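/- Let N ≥ 3, let p ≥ q > 0 with pq > 1, and let a, b > −2. Assume the quadruple (p,q,a,b) is supercritical and 0 ≤ a − b ≤ (N−2)(p−q). If the Lane–Emden system (LE) with the same parameters p, q admits no bounded positive solution (u,v) ∈ C^∞(ℝ^N) × C^∞(ℝ^N), then the Hénon–Lane–Emden system (HLE) admits no positive solution (u,v) with ∫_{ℝ^N} u(x)^{N/α̃} dx < ∞. -/

import Mathlib

open MeasureTheory Metric Set

noncomputable section

/-- Euclidean space `ℝ^N`. -/
abbrev Euc (N : ℕ) := EuclideanSpace ℝ (Fin N)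

/-- The Laplacian of a function `f : ℝ^N → ℝ`, as the sum of the pure second
partial derivatives. -/
def lap {N : ℕ} (f : Euc N → ℝ) (x : Euc N) : ℝ :=
  ∑ i : Fin N, iteratedFDeriv ℝ 2 f x ![EuclideanSpace.single i 1, EuclideanSpace.single i 1]

/-- `(u, v)` is a solution of the Hénon–Lane–Emden system
`-Δu = |x|^a |v|^{p-1} v`, `-Δv = |x|^b |u|^{q-1} u` on `ℝ^N \ {0}`:
`u, v` are `C²` on `ℝ^N \ {0}`, continuous on `ℝ^N`, and satisfy the equations pointwise. -/
def IsHLESol {N : ℕ} (p q a b : ℝ) (u v : Euc N → ℝ) : Prop :=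
  ContDiffOn ℝ 2 u {x : Euc N | x ≠ 0} ∧ ContDiffOn ℝ 2 v {x : Euc N | x ≠ 0} ∧
  Continuous u ∧ Continuous v ∧
  (∀ x : Euc N, x ≠ 0 → -lap u x = ‖x‖ ^ a * (|v x| ^ (p - 1) * v x)) ∧
  (∀ x : Euc N, x ≠ 0 → -lap v x = ‖x‖ ^ b * (|u x| ^ (q - 1) * u x))

/-- Stability of a (positive) solution of the Hénon–Lane–Emden system on an open set `Ω`:
there exist positive `C²` functions `ξ, ζ` on `Ω` with
`-Δξ ≥ p |x|^a v^{p-1} ζ` and `-Δζ ≥ q |x|^b u^{q-1} ξ` on `Ω`. -/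
def HLEStableOn {N : ℕ} (p q a b : ℝ) (u v : Euc N → ℝ) (Ω : Set (Euc N)) : Prop :=
  ∃ ξ ζ : Euc N → ℝ, ContDiffOn ℝ 2 ξ Ω ∧ ContDiffOn ℝ 2 ζ Ω ∧
    (∀ x ∈ Ω, 0 < ξ x) ∧ (∀ x ∈ Ω, 0 < ζ x) ∧
    (∀ x ∈ Ω, p * ‖x‖ ^ a * v x ^ (p - 1) * ζ x ≤ -lap ξ x) ∧
    (∀ x ∈ Ω, q * ‖x‖ ^ b * u x ^ (q - 1) * ξ x ≤ -lap ζ x)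

/-- Stability outside a compact set `K`: stability on every open set whose closure is
compact and contained in `ℝ^N \ K`. -/
def HLEStableOutside {N : ℕ} (p q a b : ℝ) (u v : Euc N → ℝ) (K : Set (Euc N)) : Prop :=
  IsCompact K ∧
    ∀ Ω : Set (Euc N), IsOpen Ω → IsCompact (closure Ω) → closure Ω ⊆ Kᶜ →
      HLEStableOn p q a b u v Ω

/-- `(u, v)` solves the Lane–Emden system `-Δu = |v|^{p-1} v`, `-Δv = |u|^{q-1} u` on `ℝ^N`. -/
def IsLESol {N : ℕ} (p q : ℝ) (u v : Euc N → ℝ) : Prop :=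
  (∀ x : Euc N, -lap u x = |v x| ^ (p - 1) * v x) ∧
  (∀ x : Euc N, -lap v x = |u x| ^ (q - 1) * u x)

/-- Stability of a (positive) solution of the Lane–Emden system on an open set `Ω`. -/
def LEStableOn {N : ℕ} (p q : ℝ) (u v : Euc N → ℝ) (Ω : Set (Euc N)) : Prop :=
  ∃ ξ ζ : Euc N → ℝ, ContDiffOn ℝ 2 ξ Ω ∧ ContDiffOn ℝ 2 ζ Ω ∧
    (∀ x ∈ Ω, 0 < ξ x) ∧ (∀ x ∈ Ω, 0 < ζ x) ∧
    (∀ x ∈ Ω, p * v x ^ (p - 1) * ζ x ≤ -lap ξ x) ∧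
    (∀ x ∈ Ω, q * u x ^ (q - 1) * ξ x ≤ -lap ζ x)

/-- A function on `ℝ^N` is polynomially bounded. -/
def PolyBounded {N : ℕ} (w : Euc N → ℝ) : Prop :=
  ∃ K L R : ℝ, 0 < K ∧ 0 < L ∧ ∀ x : Euc N, R ≤ ‖x‖ → |w x| ≤ K * ‖x‖ ^ L

/-- The polynomial `G` from Theorem 1.4 (iii). -/
def Gpoly (p q x : ℝ) : ℝ :=
  x ^ 4 - (4 * p * q * (q + 1) / (p + 1)) * x ^ 2 +
    (2 * p * q * (q + 1) * (p + q + 2) / (p + 1) ^ 2) * x -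
    p * q * (q + 1) ^ 2 / (p + 1) ^ 2

/-- The `i`-th partial derivative. -/
def pd {N : ℕ} (i : Fin N) (f : Euc N → ℝ) (x : Euc N) : ℝ :=
  fderiv ℝ f x (EuclideanSpace.single i 1)

section PartialDerivatives

open Filter Topology

variable {N : ℕ} {f g : Euc N → ℝ} {x : Euc N} {i : Fin N}

theorem ContDiffAt.differentiableAt_two (hf : ContDiffAt ℝ 2 f x) : DifferentiableAt ℝ f x :=
  hf.differentiableAt (by norm_num)

theorem ContDiffAt.fderiv_one (hf : ContDiffAt ℝ 2 f x) : ContDiffAt ℝ 1 (fderiv ℝ f) x :=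
  hf.fderiv_right (by norm_num)

theorem ContDiffAt.pd_one (hf : ContDiffAt ℝ 2 f x) : ContDiffAt ℝ 1 (pd i f) x :=
  hf.fderiv_one.clm_apply contDiffAt_const

theorem ContDiffAt.differentiableAt_pd (hf : ContDiffAt ℝ 2 f x) :
    DifferentiableAt ℝ (pd i f) x :=
  hf.pd_one.differentiableAt (by norm_num)

theorem ContDiffAt.eventually_two (hf : ContDiffAt ℝ 2 f x) :
    ∀ᶠ y in 𝓝 x, ContDiffAt ℝ 2 f y :=
  hf.eventually (by simp)

theorem pd_pd_eq (hf : ContDiffAt ℝ 2 f x) (i j : Fin N) :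
    pd i (pd j f) x = fderiv ℝ (fderiv ℝ f) x (EuclideanSpace.single i 1)
      (EuclideanSpace.single j 1) := by
  have h := hf.fderiv_one.differentiableAt (by norm_num)
  have : HasFDerivAt (pd j f) ((fderiv ℝ (fderiv ℝ f) x).flip (EuclideanSpace.single j 1)) x := by
    have h2 := h.hasFDerivAt.clm_apply (hasFDerivAt_const (EuclideanSpace.single j (1:ℝ)) x)
    simp only [ContinuousLinearMap.comp_zero, zero_add] at h2
    exact h2
  rw [pd, this.fderiv]
  rfl

theorem pd_comm (hf : ContDiffAt ℝ 2 f x) (i j : Fin N) :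
    pd i (pd j f) x = pd j (pd i f) x := by
  rw [pd_pd_eq hf, pd_pd_eq hf]
  exact (hf.isSymmSndFDerivAt (by simp)) _ _

theorem lap_eq (hf : ContDiffAt ℝ 2 f x) : lap f x = ∑ i, pd i (pd i f) x := by
  refine Finset.sum_congr rfl fun i _ => ?_
  rw [pd_pd_eq hf, iteratedFDeriv_two_apply]
  rfl

theorem pd_congr (h : f =ᶠ[𝓝 x] g) : pd i f x = pd i g x := by
  rw [pd, pd, h.fderiv_eq]

theorem lap_congr (h : f =ᶠ[𝓝 x] g) : lap f x = lap g x := by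
  have := (h.iteratedFDeriv ℝ 2).eq_of_nhds
  simp only [lap, this]

theorem pd_add (hf : DifferentiableAt ℝ f x) (hg : DifferentiableAt ℝ g x) :
    pd i (fun y => f y + g y) x = pd i f x + pd i g x := by
  simp [pd, fderiv_fun_add hf hg]

theorem pd_mul (hf : DifferentiableAt ℝ f x) (hg : DifferentiableAt ℝ g x) :
    pd i (fun y => f y * g y) x = pd i f x * g x + f x * pd i g x := by
  simp [pd, fderiv_fun_mul hf hg]; ring

theorem pd_const_mul (c : ℝ) (hf : DifferentiableAt ℝ f x) :
    pd i (fun y => c * f y) x = c * pd i f x := by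
  simp [pd, fderiv_const_mul hf]

theorem pd_comp {φ : ℝ → ℝ} {φ' : ℝ} (hφ : HasDerivAt φ φ' (f x)) (hf : DifferentiableAt ℝ f x) :
    pd i (fun y => φ (f y)) x = φ' * pd i f x := by
  have := (hφ.comp_hasFDerivAt x hf.hasFDerivAt).fderiv
  simp only [Function.comp_def] at this
  simp [pd, this]

theorem lap_add (hf : ContDiffAt ℝ 2 f x) (hg : ContDiffAt ℝ 2 g x) :
    lap (fun y => f y + g y) x = lap f x + lap g x := by
  simp only [lap, ← Finset.sum_add_distrib]
  refine Finset.sum_congr rfl fun i _ => ?_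
  rw [show (fun y => f y + g y) = f + g from rfl, iteratedFDeriv_add_apply hf hg]
  rfl

theorem lap_const_mul (c : ℝ) (hf : ContDiffAt ℝ 2 f x) :
    lap (fun y => c * f y) x = c * lap f x := by
  simp only [lap, Finset.mul_sum]
  refine Finset.sum_congr rfl fun i _ => ?_
  rw [show (fun y => c * f y) = c • f from rfl, iteratedFDeriv_const_smul_apply hf]
  rfl

theorem lap_const (c : ℝ) : lap (fun _ : Euc N => c) x = 0 := by
  rw [lap_eq contDiffAt_const]
  refine Finset.sum_eq_zero fun i _ => ?_
  have : pd i (fun _ : Euc N => c) = fun _ => 0 := by ext; simp [pd]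
  rw [this]; simp [pd]

theorem lap_sub (hf : ContDiffAt ℝ 2 f x) (hg : ContDiffAt ℝ 2 g x) :
    lap (fun y => f y - g y) x = lap f x - lap g x := by
  have := lap_add hf (contDiffAt_const.mul hg : ContDiffAt ℝ 2 (fun y => (-1) * g y) x)
  rw [lap_const_mul _ hg] at this
  simpa [sub_eq_add_neg] using this

theorem lap_mul (hf : ContDiffAt ℝ 2 f x) (hg : ContDiffAt ℝ 2 g x) :
    lap (fun y => f y * g y) x
      = lap f x * g x + 2 * ∑ i, pd i f x * pd i g x + f x * lap g x := by
  rw [lap_eq (hf.mul hg), lap_eq hf, lap_eq hg, Finset.sum_mul, Finset.mul_sum, Finset.mul_sum,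
    ← Finset.sum_add_distrib, ← Finset.sum_add_distrib]
  refine Finset.sum_congr rfl fun i _ => ?_
  have h : pd i (fun y => f y * g y) =ᶠ[𝓝 x] fun y => pd i f y * g y + f y * pd i g y := by
    filter_upwards [hf.eventually_two, hg.eventually_two] with y h1 h2
    exact pd_mul h1.differentiableAt_two h2.differentiableAt_two
  rw [pd_congr h, pd_add (f := fun y => pd i f y * g y) (g := fun y => f y * pd i g y)
    (hf.differentiableAt_pd.mul hg.differentiableAt_two)
    (hf.differentiableAt_two.mul hg.differentiableAt_pd),
    pd_mul hf.differentiableAt_pd hg.differentiableAt_two,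
    pd_mul hf.differentiableAt_two hg.differentiableAt_pd]
  ring

theorem lap_comp {φ φ₁ : ℝ → ℝ} {φ₂ : ℝ} (hf : ContDiffAt ℝ 2 f x)
    (hc : ContDiffAt ℝ 2 φ (f x))
    (h1 : ∀ᶠ t in 𝓝 (f x), HasDerivAt φ (φ₁ t) t) (h2 : HasDerivAt φ₁ φ₂ (f x)) :
    lap (fun y => φ (f y)) x = φ₁ (f x) * lap f x + φ₂ * ∑ i, pd i f x ^ 2 := by
  rw [lap_eq (f := fun y => φ (f y)) (hc.comp x hf), lap_eq hf, Finset.mul_sum, Finset.mul_sum, ← Finset.sum_add_distrib]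
  refine Finset.sum_congr rfl fun i _ => ?_
  have h : pd i (fun y => φ (f y)) =ᶠ[𝓝 x] fun y => φ₁ (f y) * pd i f y := by
    filter_upwards [hf.eventually_two, hf.continuousAt.eventually h1] with y h1 h2
    exact pd_comp h2 h1.differentiableAt_two
  have hd : DifferentiableAt ℝ (fun y => φ₁ (f y)) x :=
    (h2.differentiableAt.comp x hf.differentiableAt_two :)
  rw [pd_congr h, pd_mul hd hf.differentiableAt_pd, pd_comp h2 hf.differentiableAt_two]
  ring

theorem pd_normSq : pd i (fun y : Euc N => ‖y‖ ^ 2) x = 2 * x i := by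
  have := (hasStrictFDerivAt_norm_sq x).hasFDerivAt.fderiv
  simp [pd, this, EuclideanSpace.inner_single_right]

theorem lap_normSq : lap (fun y : Euc N => ‖y‖ ^ 2) x = 2 * N := by
  rw [lap_eq (contDiff_norm_sq ℝ).contDiffAt]
  have h : ∀ i : Fin N, pd i (pd i (fun y : Euc N => ‖y‖ ^ 2)) x = 2 := by
    intro i
    have h1 : pd i (fun y : Euc N => ‖y‖ ^ 2) = fun y => 2 * y i := by ext y; exact pd_normSq
    have h2 : HasFDerivAt (fun y : Euc N => 2 * y i)
        ((2:ℝ) • (EuclideanSpace.proj i : Euc N →L[ℝ] ℝ)) x :=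
      ((EuclideanSpace.proj i : Euc N →L[ℝ] ℝ).hasFDerivAt).const_mul 2
    rw [h1, pd, h2.fderiv]; simp
  simp [h]; ring

theorem pd_coord (j : Fin N) : pd i (fun y : Euc N => y j) x = if i = j then 1 else 0 := by
  have h2 : HasFDerivAt (fun y : Euc N => y j) (EuclideanSpace.proj j : Euc N →L[ℝ] ℝ) x :=
    (EuclideanSpace.proj j : Euc N →L[ℝ] ℝ).hasFDerivAt
  rw [pd, h2.fderiv]; simp [eq_comm]

theorem contDiffAt_norm_rpow (k : ℝ) (hx : x ≠ 0) {n : WithTop ℕ∞} :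
    ContDiffAt ℝ n (fun y : Euc N => ‖y‖ ^ k) x :=
  (contDiffAt_norm ℝ hx).rpow_const_of_ne (norm_ne_zero_iff.2 hx)

theorem norm_rpow_eq_normSq (k : ℝ) :
    (fun y : Euc N => ‖y‖ ^ k) = fun y : Euc N => (‖y‖ ^ 2) ^ (k / 2) := by
  ext y
  rw [← Real.rpow_natCast, ← Real.rpow_mul (norm_nonneg y)]; congr 1; push_cast; ring

theorem pd_norm_rpow (k : ℝ) (hx : x ≠ 0) :
    pd i (fun y : Euc N => ‖y‖ ^ k) x = k * ‖x‖ ^ (k - 2) * x i := by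
  have hpos : 0 < ‖x‖ := norm_pos_iff.2 hx
  rw [norm_rpow_eq_normSq, pd_comp (φ := fun t => t ^ (k / 2)) (f := fun y : Euc N => ‖y‖ ^ 2) (φ' := k / 2 * (‖x‖ ^ 2) ^ (k / 2 - 1))
    (Real.hasDerivAt_rpow_const (Or.inl (by positivity)))
    ((contDiff_norm_sq ℝ).contDiffAt.differentiableAt_two), pd_normSq]
  rw [← Real.rpow_natCast, ← Real.rpow_mul (norm_nonneg x)]
  rw [show ((2:ℕ):ℝ) * (k / 2 - 1) = k - 2 by push_cast; ring]; ring

theorem sum_sq_eq_norm_sq (x : Euc N) : ∑ i, x i ^ 2 = ‖x‖ ^ 2 :=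
  (EuclideanSpace.real_norm_sq_eq x).symm

theorem lap_norm_rpow (k : ℝ) (hx : x ≠ 0) :
    lap (fun y : Euc N => ‖y‖ ^ k) x = k * (k + N - 2) * ‖x‖ ^ (k - 2) := by
  have hpos : 0 < ‖x‖ := norm_pos_iff.2 hx
  have h0 : ‖x‖ ^ 2 ≠ 0 := by positivity
  rw [norm_rpow_eq_normSq, lap_comp (φ := fun t => t ^ (k / 2))
    (φ₁ := fun t => k / 2 * t ^ (k / 2 - 1))
    (φ₂ := k / 2 * ((k / 2 - 1) * (‖x‖ ^ 2) ^ (k / 2 - 1 - 1)))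
    (contDiff_norm_sq ℝ).contDiffAt (Real.contDiffAt_rpow_const_of_ne h0)
    ((isOpen_ne.eventually_mem h0).mono fun t ht => Real.hasDerivAt_rpow_const (Or.inl ht))
    ((Real.hasDerivAt_rpow_const (Or.inl h0)).const_mul _), lap_normSq]
  simp only [pd_normSq, mul_pow, ← Finset.mul_sum, sum_sq_eq_norm_sq]
  rw [Real.rpow_sub_one h0 (k / 2 - 1)]
  have : (‖x‖ ^ 2) ^ (k / 2 - 1) = ‖x‖ ^ (k - 2) := by
    rw [← Real.rpow_natCast, ← Real.rpow_mul (norm_nonneg x)]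
    congr 1; push_cast; ring
  rw [this]
  field_simp
  ring

/-- At a local maximum the Laplacian is nonpositive. -/
theorem IsLocalMax.lap_nonpos (h : IsLocalMax f x) (hf : ContDiffAt ℝ 2 f x) : lap f x ≤ 0 := by
  rw [lap_eq hf]
  refine Finset.sum_nonpos fun i _ => ?_
  set e : Euc N := EuclideanSpace.single i 1
  let l : ℝ → Euc N := fun t => x + t • e
  have hl : ∀ t, HasDerivAt l e t := fun t => by
    simpa only [one_smul, id] using ((hasDerivAt_id t).smul_const e).const_add x
  have hl0 : l 0 = x := by simp [l]
  have hcl : ContinuousAt l 0 := (hl 0).continuousAt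
  have htl : Tendsto l (𝓝 0) (𝓝 x) := by simpa [hl0] using hcl.tendsto
  have hev : ∀ᶠ t in 𝓝 (0:ℝ), HasDerivAt (fun t => f (l t)) (pd i f (l t)) t := by
    filter_upwards [htl.eventually hf.eventually_two] with t ht
    exact ht.differentiableAt_two.hasFDerivAt.comp_hasDerivAt t (hl t)
  have hd1 : deriv (fun t => f (l t)) =ᶠ[𝓝 0] fun t => pd i f (l t) :=
    hev.mono fun t ht => ht.deriv
  have hd2 : deriv (deriv (fun t => f (l t))) 0 = pd i (pd i f) x := by
    rw [hd1.deriv_eq]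
    have h2 : HasFDerivAt (pd i f) (fderiv ℝ (pd i f) x) (l 0) := by
      rw [hl0]; exact hf.differentiableAt_pd.hasFDerivAt
    exact (h2.comp_hasDerivAt 0 (hl 0)).deriv
  by_contra! hpos
  have hmax : IsLocalMax (fun t => f (l t)) 0 := by
    have := htl.eventually h
    simpa [IsLocalMax, IsMaxFilter, hl0] using this
  have hmin := isLocalMin_of_deriv_deriv_pos (f := fun t => f (l t)) (x₀ := 0) (by rw [hd2]; exact hpos)
    hmax.deriv_eq_zero hev.self_of_nhds.continuousAt
  have hconst : (fun t => f (l t)) =ᶠ[𝓝 0] fun _ => f (l 0) := by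
    filter_upwards [hmax, hmin] with t h1 h2 using le_antisymm h1 h2
  have h3 : deriv (deriv (fun t => f (l t))) 0 = 0 := by
    rw [hconst.deriv.deriv_eq]; simp
  rw [hd2] at h3
  linarith

end PartialDerivatives

section MeanValue

open Filter Topology

variable {N : ℕ}

theorem fderiv_apply_eq_sum (f : Euc N → ℝ) (x z : Euc N) :
    fderiv ℝ f x z = ∑ i, z i * pd i f x := by
  have hz : z = ∑ i, z i • (EuclideanSpace.single i (1:ℝ) : Euc N) := by
    have := (EuclideanSpace.basisFun (Fin N) ℝ).sum_repr z
    simpa using this.symm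
  conv_lhs => rw [hz]
  simp [pd, map_sum]

/-- The radial weight `(1 - |z|²)₊` used for averaging. -/
def wt (z : Euc N) : ℝ := max (1 - ‖z‖ ^ 2) 0

/-- A primitive of the weight: `∇ wtPrim z = - wt z • z`. -/
def wtPrim (z : Euc N) : ℝ := (max (1 - ‖z‖ ^ 2) 0) ^ 2 / 4

theorem wt_nonneg (z : Euc N) : 0 ≤ wt z := le_max_right _ _

theorem wt_le_one (z : Euc N) : wt z ≤ 1 := max_le (by nlinarith [sq_nonneg ‖z‖]) zero_le_one

theorem wtPrim_nonneg (z : Euc N) : 0 ≤ wtPrim z := by unfold wtPrim; positivity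

theorem wt_eq_zero {z : Euc N} (hz : 1 ≤ ‖z‖) : wt z = 0 :=
  max_eq_right (by nlinarith)

theorem wtPrim_eq_zero {z : Euc N} (hz : 1 ≤ ‖z‖) : wtPrim z = 0 := by
  simp [wtPrim, max_eq_right (show 1 - ‖z‖ ^ 2 ≤ 0 by nlinarith)]

theorem continuous_wt : Continuous (wt : Euc N → ℝ) := by unfold wt; fun_prop

theorem hasCompactSupport_of_eq_zero {f : Euc N → ℝ} {R : ℝ} (h : ∀ z, R ≤ ‖z‖ → f z = 0) :
    HasCompactSupport f :=
  HasCompactSupport.intro (isCompact_closedBall (0 : Euc N) R) fun z hz => h z (by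
    simp only [mem_closedBall, dist_zero_right, not_le] at hz; exact hz.le)

theorem hasCompactSupport_wt : HasCompactSupport (wt : Euc N → ℝ) :=
  hasCompactSupport_of_eq_zero fun _ => wt_eq_zero

theorem hasCompactSupport_wtPrim : HasCompactSupport (wtPrim : Euc N → ℝ) :=
  hasCompactSupport_of_eq_zero fun _ => wtPrim_eq_zero

theorem integral_wt_pos : 0 < ∫ z : Euc N, wt z := by
  refine continuous_wt.integral_pos_of_hasCompactSupport_nonneg_nonzero hasCompactSupport_wt
    wt_nonneg (x := 0) ?_
  simp [wt]

theorem integrable_mul_wt {f : Euc N → ℝ} (hf : Continuous f) :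
    Integrable (fun z => f z * wt z) :=
  (hf.mul continuous_wt).integrable_of_hasCompactSupport hasCompactSupport_wt.mul_left

theorem hasDerivAt_max_sq (t : ℝ) :
    HasDerivAt (fun t : ℝ => (max t 0) ^ 2) (2 * max t 0) t := by
  rcases lt_trichotomy t 0 with h | h | h
  · have : (fun t : ℝ => (max t 0) ^ 2) =ᶠ[𝓝 t] fun _ => 0 := by
      filter_upwards [eventually_lt_nhds h] with s hs
      simp [max_eq_right hs.le]
    rw [max_eq_right h.le, mul_zero]
    exact (hasDerivAt_const t (0:ℝ)).congr_of_eventuallyEq this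
  · subst h
    simp only [max_self, mul_zero]
    rw [hasDerivAt_iff_isLittleO_nhds_zero]
    have : (fun h : ℝ => (max (0 + h) 0) ^ 2 - (max (0:ℝ) 0) ^ 2 - h • (0:ℝ))
        =O[𝓝 0] fun h => h ^ 2 := by
      refine Asymptotics.IsBigO.of_bound 1 (Eventually.of_forall fun h => ?_)
      simp only [zero_add, max_self, smul_zero, sub_zero, Real.norm_eq_abs, one_mul]
      rw [zero_pow two_ne_zero, sub_zero, abs_of_nonneg (by positivity), abs_of_nonneg (by positivity)]
      rcases max_cases h 0 with ⟨h1, _⟩ | ⟨h1, _⟩ <;> rw [h1]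
      rw [zero_pow two_ne_zero]; positivity
    exact this.trans_isLittleO (Asymptotics.isLittleO_pow_id (by norm_num))
  · have : (fun t : ℝ => (max t 0) ^ 2) =ᶠ[𝓝 t] fun s => s ^ 2 := by
      filter_upwards [eventually_gt_nhds h] with s hs
      simp [max_eq_left hs.le]
    rw [max_eq_left h.le]
    simpa using (hasDerivAt_pow 2 t).congr_of_eventuallyEq this

theorem hasFDerivAt_wtPrim (z : Euc N) :
    HasFDerivAt wtPrim (-(wt z) • innerSL ℝ z) z := by
  have h1 : HasFDerivAt (fun z : Euc N => 1 - ‖z‖ ^ 2) (-(2 • innerSL ℝ z)) z :=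
    ((hasStrictFDerivAt_norm_sq z).hasFDerivAt).const_sub 1
  have h2 := ((hasDerivAt_max_sq (1 - ‖z‖ ^ 2)).div_const 4).comp_hasFDerivAt z h1
  refine HasFDerivAt.congr_fderiv h2 ?_
  ext w
  simp [wt]; ring

theorem pd_wtPrim (i : Fin N) (z : Euc N) : pd i wtPrim z = -(z i * wt z) := by
  rw [pd, (hasFDerivAt_wtPrim z).fderiv]
  simp [EuclideanSpace.inner_single_right]; ring

theorem differentiable_wtPrim : Differentiable ℝ (wtPrim : Euc N → ℝ) :=
  fun z => (hasFDerivAt_wtPrim z).differentiableAt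

theorem integral_pd_mul_wt {g : Euc N → ℝ} (hg : ContDiff ℝ 1 g) (i : Fin N) :
    ∫ z, g z * (z i * wt z) = ∫ z, pd i g z * wtPrim z := by
  have hc : Continuous (pd i g) := (hg.continuous_fderiv (by norm_num)).clm_apply continuous_const
  have hpd : pd i (wtPrim : Euc N → ℝ) = fun z => -(z i * wt z) := funext fun z => pd_wtPrim i z
  have h := integral_mul_fderiv_eq_neg_fderiv_mul_of_integrable (μ := (volume : Measure (Euc N)))
    (f := g) (g := wtPrim) (v := EuclideanSpace.single i 1)
    ((hc.mul differentiable_wtPrim.continuous).integrable_of_hasCompactSupport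
      hasCompactSupport_wtPrim.mul_left)
    (by
      change Integrable fun x => g x * pd i wtPrim x
      rw [hpd]
      refine Continuous.integrable_of_hasCompactSupport ?_ ?_
      · exact hg.continuous.mul
          (((EuclideanSpace.proj i : Euc N →L[ℝ] ℝ).continuous.mul continuous_wt).neg)
      · exact hasCompactSupport_of_eq_zero (R := 1) fun z hz => by simp [wt_eq_zero hz])
    ((hg.continuous.mul differentiable_wtPrim.continuous).integrable_of_hasCompactSupport
      hasCompactSupport_wtPrim.mul_left)
    (fun x _ => hg.differentiable (by norm_num) x) (fun x _ => differentiable_wtPrim x)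
  change ∫ x, g x * pd i wtPrim x = -∫ x, pd i g x * wtPrim x at h
  rw [hpd] at h
  simp only [mul_neg, integral_neg, neg_inj] at h
  exact h

theorem pd_comp_affine {F : Euc N → ℝ} (x₀ : Euc N) (s : ℝ) (i : Fin N) (z : Euc N)
    (hF : DifferentiableAt ℝ F (x₀ + s • z)) :
    pd i (fun z => F (x₀ + s • z)) z = s * pd i F (x₀ + s • z) := by
  have h1 : HasFDerivAt (fun z : Euc N => x₀ + s • z) (s • ContinuousLinearMap.id ℝ (Euc N)) z :=
    ((hasFDerivAt_id z).const_smul s).const_add x₀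
  have h2 := (hF.hasFDerivAt.comp z h1).fderiv
  simp only [Function.comp_def] at h2
  simp [pd, h2]

theorem hasDerivAt_mean {F : Euc N → ℝ} (hF : ContDiff ℝ 2 F) (x₀ : Euc N) (s : ℝ) :
    HasDerivAt (fun s : ℝ => ∫ z, F (x₀ + s • z) * wt z)
      (s * ∫ z, lap F (x₀ + s • z) * wtPrim z) s := by
  have hcF := hF.continuous
  have hcD : Continuous (fderiv ℝ F) := hF.continuous_fderiv (by norm_num)
  obtain ⟨C, hC⟩ := ((isCompact_closedBall s 1).prod
    (isCompact_closedBall (0 : Euc N) 1)).exists_bound_of_continuousOn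
    (f := fun y : ℝ × Euc N => fderiv ℝ F (x₀ + y.1 • y.2) y.2) (by fun_prop)
  have key := hasDerivAt_integral_of_dominated_loc_of_deriv_le (μ := (volume : Measure (Euc N)))
    (F := fun (s : ℝ) z => F (x₀ + s • z) * wt z) (x₀ := s)
    (F' := fun (s : ℝ) z => fderiv ℝ F (x₀ + s • z) z * wt z) (bound := fun z => C * wt z)
    (s := closedBall s 1) (closedBall_mem_nhds s one_pos)
    (Eventually.of_forall fun t => (integrable_mul_wt (by fun_prop)).aestronglyMeasurable)
    (integrable_mul_wt (by fun_prop))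
    (integrable_mul_wt (by fun_prop)).aestronglyMeasurable
    (Eventually.of_forall fun z t ht => by
      rw [norm_mul, Real.norm_of_nonneg (wt_nonneg z)]
      rcases le_or_gt 1 ‖z‖ with hz | hz
      · simp [wt_eq_zero hz]
      · exact mul_le_mul_of_nonneg_right
          (hC (t, z) ⟨ht, by simpa using hz.le⟩) (wt_nonneg z))
    (integrable_mul_wt continuous_const)
    (Eventually.of_forall fun z t _ => by
      have h1 : HasDerivAt (fun t : ℝ => x₀ + t • z) z t := by
        simpa only [one_smul, id] using ((hasDerivAt_id t).smul_const z).const_add x₀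
      exact ((hF.differentiable (by norm_num) _).hasFDerivAt.comp_hasDerivAt t h1).mul_const _)
  refine key.2.congr_deriv ?_
  have hpdc : ∀ i, ContDiff ℝ 1 (pd i F) := fun i =>
    contDiff_iff_contDiffAt.2 fun y => hF.contDiffAt.pd_one
  have hcomp : ∀ i, ContDiff ℝ 1 (fun z => pd i F (x₀ + s • z)) := fun i =>
    (hpdc i).comp (by fun_prop)
  calc ∫ z, fderiv ℝ F (x₀ + s • z) z * wt z
      = ∫ z, ∑ i, pd i F (x₀ + s • z) * (z i * wt z) := by
        refine integral_congr_ae (Eventually.of_forall fun z => ?_)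
        simp only [fderiv_apply_eq_sum, Finset.sum_mul]
        exact Finset.sum_congr rfl fun i _ => by ring
    _ = ∑ i, ∫ z, pd i F (x₀ + s • z) * (z i * wt z) := by
        refine integral_finsetSum _ fun i _ => ?_
        have := integrable_mul_wt (f := fun z : Euc N => pd i F (x₀ + s • z) * z i)
          ((hcomp i).continuous.mul (EuclideanSpace.proj i : Euc N →L[ℝ] ℝ).continuous)
        simpa only [mul_assoc] using this
    _ = ∑ i, ∫ z, (s * pd i (pd i F) (x₀ + s • z)) * wtPrim z := by
        refine Finset.sum_congr rfl fun i _ => ?_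
        rw [integral_pd_mul_wt (hcomp i)]
        refine integral_congr_ae (Eventually.of_forall fun z => ?_)
        simp only
        rw [pd_comp_affine _ _ _ _ ((hpdc i).differentiable (by norm_num) _)]
    _ = ∫ z, ∑ i, (s * pd i (pd i F) (x₀ + s • z)) * wtPrim z := by
        refine (integral_finsetSum _ fun i _ => ?_).symm
        refine Continuous.integrable_of_hasCompactSupport ?_ hasCompactSupport_wtPrim.mul_left
        have : Continuous (pd i (pd i F)) :=
          ((hpdc i).continuous_fderiv (by norm_num)).clm_apply continuous_const
        have h3 := (differentiable_wtPrim (N := N)).continuous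
        fun_prop
    _ = s * ∫ z, lap F (x₀ + s • z) * wtPrim z := by
        rw [← integral_const_mul]
        refine integral_congr_ae (Eventually.of_forall fun z => ?_)
        simp only
        rw [lap_eq hF.contDiffAt, Finset.sum_mul, Finset.mul_sum]
        exact Finset.sum_congr rfl fun i _ => by ring

/-- Sub-mean value property for weighted averages. -/
theorem sub_mean {F : Euc N → ℝ} (hF : ContDiff ℝ 2 F) {x₀ : Euc N} {r : ℝ} (hr : 0 ≤ r)
    (h : ∀ y ∈ ball x₀ r, 0 ≤ lap F y) :
    F x₀ * ∫ z : Euc N, wt z ≤ ∫ z, F (x₀ + r • z) * wt z := by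
  have hd := fun s => hasDerivAt_mean hF x₀ s
  have hm : MonotoneOn (fun s : ℝ => ∫ z, F (x₀ + s • z) * wt z) (Icc 0 r) := by
    refine monotoneOn_of_deriv_nonneg (convex_Icc 0 r)
      (fun s _ => (hd s).continuousAt.continuousWithinAt)
      (fun s _ => (hd s).differentiableAt.differentiableWithinAt) fun s hs => ?_
    rw [interior_Icc] at hs
    rw [(hd s).deriv]
    refine mul_nonneg hs.1.le (integral_nonneg fun z => ?_)
    rcases le_or_gt 1 ‖z‖ with hz | hz
    · simp [wtPrim_eq_zero hz]
    · refine mul_nonneg (h _ ?_) (wtPrim_nonneg z)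
      simp only [mem_ball, dist_self_add_left, norm_smul, Real.norm_eq_abs, abs_of_pos hs.1]
      nlinarith [hs.1, hs.2, norm_nonneg z]
  have := hm (left_mem_Icc.2 hr) (right_mem_Icc.2 hr) hr
  simpa [integral_const_mul] using this

end MeanValue

section Subharmonic

open Filter Topology

variable {N : ℕ}

theorem hasDerivAt_comp_max_zero {g g' : ℝ → ℝ} {t : ℝ}
    (hg : HasDerivAt g (g' (max t 0)) (max t 0)) (h0 : g' 0 = 0) :
    HasDerivAt (fun t => g (max t 0)) (g' (max t 0)) t := by
  rcases lt_trichotomy t 0 with h | h | h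
  · have : (fun t => g (max t 0)) =ᶠ[𝓝 t] fun _ => g 0 := by
      filter_upwards [eventually_lt_nhds h] with s hs
      rw [max_eq_right hs.le]
    rw [max_eq_right h.le, h0]
    exact (hasDerivAt_const t (g 0)).congr_of_eventuallyEq this
  · subst h
    rw [max_self, h0] at hg
    rw [max_self, h0]
    have h1 : HasDerivWithinAt (fun t => g (max t 0)) 0 (Iic 0) 0 :=
      (hasDerivWithinAt_const (0:ℝ) (Iic 0) (g 0)).congr
        (fun s hs => by rw [max_eq_right hs]) (by simp)
    have h2 : HasDerivWithinAt (fun t => g (max t 0)) 0 (Ici 0) 0 :=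
      hg.hasDerivWithinAt.congr (fun s hs => by rw [max_eq_left hs]) (by simp)
    simpa [Iic_union_Ici, hasDerivWithinAt_univ] using h1.union h2
  · have : (fun t => g (max t 0)) =ᶠ[𝓝 t] g := by
      filter_upwards [eventually_gt_nhds h] with s hs
      rw [max_eq_left hs.le]
    rw [max_eq_left h.le] at hg ⊢
    exact hg.congr_of_eventuallyEq this

/-- A `C²` convex approximation of the positive part. -/
def softPos (t : ℝ) : ℝ := (max t 0) ^ 3 / (1 + max t 0) ^ 2

/-- First derivative of `softPos`. -/
def softPos₁ (t : ℝ) : ℝ := ((max t 0) ^ 3 + 3 * (max t 0) ^ 2) / (1 + max t 0) ^ 3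

/-- Second derivative of `softPos`. -/
def softPos₂ (t : ℝ) : ℝ := 6 * max t 0 / (1 + max t 0) ^ 4

theorem hasDerivAt_softPos (t : ℝ) : HasDerivAt softPos (softPos₁ t) t := by
  refine hasDerivAt_comp_max_zero (g := fun s => s ^ 3 / (1 + s) ^ 2)
    (g' := fun s => (s ^ 3 + 3 * s ^ 2) / (1 + s) ^ 3) ?_ (by simp)
  set s := max t 0
  have hs : 0 ≤ s := le_max_right _ _
  have h1 : HasDerivAt (fun s : ℝ => 1 + s) 1 s := (hasDerivAt_id s).const_add 1
  have hs1 : 1 + s ≠ 0 := by positivity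
  refine ((hasDerivAt_pow 3 s).div (h1.pow 2) (pow_ne_zero _ hs1)).congr_deriv ?_
  simp only [Pi.pow_apply]
  field_simp
  ring

theorem hasDerivAt_softPos₁ (t : ℝ) : HasDerivAt softPos₁ (softPos₂ t) t := by
  refine hasDerivAt_comp_max_zero (g := fun s => (s ^ 3 + 3 * s ^ 2) / (1 + s) ^ 3)
    (g' := fun s => 6 * s / (1 + s) ^ 4) ?_ (by simp)
  set s := max t 0
  have hs : 0 ≤ s := le_max_right _ _
  have h1 : HasDerivAt (fun s : ℝ => 1 + s) 1 s := (hasDerivAt_id s).const_add 1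
  have hs1 : 1 + s ≠ 0 := by positivity
  refine (((hasDerivAt_pow 3 s).add ((hasDerivAt_pow 2 s).const_mul 3)).div (h1.pow 3)
    (pow_ne_zero _ hs1)).congr_deriv ?_
  simp only [Pi.pow_apply, Pi.add_apply]
  field_simp
  ring

theorem contDiff_softPos : ContDiff ℝ 2 softPos := by
  have h1 : deriv softPos = softPos₁ := funext fun t => (hasDerivAt_softPos t).deriv
  have h2 : deriv softPos₁ = softPos₂ := funext fun t => (hasDerivAt_softPos₁ t).deriv
  have h3 : Continuous softPos₂ := by
    unfold softPos₂
    refine Continuous.div (by fun_prop) (by fun_prop) fun t => ?_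
    have : 0 ≤ max t 0 := le_max_right _ _
    positivity
  have h4 : ContDiff ℝ 1 softPos₁ := contDiff_one_iff_deriv.2
    ⟨fun t => (hasDerivAt_softPos₁ t).differentiableAt, by rwa [h2]⟩
  rw [show (2 : WithTop ℕ∞) = 1 + 1 by norm_num, contDiff_succ_iff_deriv]
  exact ⟨fun t => (hasDerivAt_softPos t).differentiableAt, by simp, by rwa [h1]⟩

theorem softPos_of_nonpos {t : ℝ} (h : t ≤ 0) : softPos t = 0 := by simp [softPos, max_eq_right h]

theorem softPos_le (t : ℝ) : softPos t ≤ max t 0 := by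
  unfold softPos
  have : 0 ≤ max t 0 := le_max_right _ _
  rw [div_le_iff₀ (by positivity)]
  nlinarith [mul_nonneg this this]

theorem sub_two_le_softPos (t : ℝ) : t - 2 ≤ softPos t := by
  unfold softPos
  have h : 0 ≤ max t 0 := le_max_right _ _
  refine le_trans (sub_le_sub_right (le_max_left t 0) 2) ?_
  rw [le_div_iff₀ (by positivity)]
  nlinarith [mul_nonneg h h]

theorem softPos₁_nonneg (t : ℝ) : 0 ≤ softPos₁ t := by
  have h : 0 ≤ max t 0 := le_max_right _ _
  unfold softPos₁; positivity

theorem softPos₂_nonneg (t : ℝ) : 0 ≤ softPos₂ t := by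
  have h : 0 ≤ max t 0 := le_max_right _ _
  unfold softPos₂; positivity

theorem eventually_ne_zero_of_ne {x : Euc N} (hx : x ≠ 0) : ∀ᶠ y in 𝓝 x, y ≠ 0 :=
  isOpen_ne.eventually_mem hx

/-- Sub-mean value inequality for the positive part of a function which is subharmonic where it
is positive, off the origin. -/
theorem sub_mean_pos {w M : Euc N → ℝ} (hw : ∀ x, x ≠ 0 → ContDiffAt ℝ 2 w x)
    (h0 : ∀ᶠ x in 𝓝[≠] 0, w x < 0) (hl : ∀ x, x ≠ 0 → 0 < w x → 0 ≤ lap w x)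
    (hM : Continuous M) (hM0 : ∀ x, 0 ≤ M x) (hwM : ∀ x, x ≠ 0 → w x ≤ M x)
    {x₀ : Euc N} (hx₀ : x₀ ≠ 0) {r : ℝ} (hr : 0 ≤ r) :
    w x₀ * ∫ z : Euc N, wt z ≤ ∫ z, M (x₀ + r • z) * wt z := by
  have hI : 0 < ∫ z : Euc N, wt z := integral_wt_pos
  have key : ∀ k : ℝ, 0 < k → (k * w x₀ - 2) * ∫ z : Euc N, wt z
      ≤ k * ∫ z, M (x₀ + r • z) * wt z := by
    intro k hk
    classical
    let F : Euc N → ℝ := fun x => if x = 0 then 0 else softPos (k * w x)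
    have hF0 : F =ᶠ[𝓝 0] fun _ => 0 := by
      rw [eventually_nhdsWithin_iff] at h0
      filter_upwards [h0] with x hx
      by_cases h : x = 0
      · simp [F, h]
      · simp only [F, h, if_false]
        exact softPos_of_nonpos (mul_nonpos_of_nonneg_of_nonpos hk.le (hx h).le)
    have hF1 : ∀ x, x ≠ 0 → F =ᶠ[𝓝 x] fun y => softPos (k * w y) := by
      intro x hx
      filter_upwards [eventually_ne_zero_of_ne hx] with y hy
      simp [F, hy]
    have hkw : ∀ x, x ≠ 0 → ContDiffAt ℝ 2 (fun y => k * w y) x := fun x hx =>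
      contDiffAt_const.mul (hw x hx)
    have hFc : ContDiff ℝ 2 F := by
      rw [contDiff_iff_contDiffAt]
      intro x
      by_cases hx : x = 0
      · subst hx
        exact contDiffAt_const.congr_of_eventuallyEq hF0
      · exact (contDiff_softPos.contDiffAt.comp x (hkw x hx)).congr_of_eventuallyEq (hF1 x hx)
    have hlF : ∀ x, 0 ≤ lap F x := by
      intro x
      by_cases hx : x = 0
      · subst hx
        rw [lap_congr hF0, lap_const]
      · rw [lap_congr (hF1 x hx), lap_comp (f := fun y => k * w y) (hkw x hx)
          contDiff_softPos.contDiffAt (Eventually.of_forall hasDerivAt_softPos)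
          (hasDerivAt_softPos₁ _), lap_const_mul _ (hw x hx)]
        refine add_nonneg ?_ (mul_nonneg (softPos₂_nonneg _)
          (Finset.sum_nonneg fun i _ => sq_nonneg _))
        rcases le_or_gt (w x) 0 with h | h
        · have : softPos₁ (k * w x) = 0 := by
            simp [softPos₁, max_eq_right (mul_nonpos_of_nonneg_of_nonpos hk.le h)]
          rw [this, zero_mul]
        · exact mul_nonneg (softPos₁_nonneg _) (mul_nonneg hk.le (hl x hx h))
    have hm := sub_mean hFc hr (x₀ := x₀) fun y _ => hlF y
    have hFM : ∀ x, F x ≤ k * M x := by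
      intro x
      by_cases hx : x = 0
      · simp only [F, hx, if_true]; exact mul_nonneg hk.le (hM0 _)
      · simp only [F, hx, if_false]
        exact (softPos_le _).trans (max_le (mul_le_mul_of_nonneg_left (hwM x hx) hk.le)
          (mul_nonneg hk.le (hM0 _)))
    have hF2 : k * w x₀ - 2 ≤ F x₀ := by
      simp only [F, hx₀, if_false]; exact sub_two_le_softPos _
    calc (k * w x₀ - 2) * ∫ z : Euc N, wt z ≤ F x₀ * ∫ z : Euc N, wt z :=
          mul_le_mul_of_nonneg_right hF2 hI.le
      _ ≤ ∫ z, F (x₀ + r • z) * wt z := hm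
      _ ≤ ∫ z, k * (M (x₀ + r • z) * wt z) := by
          refine integral_mono (integrable_mul_wt ?_) ((integrable_mul_wt ?_).const_mul k)
            fun z => ?_
          · exact hFc.continuous.comp (by fun_prop)
          · exact hM.comp (by fun_prop)
          · have := mul_le_mul_of_nonneg_right (hFM (x₀ + r • z)) (wt_nonneg z)
            simpa [mul_assoc] using this
      _ = _ := integral_const_mul _ _
  by_contra! hlt
  set I := ∫ z : Euc N, wt z
  set J := ∫ z, M (x₀ + r • z) * wt z
  have hpos : 0 < w x₀ * I - J := by linarith
  have := key ((2 * I + 1) / (w x₀ * I - J)) (by positivity)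
  have h2 : (2 * I + 1) / (w x₀ * I - J) * (w x₀ * I - J) = 2 * I + 1 :=
    div_mul_cancel₀ _ hpos.ne'
  nlinarith

theorem eventually_lt_fundamental (hN : 3 ≤ N) {f : Euc N → ℝ} (hf : ContinuousAt f 0)
    {δ : ℝ} (hδ : 0 < δ) : ∀ᶠ x in 𝓝[≠] 0, f x < δ * ‖x‖ ^ (2 - (N:ℝ)) := by
  have h1 : Tendsto (fun x : Euc N => ‖x‖) (𝓝[≠] 0) (𝓝[>] 0) := tendsto_norm_nhdsNE_zero
  have hN' : (3:ℝ) ≤ N := by exact_mod_cast hN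
  have h2 : Tendsto (fun x : Euc N => δ * ‖x‖ ^ (2 - (N:ℝ))) (𝓝[≠] 0) atTop :=
    ((tendsto_rpow_neg_nhdsGT_zero (y := 2 - (N:ℝ)) (by linarith)).comp h1).const_mul_atTop hδ
  filter_upwards [h2.eventually_gt_atTop (f 0 + 1),
    (hf.tendsto.mono_left nhdsWithin_le_nhds).eventually_lt_const (lt_add_one (f 0))] with x hx hy
  exact hy.trans hx

theorem lap_fundamental {x : Euc N} (hx : x ≠ 0) :
    lap (fun y : Euc N => ‖y‖ ^ (2 - (N:ℝ))) x = 0 := by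
  rw [lap_norm_rpow _ hx]; ring

/-- Maximum principle off the origin. -/
theorem nonpos_of_lap_pos {w : Euc N → ℝ} (hw : ∀ x, x ≠ 0 → ContDiffAt ℝ 2 w x)
    (h0 : ∀ᶠ x in 𝓝[≠] 0, w x < 0) {R : ℝ} (hR : ∀ x, R ≤ ‖x‖ → x ≠ 0 → w x ≤ 0)
    (hl : ∀ x, x ≠ 0 → 0 < w x → 0 < lap w x) {x : Euc N} (hx : x ≠ 0) : w x ≤ 0 := by
  by_contra! hpos
  obtain ⟨ε, hε, hw0⟩ : ∃ ε > 0, ∀ y : Euc N, y ≠ 0 → ‖y‖ < ε → w y < 0 := by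
    rw [eventually_nhdsWithin_iff, Metric.eventually_nhds_iff] at h0
    obtain ⟨ε, hε, h⟩ := h0
    exact ⟨ε, hε, fun y hy hyε => h (by simpa using hyε) hy⟩
  let K : Set (Euc N) := closedBall 0 R \ ball 0 ε
  have hK : IsCompact K := (isCompact_closedBall 0 R).diff isOpen_ball
  have hne : ∀ y ∈ K, y ≠ 0 := fun y hy h => hy.2 (by simp [h, hε])
  have hout : ∀ y, y ≠ 0 → 0 < w y → y ∈ K := by
    intro y hy hwy
    refine ⟨?_, ?_⟩
    · simp only [mem_closedBall, dist_zero_right]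
      by_contra! h; linarith [hR y h.le hy]
    · simp only [mem_ball, dist_zero_right]
      intro h; linarith [hw0 y hy h]
  obtain ⟨y, hyK, hy⟩ := hK.exists_isMaxOn ⟨x, hout x hx hpos⟩
    (fun y hy => (hw y (hne y hy)).continuousAt.continuousWithinAt)
  have hwy : 0 < w y := hpos.trans_le (hy (hout x hx hpos))
  have hy0 := hne y hyK
  have hmax : IsLocalMax w y := by
    filter_upwards [eventually_ne_zero_of_ne hy0] with z hz
    by_cases h : 0 < w z
    · exact hy (hout z hz h)
    · linarith
  linarith [hmax.lap_nonpos (hw y hy0), hl y hy0 hwy]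

/-- Mean value inequality for functions superharmonic off the origin. -/
theorem mean_le_of_superharmonic (hN : 3 ≤ N) {v : Euc N → ℝ} (hv : Continuous v)
    (hv2 : ∀ x, x ≠ 0 → ContDiffAt ℝ 2 v x) (hl : ∀ x, x ≠ 0 → lap v x ≤ 0)
    {x₀ : Euc N} (hx₀ : x₀ ≠ 0) {r : ℝ} (hr : 0 ≤ r) :
    ∫ z, v (x₀ + r • z) * wt z ≤ v x₀ * ∫ z : Euc N, wt z := by
  set I := ∫ z : Euc N, wt z with hI
  have hIpos : 0 < I := integral_wt_pos
  obtain ⟨c, hc⟩ := ((isCompact_closedBall x₀ r).image hv).bddAbove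
  have hc' : ∀ z : Euc N, ‖z‖ ≤ 1 → v (x₀ + r • z) ≤ c := fun z hz => hc ⟨_, by
    simp only [mem_closedBall, dist_self_add_left, norm_smul, Real.norm_eq_abs, abs_of_nonneg hr]
    nlinarith [norm_nonneg z], rfl⟩
  have key : ∀ δ : ℝ, 0 < δ → (c - v x₀ - δ * ‖x₀‖ ^ (2 - (N:ℝ))) * I
      ≤ c * I - ∫ z, v (x₀ + r • z) * wt z := by
    intro δ hδ
    have hfund : ∀ x : Euc N, x ≠ 0 → ContDiffAt ℝ 2 (fun y : Euc N => δ * ‖y‖ ^ (2 - (N:ℝ))) x :=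
      fun x hx => contDiffAt_const.mul (contDiffAt_norm_rpow _ hx)
    have h := sub_mean_pos (w := fun x => (c - v x) - δ * ‖x‖ ^ (2 - (N:ℝ)))
      (M := fun x => max (c - v x) 0)
      (fun x hx => (contDiffAt_const.sub (hv2 x hx)).sub (hfund x hx))
      (by
        filter_upwards [eventually_lt_fundamental hN (f := fun x => c - v x)
          (by fun_prop) hδ] with x hx
        linarith)
      (fun x hx _ => by
        rw [lap_sub (f := fun y => c - v y) (contDiffAt_const.sub (hv2 x hx)) (hfund x hx),
          lap_sub (f := fun _ => c) contDiffAt_const (hv2 x hx), lap_const,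
          lap_const_mul _ (contDiffAt_norm_rpow _ hx), lap_fundamental hx]
        linarith [hl x hx])
      (by fun_prop) (fun x => le_max_right _ _)
      (fun x _ => (sub_le_self _ (by positivity)).trans (le_max_left _ _)) hx₀ hr
    refine h.trans (le_of_eq ?_)
    rw [hI, ← integral_const_mul, ← integral_sub (integrable_mul_wt continuous_const)
      (integrable_mul_wt (by fun_prop))]
    refine integral_congr_ae (Eventually.of_forall fun z => ?_)
    simp only
    rcases le_or_gt 1 ‖z‖ with hz | hz
    · simp [wt_eq_zero hz]
    · rw [max_eq_left (by linarith [hc' z hz.le])]; ring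
  refine le_of_forall_pos_le_add fun ε hε => ?_
  have hK : 0 < ‖x₀‖ ^ (2 - (N:ℝ)) * I := mul_pos (Real.rpow_pos_of_pos (norm_pos_iff.2 hx₀) _) hIpos
  have := key (ε / (‖x₀‖ ^ (2 - (N:ℝ)) * I)) (by positivity)
  have h2 : ε / (‖x₀‖ ^ (2 - (N:ℝ)) * I) * (‖x₀‖ ^ (2 - (N:ℝ)) * I) = ε := div_mul_cancel₀ _ hK.ne'
  nlinarith

theorem integral_affine_ge {v : Euc N → ℝ} (hv : Continuous v) (hv0 : ∀ x, 0 ≤ v x)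
    (x₀ x₁ : Euc N) {r : ℝ} (hr : 0 < r) (hrx : 4 * ‖x₀ - x₁‖ ≤ r) :
    (2⁻¹ : ℝ) ^ (N + 1) * ∫ z, v (x₀ + r • z) * wt z ≤ ∫ z, v (x₁ + (2 * r) • z) * wt z := by
  set h : Euc N := (2 * r)⁻¹ • (x₀ - x₁) with hh
  have hh8 : ‖h‖ ≤ 1 / 8 := by
    rw [hh, norm_smul, Real.norm_of_nonneg (by positivity), inv_mul_le_iff₀ (by positivity)]
    linarith
  have e1 : ∫ z, v (x₁ + (2 * r) • z) * wt z
      = (2⁻¹ : ℝ) ^ N * ∫ z, v (x₀ + r • z) * wt (h + (2⁻¹ : ℝ) • z) := by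
    have e2 := integral_add_left_eq_self (μ := (volume : Measure (Euc N)))
      (fun z => v (x₁ + (2 * r) • z) * wt z) h
    have e3 := Measure.integral_comp_smul (volume : Measure (Euc N))
      (fun z => v (x₁ + (2 * r) • (h + z)) * wt (h + z)) (2⁻¹ : ℝ)
    rw [← e2]
    have e4 : ∀ z : Euc N, x₁ + (2 * r) • (h + (2⁻¹ : ℝ) • z) = x₀ + r • z := by
      intro z
      rw [hh, smul_add, smul_smul, smul_smul, mul_inv_cancel₀ (by positivity), one_smul,
        show 2 * r * 2⁻¹ = r by ring]
      abel
    simp only [e4] at e3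
    rw [e3]
    simp
  rw [e1, pow_succ, mul_assoc]
  refine mul_le_mul_of_nonneg_left ?_ (by positivity)
  rw [← integral_const_mul]
  have hcs : HasCompactSupport fun z : Euc N => v (x₀ + r • z) * wt (h + (2⁻¹ : ℝ) • z) := by
    refine hasCompactSupport_of_eq_zero (R := 3) fun z hz => ?_
    rw [wt_eq_zero, mul_zero]
    have : ‖(2⁻¹ : ℝ) • z‖ ≤ ‖h + (2⁻¹ : ℝ) • z‖ + ‖h‖ := by
      simpa using norm_sub_le (h + (2⁻¹ : ℝ) • z) h
    rw [norm_smul, Real.norm_of_nonneg (by norm_num)] at this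
    linarith
  refine integral_mono ((integrable_mul_wt (by fun_prop)).const_mul _)
    (Continuous.integrable_of_hasCompactSupport ?_ hcs) fun z => ?_
  · have := continuous_wt (N := N)
    fun_prop
  · simp only
    rcases le_or_gt 1 ‖z‖ with hz | hz
    · rw [wt_eq_zero hz]; simpa using mul_nonneg (hv0 _) (wt_nonneg _)
    · have h1 : ‖h + (2⁻¹ : ℝ) • z‖ ≤ 5 / 8 := by
        refine (norm_add_le _ _).trans ?_
        rw [norm_smul (2⁻¹ : ℝ) z, Real.norm_of_nonneg (by norm_num)]
        linarith
      have h2 : 1 / 2 ≤ wt (h + (2⁻¹ : ℝ) • z) :=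
        le_trans (by nlinarith [norm_nonneg (h + (2⁻¹ : ℝ) • z)]) (le_max_left _ _)
      nlinarith [mul_le_mul_of_nonneg_left (wt_le_one z) (hv0 (x₀ + r • z)),
        mul_le_mul_of_nonneg_left h2 (hv0 (x₀ + r • z))]

/-- No positive function satisfies `-Δu ≥ K |x|^a` off the origin when `a > -2`. -/
theorem not_lap_le_neg_rpow (hN : 3 ≤ N) {u : Euc N → ℝ} (hu : Continuous u) (hu0 : ∀ x, 0 ≤ u x)
    (hu2 : ∀ x, x ≠ 0 → ContDiffAt ℝ 2 u x) {K a : ℝ} (hK : 0 < K) (ha : -2 < a)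
    (hl : ∀ x, x ≠ 0 → K * ‖x‖ ^ a ≤ -lap u x) : False := by
  have hN' : (3:ℝ) ≤ N := by exact_mod_cast hN
  have hd : 0 < 2 * ((2 + a) * (N + a)) := by
    have h1 : 0 < 2 + a := by linarith
    have h2 : 0 < N + a := by linarith
    positivity
  set c := K / (2 * ((2 + a) * (N + a))) with hc
  have hcpos : 0 < c := by positivity
  have : NeZero N := ⟨by omega⟩
  let x₁ : Euc N := EuclideanSpace.single 0 1
  have hx₁ : ‖x₁‖ = 1 := by simp [x₁]
  have hx₁0 : x₁ ≠ 0 := norm_ne_zero_iff.1 (by rw [hx₁]; norm_num)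
  have key : ∀ R : ℝ, 0 < R → c * (R ^ (2 + a) - 1) - u x₁ - 1 ≤ 0 := by
    intro R hR
    have hA : ∀ x : Euc N, x ≠ 0 → ContDiffAt ℝ 2 (fun y : Euc N => c * ‖y‖ ^ (2 + a)) x :=
      fun x hx => contDiffAt_const.mul (contDiffAt_norm_rpow _ hx)
    have h := nonpos_of_lap_pos (w := fun x => (c * R ^ (2 + a) - c * ‖x‖ ^ (2 + a)) - u x
        - ‖x‖ ^ (2 - (N:ℝ))) (R := R)
      (fun x hx => ((contDiffAt_const.sub (hA x hx)).sub (hu2 x hx)).sub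
        (contDiffAt_norm_rpow _ hx))
      (by
        filter_upwards [eventually_lt_fundamental hN (f := fun x => c * R ^ (2 + a) - u x)
          (by fun_prop) one_pos] with x hx
        have : 0 ≤ c * ‖x‖ ^ (2 + a) := by positivity
        linarith)
      (fun x hx _ => by
        have h1 : c * R ^ (2 + a) ≤ c * ‖x‖ ^ (2 + a) :=
          mul_le_mul_of_nonneg_left (Real.rpow_le_rpow hR.le hx (by linarith)) hcpos.le
        have h2 : 0 ≤ ‖x‖ ^ (2 - (N:ℝ)) := by positivity
        linarith [hu0 x])
      (fun x hx _ => by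
        rw [lap_sub (f := fun x => (c * R ^ (2 + a) - c * ‖x‖ ^ (2 + a)) - u x)
            ((contDiffAt_const.sub (hA x hx)).sub (hu2 x hx)) (contDiffAt_norm_rpow _ hx),
          lap_sub (f := fun x => (c * R ^ (2 + a) - c * ‖x‖ ^ (2 + a)))
            (contDiffAt_const.sub (hA x hx)) (hu2 x hx),
          lap_sub (f := fun _ => c * R ^ (2 + a)) contDiffAt_const (hA x hx), lap_const,
          lap_const_mul _ (contDiffAt_norm_rpow _ hx), lap_norm_rpow _ hx, lap_fundamental hx]
        have h1 := hl x hx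
        have h2 : 0 < ‖x‖ ^ a := Real.rpow_pos_of_pos (norm_pos_iff.2 hx) _
        have h3 : c * ((2 + a) * (2 + a + N - 2) * ‖x‖ ^ (2 + a - 2)) = K / 2 * ‖x‖ ^ a := by
          have h4 : c * (2 * ((2 + a) * (N + a))) = K := div_mul_cancel₀ _ hd.ne'
          rw [show 2 + a - 2 = a by ring, ← h4]
          ring
        rw [h3]
        nlinarith)
      hx₁0
    simpa [hx₁, mul_sub] using h
  have ht : Tendsto (fun R : ℝ => R ^ (2 + a)) atTop atTop := tendsto_rpow_atTop (by linarith)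
  obtain ⟨R, hR1, hR2⟩ := ((ht.eventually_gt_atTop (1 + (u x₁ + 1) / c)).and
    (eventually_gt_atTop 0)).exists
  have h1 := key R hR2
  have h2 : (u x₁ + 1) / c * c = u x₁ + 1 := div_mul_cancel₀ _ hcpos.ne'
  nlinarith

end Subharmonic

section Comparison

open Filter Topology

variable {N : ℕ}

/-- Positive solutions of the Hénon–Lane–Emden system. -/
structure IsPosSol (p q a b : ℝ) (u v : Euc N → ℝ) : Prop where
  contU : Continuous u
  contV : Continuous v
  posU : ∀ x, 0 < u x
  posV : ∀ x, 0 < v x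
  cdU : ∀ x, x ≠ 0 → ContDiffAt ℝ 2 u x
  cdV : ∀ x, x ≠ 0 → ContDiffAt ℝ 2 v x
  eqU : ∀ x, x ≠ 0 → -lap u x = ‖x‖ ^ a * v x ^ p
  eqV : ∀ x, x ≠ 0 → -lap v x = ‖x‖ ^ b * u x ^ q

theorem abs_rpow_sub_one_mul {t : ℝ} (ht : 0 < t) (p : ℝ) : |t| ^ (p - 1) * t = t ^ p := by
  rw [abs_of_pos ht, Real.rpow_sub_one ht.ne', div_mul_cancel₀ _ ht.ne']

theorem IsHLESol.isPosSol {p q a b : ℝ} {u v : Euc N → ℝ} (h : IsHLESol p q a b u v)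
    (hu : ∀ x, 0 < u x) (hv : ∀ x, 0 < v x) : IsPosSol p q a b u v := by
  obtain ⟨h1, h2, h3, h4, h5, h6⟩ := h
  refine ⟨h3, h4, hu, hv, fun x hx => h1.contDiffAt (isOpen_ne.mem_nhds hx),
    fun x hx => h2.contDiffAt (isOpen_ne.mem_nhds hx), fun x hx => ?_, fun x hx => ?_⟩
  · rw [h5 x hx, abs_rpow_sub_one_mul (hv x)]
  · rw [h6 x hx, abs_rpow_sub_one_mul (hu x)]

theorem sum_coord_mul_sq_le (x g : Fin N → ℝ) :
    (∑ i, x i * g i) ^ 2 ≤ (∑ i, x i ^ 2) * ∑ i, g i ^ 2 :=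
  Finset.sum_mul_sq_le_sq_mul_sq _ _ _

/-- Laplacian of `|x|^{-γ} u^σ`. -/
theorem lap_weighted_rpow {u : Euc N → ℝ} {x : Euc N} (hx : x ≠ 0) (hu : 0 < u x)
    (h2 : ContDiffAt ℝ 2 u x) (γ σ : ℝ) :
    lap (fun y => ‖y‖ ^ (-γ) * u y ^ σ) x
      = σ * ‖x‖ ^ (-γ) * u x ^ (σ - 1) * lap u x
        - ‖x‖ ^ (-γ - 2) * u x ^ (σ - 2) * (γ * (N - 2 - γ) * u x ^ 2
          + 2 * γ * σ * u x * (∑ i, x i * pd i u x)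
          + σ * (1 - σ) * (‖x‖ ^ 2 * ∑ i, pd i u x ^ 2)) := by
  have hpos : 0 < ‖x‖ := norm_pos_iff.2 hx
  have hev : ∀ᶠ t in 𝓝 (u x), HasDerivAt (fun t : ℝ => t ^ σ) (σ * t ^ (σ - 1)) t :=
    (isOpen_ne.eventually_mem hu.ne').mono fun t ht => Real.hasDerivAt_rpow_const (Or.inl ht)
  have hc : ContDiffAt ℝ 2 (fun t : ℝ => t ^ σ) (u x) := Real.contDiffAt_rpow_const_of_ne hu.ne'
  rw [lap_mul (f := fun y : Euc N => ‖y‖ ^ (-γ)) (g := fun y => u y ^ σ)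
    (contDiffAt_norm_rpow _ hx) (hc.comp x h2), lap_norm_rpow _ hx,
    lap_comp (φ := fun t => t ^ σ) (φ₁ := fun t => σ * t ^ (σ - 1)) h2 hc hev
      ((Real.hasDerivAt_rpow_const (p := σ - 1) (Or.inl hu.ne')).const_mul σ)]
  have hpd : ∀ i : Fin N, pd i (fun y : Euc N => ‖y‖ ^ (-γ)) x * pd i (fun y => u y ^ σ) x
      = (-γ * ‖x‖ ^ (-γ - 2) * (σ * u x ^ (σ - 1))) * (x i * pd i u x) := by
    intro i
    rw [pd_norm_rpow _ hx, pd_comp (φ := fun t => t ^ σ) hev.self_of_nhds h2.differentiableAt_two]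
    ring
  simp only [hpd, ← Finset.mul_sum]
  have e1 : u x ^ (σ - 1) = u x ^ (σ - 2) * u x := by
    rw [← Real.rpow_add_one hu.ne']; congr 1; ring
  have e2 : u x ^ σ = u x ^ (σ - 2) * u x ^ 2 := by
    rw [← Real.rpow_natCast, ← Real.rpow_add hu]; congr 1; push_cast; ring
  have e3 : ‖x‖ ^ (-γ) = ‖x‖ ^ (-γ - 2) * ‖x‖ ^ 2 := by
    rw [← Real.rpow_natCast, ← Real.rpow_add hpos]; congr 1; push_cast; ring
  rw [show σ - 1 - 1 = σ - 2 by ring, e1, e2, e3]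
  ring

theorem quadratic_form_nonneg {n γ σ t X G : ℝ} (hσ : 0 < σ) (hσ1 : σ ≤ 1) (hγ : 0 ≤ γ)
    (h : γ ≤ n * (1 - σ)) (hG : X ^ 2 ≤ G) :
    0 ≤ γ * (n - γ) * t ^ 2 + 2 * γ * σ * t * X + σ * (1 - σ) * G := by
  rcases eq_or_lt_of_le hσ1 with rfl | h1
  · have : γ = 0 := by linarith
    simp [this]
  · have hs : 0 < 1 - σ := by linarith
    have h2 : σ * (1 - σ) * X ^ 2 ≤ σ * (1 - σ) * G :=
      mul_le_mul_of_nonneg_left hG (by positivity)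
    have h3 : 0 ≤ γ * t ^ 2 * (n * (1 - σ) - γ) :=
      mul_nonneg (by positivity) (by linarith)
    have h4 : 0 ≤ (1 - σ) * (γ * (n - γ) * t ^ 2 + 2 * γ * σ * t * X + σ * (1 - σ) * X ^ 2) := by
      nlinarith [mul_nonneg hσ.le (sq_nonneg (γ * t + (1 - σ) * X))]
    have := nonneg_of_mul_nonneg_right h4 hs
    linarith

theorem lap_weighted_rpow_le {u : Euc N → ℝ} {x : Euc N} (hx : x ≠ 0) (hu : 0 < u x)
    (h2 : ContDiffAt ℝ 2 u x) {γ σ : ℝ} (hσ : 0 < σ) (hσ1 : σ ≤ 1) (hγ : 0 ≤ γ)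
    (h : γ ≤ (N - 2) * (1 - σ)) :
    lap (fun y => ‖y‖ ^ (-γ) * u y ^ σ) x ≤ σ * ‖x‖ ^ (-γ) * u x ^ (σ - 1) * lap u x := by
  rw [lap_weighted_rpow hx hu h2]
  have := quadratic_form_nonneg (t := u x) hσ hσ1 hγ h
    ((sum_coord_mul_sq_le (fun i => x i) fun i => pd i u x).trans_eq (by
      rw [sum_sq_eq_norm_sq]))
  have h3 : 0 ≤ ‖x‖ ^ (-γ - 2) * u x ^ (σ - 2) := by positivity
  nlinarith [mul_nonneg h3 this]

variable {p q a b : ℝ} {u v : Euc N → ℝ}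

/-- Pointwise comparison of the two components of a positive solution. -/
theorem IsPosSol.comparison (h : IsPosSol p q a b u v) (hN : 3 ≤ N) (hq : 0 < q) (hqp : q ≤ p)
    (ha : -2 < a) (hab0 : 0 ≤ a - b) (hab : a - b ≤ ((N : ℝ) - 2) * (p - q)) :
    ∃ l : ℝ, 0 < l ∧ ∀ x, x ≠ 0 →
      v x ≤ l * (‖x‖ ^ (-((a - b) / (p + 1))) * u x ^ ((q + 1) / (p + 1))) := by
  have hp : 0 < p := hq.trans_le hqp
  have hp1 : 0 < p + 1 := by linarith
  set γ := (a - b) / (p + 1) with hγ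
  set σ := (q + 1) / (p + 1) with hσ
  have hσ0 : 0 < σ := by positivity
  have hσ1 : σ ≤ 1 := by rw [hσ, div_le_one hp1]; linarith
  have hγ0 : 0 ≤ γ := by positivity
  have hγp : γ * (p + 1) = a - b := div_mul_cancel₀ _ hp1.ne'
  have hσp : σ * (p + 1) = q + 1 := div_mul_cancel₀ _ hp1.ne'
  have hγσ : γ ≤ (N - 2) * (1 - σ) := by
    rw [hγ, div_le_iff₀ hp1]
    nlinarith
  set l := σ ^ (-(1 / (p + 1))) with hl
  have hl0 : 0 < l := Real.rpow_pos_of_pos hσ0 _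
  have hlσ : l ^ (p + 1) * σ = 1 := by
    rw [hl, ← Real.rpow_mul hσ0.le, show -(1 / (p + 1)) * (p + 1) = -1 by field_simp,
      Real.rpow_neg_one, inv_mul_cancel₀ hσ0.ne']
  have hz2 : ∀ x, x ≠ 0 → ContDiffAt ℝ 2 (fun y : Euc N => ‖y‖ ^ (-γ) * u y ^ σ) x := fun x hx =>
    (contDiffAt_norm_rpow _ hx).mul
      ((Real.contDiffAt_rpow_const_of_ne (h.posU x).ne').comp x (h.cdU x hx))
  have hf2 : ∀ δ : ℝ, ∀ x : Euc N, x ≠ 0 →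
      ContDiffAt ℝ 2 (fun y : Euc N => δ * ‖y‖ ^ (2 - (N:ℝ))) x :=
    fun δ x hx => contDiffAt_const.mul (contDiffAt_norm_rpow _ hx)
  have key : ∀ δ : ℝ, 0 < δ → ∀ x, x ≠ 0 →
      v x - l * (‖x‖ ^ (-γ) * u x ^ σ) - δ * ‖x‖ ^ (2 - (N:ℝ)) ≤ 0 := by
    intro δ hδ x₀ hx₀
    by_contra! hη
    set η := v x₀ - l * (‖x₀‖ ^ (-γ) * u x₀ ^ σ) - δ * ‖x₀‖ ^ (2 - (N:ℝ)) with hηdef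
    have hsub : ∀ r : ℝ, 0 ≤ r → η * ∫ z : Euc N, wt z ≤ ∫ z, v (x₀ + r • z) * wt z := by
      intro r hr
      refine sub_mean_pos (w := fun x => (v x - l * (‖x‖ ^ (-γ) * u x ^ σ))
        - δ * ‖x‖ ^ (2 - (N:ℝ)))
        (fun x hx => ((h.cdV x hx).sub (contDiffAt_const.mul (hz2 x hx))).sub (hf2 δ x hx))
        ?_ ?_ h.contV (fun x => (h.posV x).le) ?_ hx₀ hr
      · filter_upwards [eventually_lt_fundamental hN h.contV.continuousAt hδ] with x hx
        have h1 : 0 ≤ l * (‖x‖ ^ (-γ) * u x ^ σ) := by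
          have := (h.posU x).le
          positivity
        linarith
      · intro x hx hw
        have hxp : 0 < ‖x‖ := norm_pos_iff.2 hx
        have hup := h.posU x
        have hvl : l * (‖x‖ ^ (-γ) * u x ^ σ) ≤ v x := by
          have : 0 ≤ δ * ‖x‖ ^ (2 - (N:ℝ)) := by positivity
          linarith
        rw [lap_sub (f := fun x => v x - l * (‖x‖ ^ (-γ) * u x ^ σ))
            ((h.cdV x hx).sub (contDiffAt_const.mul (hz2 x hx))) (hf2 δ x hx),
          lap_sub (h.cdV x hx) (contDiffAt_const.mul (hz2 x hx)),
          lap_const_mul _ (hz2 x hx), lap_const_mul _ (contDiffAt_norm_rpow _ hx),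
          lap_fundamental hx]
        have h1 := lap_weighted_rpow_le hx hup (h.cdU x hx) hσ0 hσ1 hγ0 hγσ
        have h2 : lap u x = -(‖x‖ ^ a * v x ^ p) := by rw [← h.eqU x hx]; ring
        have h3 : lap v x = -(‖x‖ ^ b * u x ^ q) := by rw [← h.eqV x hx]; ring
        have h4 : (l * (‖x‖ ^ (-γ) * u x ^ σ)) ^ p ≤ v x ^ p :=
          Real.rpow_le_rpow (by positivity) hvl hp.le
        have h5 : l * (σ * ‖x‖ ^ (-γ) * u x ^ (σ - 1) * (‖x‖ ^ a
            * (l * (‖x‖ ^ (-γ) * u x ^ σ)) ^ p)) = ‖x‖ ^ b * u x ^ q := by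
          rw [Real.mul_rpow hl0.le (by positivity), Real.mul_rpow (by positivity) (by positivity),
            ← Real.rpow_mul hxp.le, ← Real.rpow_mul hup.le]
          calc _ = (l ^ p * l * σ) * (‖x‖ ^ a * ‖x‖ ^ (-γ) * ‖x‖ ^ (-γ * p))
                * (u x ^ (σ - 1) * u x ^ (σ * p)) := by ring
            _ = _ := by
              rw [← Real.rpow_add_one hl0.ne', hlσ, ← Real.rpow_add hxp, ← Real.rpow_add hxp,
                ← Real.rpow_add hup, one_mul,
                show a + -γ + -γ * p = b by linarith, show σ - 1 + σ * p = q by linarith]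
        have h6 : l * (σ * ‖x‖ ^ (-γ) * u x ^ (σ - 1) * (‖x‖ ^ a
            * (l * (‖x‖ ^ (-γ) * u x ^ σ)) ^ p))
            ≤ l * (σ * ‖x‖ ^ (-γ) * u x ^ (σ - 1) * (‖x‖ ^ a * v x ^ p)) := by gcongr
        rw [h2] at h1
        rw [h3]
        have h7 := mul_le_mul_of_nonneg_left h1 hl0.le
        nlinarith
      · intro x _
        have h1 : 0 ≤ l * (‖x‖ ^ (-γ) * u x ^ σ) := by
          have := (h.posU x).le
          positivity
        have : 0 ≤ δ * ‖x‖ ^ (2 - (N:ℝ)) := by positivity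
        linarith
    have hlv : ∀ x, x ≠ 0 → lap v x ≤ 0 := fun x hx => by
      have h1 := h.eqV x hx
      have h2 := (h.posU x).le
      have : 0 ≤ ‖x‖ ^ b * u x ^ q := by positivity
      linarith
    have hIpos : 0 < ∫ z : Euc N, wt z := integral_wt_pos
    have hlow : ∀ x₁, x₁ ≠ 0 → (2⁻¹ : ℝ) ^ (N + 1) * η ≤ v x₁ := by
      intro x₁ hx₁
      have hr : 0 < 4 * ‖x₀ - x₁‖ + 1 := by positivity
      have h1 := integral_affine_ge h.contV (fun x => (h.posV x).le) x₀ x₁ hr (by linarith)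
      have h2 := mean_le_of_superharmonic hN h.contV h.cdV hlv hx₁
        (r := 2 * (4 * ‖x₀ - x₁‖ + 1)) (by positivity)
      have h3 := mul_le_mul_of_nonneg_left (hsub _ hr.le)
        (show (0:ℝ) ≤ (2⁻¹ : ℝ) ^ (N + 1) by positivity)
      rw [← mul_assoc] at h3
      exact le_of_mul_le_mul_right (h3.trans (h1.trans h2)) hIpos
    refine not_lap_le_neg_rpow hN h.contU (fun x => (h.posU x).le) h.cdU
      (K := ((2⁻¹ : ℝ) ^ (N + 1) * η) ^ p) (a := a) (by positivity) ha fun x hx => ?_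
    rw [h.eqU x hx, mul_comm]
    exact mul_le_mul_of_nonneg_left (Real.rpow_le_rpow (by positivity) (hlow x hx) hp.le)
      (by positivity)
  refine ⟨l, hl0, fun x hx => le_of_forall_pos_le_add fun ε hε => ?_⟩
  have hK : 0 < ‖x‖ ^ (2 - (N:ℝ)) := Real.rpow_pos_of_pos (norm_pos_iff.2 hx) _
  have h1 := key (ε / ‖x‖ ^ (2 - (N:ℝ))) (by positivity) x hx
  rw [div_mul_cancel₀ _ hK.ne'] at h1
  linarith

/-- The comparison closes the first equation. -/
theorem IsPosSol.exists_lap_bound (h : IsPosSol p q a b u v) (hN : 3 ≤ N) (hq : 0 < q)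
    (hqp : q ≤ p) (ha : -2 < a) (hab0 : 0 ≤ a - b) (hab : a - b ≤ ((N : ℝ) - 2) * (p - q)) :
    ∃ C : ℝ, 0 < C ∧ ∀ x, x ≠ 0 →
      -lap u x ≤ C * (‖x‖ ^ ((a + p * b) / (p + 1)) * u x ^ (p * (q + 1) / (p + 1))) := by
  obtain ⟨l, hl, hv⟩ := h.comparison hN hq hqp ha hab0 hab
  have hp : 0 < p := hq.trans_le hqp
  have hp1 : p + 1 ≠ 0 := by linarith
  refine ⟨l ^ p, by positivity, fun x hx => ?_⟩
  have hxp : 0 < ‖x‖ := norm_pos_iff.2 hx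
  have hup := h.posU x
  have h1 := Real.rpow_le_rpow (h.posV x).le (hv x hx) hp.le
  rw [Real.mul_rpow hl.le (by positivity), Real.mul_rpow (by positivity) (by positivity),
    ← Real.rpow_mul hxp.le, ← Real.rpow_mul hup.le] at h1
  rw [h.eqU x hx]
  refine (mul_le_mul_of_nonneg_left h1 (by positivity)).trans (le_of_eq ?_)
  rw [show (a + p * b) / (p + 1) = a + -((a - b) / (p + 1)) * p by field_simp; ring,
    Real.rpow_add hxp, show p * (q + 1) / (p + 1) = (q + 1) / (p + 1) * p by ring]
  ring

end Comparison

section Decay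

open Filter Topology

variable {N : ℕ}

/-- Local version of the sub-mean value property. -/
theorem sub_mean_local {F : Euc N → ℝ} {x₀ : Euc N} {r R : ℝ} (hr : 0 < r) (hrR : r < R)
    (hF : ∀ y ∈ ball x₀ R, ContDiffAt ℝ 2 F y) (h : ∀ y ∈ ball x₀ r, 0 ≤ lap F y) :
    F x₀ * ∫ z : Euc N, wt z ≤ ∫ z, F (x₀ + r • z) * wt z := by
  let k : ContDiffBump x₀ := ⟨(r + R) / 2, (r + 3 * R) / 4, by linarith, by linarith⟩
  let G : Euc N → ℝ := fun y => k y * F y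
  have hG : ContDiff ℝ 2 G := by
    rw [contDiff_iff_contDiffAt]
    intro y
    by_cases hy : y ∈ ball x₀ R
    · exact (k.contDiff.contDiffAt).mul (hF y hy)
    · have : G =ᶠ[𝓝 y] fun _ => 0 := by
        have hy' : (r + 3 * R) / 4 < dist y x₀ := by
          simp only [mem_ball, not_lt] at hy; linarith
        filter_upwards [(isOpen_lt continuous_const (continuous_id.dist continuous_const)).mem_nhds
          hy'] with z hz
        have hk : k z = 0 := k.zero_of_le_dist (le_of_lt hz)
        simp only [G, hk, zero_mul]
      exact contDiffAt_const.congr_of_eventuallyEq this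
  have hGF : ∀ y, dist y x₀ ≤ (r + R) / 2 → G y = F y := fun y hy => by
    simp only [G, k.one_of_mem_closedBall (mem_closedBall.2 hy), one_mul]
  have hm := sub_mean hG hr.le (x₀ := x₀) fun y hy => by
    have : G =ᶠ[𝓝 y] F := by
      filter_upwards [isOpen_ball.mem_nhds hy] with z hz
      exact hGF z (by have := mem_ball.1 hz; linarith)
    rw [lap_congr this]
    exact h y hy
  rw [hGF x₀ (by rw [dist_self]; linarith)] at hm
  refine hm.trans_eq (integral_congr_ae (Eventually.of_forall fun z => ?_))
  simp only
  rcases le_or_gt 1 ‖z‖ with hz | hz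
  · simp [wt_eq_zero hz]
  · rw [hGF]
    rw [dist_self_add_left, norm_smul, Real.norm_of_nonneg hr.le]
    nlinarith

theorem rpow_ge_linear {t A m B : ℝ} (ht : 0 < t) (hA : 0 < A) (hm : 0 < m) (hB : 0 < B)
    (htB : t ≤ B * A) : (A / 4) ^ m * B⁻¹ * (t / A - 1 / 4) ≤ t ^ m := by
  rcases le_or_gt (t / A) (1 / 4) with h | h
  · have h1 : 0 < t ^ m := Real.rpow_pos_of_pos ht _
    have h2 : 0 ≤ (A / 4) ^ m * B⁻¹ := by positivity
    nlinarith
  · have h1 : A / 4 ≤ t := by rw [lt_div_iff₀ hA] at h; linarith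
    have h2 : (A / 4) ^ m ≤ t ^ m := Real.rpow_le_rpow (by positivity) h1 hm.le
    have h3 : t / A - 1 / 4 ≤ B := by
      have : t / A ≤ B := by rw [div_le_iff₀ hA]; exact htB
      linarith
    calc (A / 4) ^ m * B⁻¹ * (t / A - 1 / 4) ≤ (A / 4) ^ m * B⁻¹ * B := by gcongr
      _ = (A / 4) ^ m := by field_simp
      _ ≤ t ^ m := h2

/-- Lower bound for the local `L^m` mass near a point where the growth of the Laplacian is
controlled. -/
theorem local_mass_lower_bound {u : Euc N → ℝ} (hu : Continuous u) (hpos : ∀ x, 0 < u x)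
    {m : ℝ} (hm : 0 < m) (hN : 1 ≤ N) {S : Set (Euc N)} (hS : MeasurableSet S)
    (hintg : Integrable fun x => u x ^ m)
    {y₀ : Euc N} {r R B K : ℝ} (hr : 0 < r) (hrR : r < R) (hB : 0 < B)
    (hKr : K * r ^ 2 ≤ u y₀) (hRS : ball y₀ r ⊆ S)
    (h2 : ∀ y ∈ ball y₀ R, ContDiffAt ℝ 2 u y)
    (hub : ∀ y ∈ ball y₀ r, u y ≤ B * u y₀) (hl : ∀ y ∈ ball y₀ r, -lap u y ≤ K) :
    ((4 : ℝ) ^ m)⁻¹ * B⁻¹ * (1 / 4) * (∫ z : Euc N, wt z) * (u y₀ ^ m * r ^ N)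
      ≤ ∫ x in S, u x ^ m := by
  set A := u y₀ with hA
  have hA0 : 0 < A := hpos y₀
  have hN0 : (1:ℝ) ≤ N := by exact_mod_cast hN
  set I := ∫ z : Euc N, wt z with hI
  have hI0 : 0 < I := integral_wt_pos
  have hq2 : ∀ y, ContDiffAt ℝ 2 (fun y : Euc N => ‖y - y₀‖ ^ 2) y := fun y =>
    ((contDiff_norm_sq ℝ).comp (contDiff_id.sub contDiff_const)).contDiffAt
  have hlapq : ∀ y, lap (fun y : Euc N => ‖y - y₀‖ ^ 2) y = 2 * N := by
    intro y
    have := lap_normSq (x := y - y₀)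
    simp only [lap] at this ⊢
    rw [← this]
    refine Finset.sum_congr rfl fun i _ => ?_
    have := iteratedFDeriv_comp_sub (𝕜 := ℝ) (f := fun y : Euc N => ‖y‖ ^ 2) 2 y₀ y
    simp only [this]
  have hsm := sub_mean_local (F := fun y => u y + K / (2 * N) * ‖y - y₀‖ ^ 2) hr hrR
    (fun y hy => (h2 y hy).add (contDiffAt_const.mul (hq2 y))) (fun y hy => by
      rw [lap_add (h2 y (ball_subset_ball hrR.le hy)) (contDiffAt_const.mul (hq2 y)),
        lap_const_mul _ (hq2 y), hlapq, div_mul_cancel₀ _ (by positivity)]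
      linarith [hl y hy])
  have hcont : Continuous fun z : Euc N => u (y₀ + r • z) := by fun_prop
  have h1 : A / 2 * I ≤ ∫ z, u (y₀ + r • z) * wt z := by
    have e : ∫ z, (u (y₀ + r • z) + K / (2 * N) * ‖y₀ + r • z - y₀‖ ^ 2) * wt z
        ≤ (∫ z, u (y₀ + r • z) * wt z) + A / 2 * I := by
      rw [hI, ← integral_const_mul, ← integral_add (integrable_mul_wt hcont)
        ((integrable_mul_wt continuous_const))]
      refine integral_mono (integrable_mul_wt (by fun_prop))
        ((integrable_mul_wt hcont).add (integrable_mul_wt continuous_const)) fun z => ?_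
      simp only [add_sub_cancel_left, norm_smul, Real.norm_of_nonneg hr.le]
      rcases le_or_gt 1 ‖z‖ with hz | hz
      · simp [wt_eq_zero hz]
      · have hz2 : ‖z‖ ^ 2 ≤ 1 := pow_le_one₀ (norm_nonneg z) hz.le
        have h3 : K / (2 * N) * (r * ‖z‖) ^ 2 ≤ A / 2 := by
          calc K / (2 * N) * (r * ‖z‖) ^ 2 = (K * r ^ 2) * ‖z‖ ^ 2 / (2 * N) := by ring
            _ ≤ A * 1 / (2 * 1) := by gcongr
            _ = A / 2 := by ring
        nlinarith [wt_nonneg z]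
    simp only [sub_self, norm_zero, ne_eq, OfNat.ofNat_ne_zero, not_false_eq_true, zero_pow,
      mul_zero, add_zero] at hsm
    linarith
  have hum : Continuous fun x => u x ^ m := hu.rpow_const fun x => Or.inl (hpos x).ne'
  have humz : Continuous fun z : Euc N => u (y₀ + r • z) ^ m := hum.comp (by fun_prop)
  have h3 : (A / 4) ^ m * B⁻¹ * (1 / 4) * I ≤ ∫ z, u (y₀ + r • z) ^ m * wt z := by
    have e : ∫ z, ((A / 4) ^ m * B⁻¹ * (u (y₀ + r • z) / A - 1 / 4)) * wt z
        ≤ ∫ z, u (y₀ + r • z) ^ m * wt z := by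
      refine integral_mono (integrable_mul_wt (by fun_prop)) (integrable_mul_wt humz) fun z => ?_
      simp only
      rcases le_or_gt 1 ‖z‖ with hz | hz
      · simp [wt_eq_zero hz]
      · refine mul_le_mul_of_nonneg_right (rpow_ge_linear (hpos _) hA0 hm hB (hub _ ?_))
          (wt_nonneg z)
        rw [mem_ball, dist_self_add_left, norm_smul, Real.norm_of_nonneg hr.le]
        nlinarith
    have e2 : ∫ z, ((A / 4) ^ m * B⁻¹ * (u (y₀ + r • z) / A - 1 / 4)) * wt z
        = (A / 4) ^ m * B⁻¹ * (A⁻¹ * (∫ z, u (y₀ + r • z) * wt z) - 1 / 4 * I) := by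
      rw [hI, ← integral_const_mul, ← integral_const_mul, ← integral_sub
        ((integrable_mul_wt hcont).const_mul _) (integrable_mul_wt continuous_const),
        ← integral_const_mul]
      refine integral_congr_ae (Eventually.of_forall fun z => ?_)
      simp only
      ring
    rw [e2] at e
    refine le_trans ?_ e
    rw [mul_assoc]
    refine mul_le_mul_of_nonneg_left ?_ (by positivity)
    have h4 := mul_le_mul_of_nonneg_left h1 (inv_nonneg.2 hA0.le)
    have h5 : A⁻¹ * (A / 2 * I) = I / 2 := by field_simp
    linarith
  have h4 : ∫ z, u (y₀ + r • z) ^ m * wt z ≤ (r ^ N)⁻¹ * ∫ x in S, u x ^ m := by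
    have e1 : ∫ z, S.indicator (fun x => u x ^ m) (y₀ + r • z)
        = (r ^ N)⁻¹ * ∫ x in S, u x ^ m := by
      have e2 := Measure.integral_comp_smul (volume : Measure (Euc N))
        (fun z => S.indicator (fun x => u x ^ m) (y₀ + z)) r
      rw [e2, integral_add_left_eq_self (μ := (volume : Measure (Euc N)))
        (fun z => S.indicator (fun x => u x ^ m) z) y₀, integral_indicator hS]
      simp [abs_of_pos hr]
    rw [← e1]
    have hgi : Integrable (S.indicator fun x => u x ^ m) := hintg.indicator hS
    refine integral_mono (integrable_mul_wt humz)
      ((hgi.comp_add_left y₀).comp_smul hr.ne') fun z => ?_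
    simp only
    rcases le_or_gt 1 ‖z‖ with hz | hz
    · rw [wt_eq_zero hz, mul_zero]
      exact Set.indicator_nonneg (fun x _ => (Real.rpow_pos_of_pos (hpos x) _).le) _
    · rw [Set.indicator_of_mem (hRS _)]
      · have := Real.rpow_pos_of_pos (hpos (y₀ + r • z)) m
        nlinarith [wt_le_one z]
      · rw [mem_ball, dist_self_add_left, norm_smul, Real.norm_of_nonneg hr.le]
        nlinarith
  have h5 := h3.trans h4
  rw [inv_mul_eq_div, le_div_iff₀ (by positivity), Real.div_rpow hA0.le (by norm_num)] at h5
  refine le_trans (le_of_eq ?_) h5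
  ring

theorem exists_doubling_point {u : Euc N → ℝ} (hu : Continuous u) (hpos : ∀ x, 0 < u x)
    (x₀ : Euc N) {d κ : ℝ} (hd : 0 < d) (hκ : 0 < κ) :
    ∃ y₀ ρ, 0 < ρ ∧ 2 * ρ ≤ d ∧ ball y₀ (2 * ρ) ⊆ ball x₀ d ∧
      d ^ κ * u x₀ ≤ (2 * ρ) ^ κ * u y₀ ∧ ∀ y ∈ ball y₀ ρ, u y ≤ 2 ^ κ * u y₀ := by
  have hG : ContinuousOn (fun y => (d - dist y x₀) ^ κ * u y) (closedBall x₀ d) := by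
    refine ContinuousOn.mul (ContinuousOn.rpow_const (by fun_prop) fun _ _ => Or.inr hκ.le)
      hu.continuousOn
  obtain ⟨y₀, hy₀, hmax⟩ := (isCompact_closedBall x₀ d).exists_isMaxOn
    ⟨x₀, mem_closedBall_self hd.le⟩ hG
  have h0 : d ^ κ * u x₀ ≤ (d - dist y₀ x₀) ^ κ * u y₀ := by
    simpa using hmax (mem_closedBall_self hd.le)
  have hlt : dist y₀ x₀ < d := by
    rcases (mem_closedBall.1 hy₀).lt_or_eq with h | h
    · exact h
    · rw [h, sub_self, Real.zero_rpow hκ.ne', zero_mul] at h0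
      have := mul_pos (Real.rpow_pos_of_pos hd κ) (hpos x₀)
      linarith
  have hsub : ∀ y, dist y y₀ < d - dist y₀ x₀ → dist y x₀ < d := fun y hy => by
    linarith [dist_triangle y y₀ x₀]
  refine ⟨y₀, (d - dist y₀ x₀) / 2, by linarith, by linarith [dist_nonneg (x := y₀) (y := x₀)],
    fun y hy => ?_, ?_, fun y hy => ?_⟩
  · rw [mem_ball] at hy ⊢
    exact hsub y (by linarith)
  · rwa [mul_div_cancel₀ _ (two_ne_zero)]
  · rw [mem_ball] at hy
    set ρ := (d - dist y₀ x₀) / 2 with hρ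
    have hρ0 : 0 < ρ := by rw [hρ]; linarith
    have h1 := hmax (show y ∈ closedBall x₀ d from (hsub y (by linarith)).le)
    simp only [mem_ofPred_eq] at h1
    have h2 : ρ ^ κ ≤ (d - dist y x₀) ^ κ :=
      Real.rpow_le_rpow hρ0.le (by linarith [dist_triangle y y₀ x₀]) hκ.le
    have h3 : ρ ^ κ * u y ≤ ρ ^ κ * (2 ^ κ * u y₀) := by
      calc ρ ^ κ * u y ≤ (d - dist y x₀) ^ κ * u y :=
            mul_le_mul_of_nonneg_right h2 (hpos y).le
        _ ≤ (d - dist y₀ x₀) ^ κ * u y₀ := h1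
        _ = (2 * ρ) ^ κ * u y₀ := by rw [hρ]; congr 2; ring
        _ = _ := by rw [Real.mul_rpow (by norm_num) hρ0.le]; ring
    exact le_of_mul_le_mul_left h3 (Real.rpow_pos_of_pos hρ0 _)

/-- Smallness of the local mass implies smallness of the scaled pointwise value. -/
theorem exists_mass_threshold {u : Euc N → ℝ} (hN : 1 ≤ N) (hu : Continuous u)
    (hpos : ∀ x, 0 < u x) (h2 : ∀ x, x ≠ 0 → ContDiffAt ℝ 2 u x) {C θ s e : ℝ} (hC : 0 < C)
    (hl : ∀ x, x ≠ 0 → -lap u x ≤ C * (‖x‖ ^ θ * u x ^ s)) (hθ : θ < 0) (hs : 1 < s)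
    (he : 0 < e) (hes : e * (s - 1) = 2 + θ) (hintg : Integrable fun x => u x ^ ((N:ℝ) / e))
    {ε : ℝ} (hε : 0 < ε) :
    ∃ η > 0, ∀ x₀ : Euc N, x₀ ≠ 0 → ∫ x in ball x₀ (‖x₀‖ / 2), u x ^ ((N:ℝ) / e) < η →
      (‖x₀‖ / 2) ^ e * u x₀ ≤ ε := by
  have hN0 : (0:ℝ) < N := by exact_mod_cast hN
  set m := (N:ℝ) / e with hm
  have hm0 : 0 < m := by positivity
  have hs1 : 0 < s - 1 := by linarith
  set κ := 2 / (s - 1) with hκ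
  have hκ0 : 0 < κ := by positivity
  have heκ : e ≤ κ := by
    rw [hκ, le_div_iff₀ hs1]; linarith
  set I := ∫ z : Euc N, wt z with hI
  have hI0 : 0 < I := integral_wt_pos
  set c := ((4 : ℝ) ^ m)⁻¹ * (2 ^ κ)⁻¹ * (1 / 4) * I with hc
  have hc0 : 0 < c := by positivity
  set D := C * (2 ^ κ) ^ s with hD
  have hD0 : 0 < D := by positivity
  set ε' := min (ε * 2 ^ (-e)) (ε ^ (-θ / 2) * D ^ (-e / 2)) with hε'
  have hε'0 : 0 < ε' := by positivity
  refine ⟨c * ε' ^ m, by positivity, fun x₀ hx₀ hmass => ?_⟩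
  have hx₀p : 0 < ‖x₀‖ := norm_pos_iff.2 hx₀
  set d := ‖x₀‖ / 2 with hd
  have hd0 : 0 < d := by positivity
  by_contra! hbig
  obtain ⟨y₀, ρ, hρ, hρd, hsub, hval, hub⟩ := exists_doubling_point hu hpos x₀ hd0 hκ0
  set A := u y₀ with hA
  have hA0 : 0 < A := hpos y₀
  have hnorm : ∀ y ∈ ball x₀ d, d ≤ ‖y‖ := by
    intro y hy
    rw [mem_ball, dist_eq_norm] at hy
    have := norm_sub_norm_le x₀ y
    rw [norm_sub_rev] at this
    linarith
  have hne : ∀ y ∈ ball x₀ d, y ≠ 0 := fun y hy => norm_pos_iff.1 (hd0.trans_le (hnorm y hy))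
  set K := D * d ^ θ * A ^ s with hK
  have hK0 : 0 < K := by positivity
  have hlK : ∀ y ∈ ball y₀ ρ, -lap u y ≤ K := by
    intro y hy
    have hy2 : y ∈ ball x₀ d := hsub (ball_subset_ball (by linarith) hy)
    refine (hl y (hne y hy2)).trans ?_
    have h1 : ‖y‖ ^ θ ≤ d ^ θ := Real.rpow_le_rpow_of_nonpos hd0 (hnorm y hy2) hθ.le
    have h3 : u y ^ s ≤ (2 ^ κ * A) ^ s := Real.rpow_le_rpow (hpos y).le (hub y hy) (by linarith)
    rw [Real.mul_rpow (by positivity) hA0.le] at h3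
    calc C * (‖y‖ ^ θ * u y ^ s) ≤ C * (d ^ θ * ((2 ^ κ) ^ s * A ^ s)) := by
          have := (hpos y).le
          gcongr
      _ = K := by rw [hK, hD]; ring
  have main : ∀ r, 0 < r → r ≤ ρ → K * r ^ 2 ≤ A → A * r ^ e < ε' := by
    intro r hr hrρ hKr
    have h1 := local_mass_lower_bound hu hpos hm0 hN (S := ball x₀ d) measurableSet_ball hintg
      (y₀ := y₀) (r := r) (R := 2 * ρ) (B := 2 ^ κ) (K := K) hr (by linarith) (by positivity)
      hKr ((ball_subset_ball (by linarith)).trans hsub)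
      (fun y hy => h2 y (hne y (hsub hy))) (fun y hy => hub y (ball_subset_ball hrρ hy))
      (fun y hy => hlK y (ball_subset_ball hrρ hy))
    rw [← hI, ← hc, ← hA] at h1
    have h3 : A ^ m * r ^ N < ε' ^ m := lt_of_mul_lt_mul_left (h1.trans_lt hmass) hc0.le
    have h4 : (A * r ^ e) ^ m = A ^ m * r ^ N := by
      rw [Real.mul_rpow hA0.le (by positivity), ← Real.rpow_mul hr.le, hm,
        mul_div_cancel₀ _ he.ne', Real.rpow_natCast]
    rw [← h4] at h3
    exact (Real.rpow_lt_rpow_iff (by positivity) hε'0.le hm0).1 h3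
  rcases le_or_gt (K * ρ ^ 2) A with hcase | hcase
  · have h1 := (main ρ hρ le_rfl hcase).trans_le (min_le_left _ _)
    have h3 : d ^ e * u x₀ ≤ (2 * ρ) ^ e * A := by
      have e1 : d ^ κ = d ^ e * d ^ (κ - e) := by rw [← Real.rpow_add hd0]; congr 1; ring
      have e2 : (2 * ρ) ^ κ = (2 * ρ) ^ e * (2 * ρ) ^ (κ - e) := by
        rw [← Real.rpow_add (by positivity)]; congr 1; ring
      have e3 : (2 * ρ) ^ (κ - e) ≤ d ^ (κ - e) :=
        Real.rpow_le_rpow (by positivity) hρd (by linarith)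
      rw [e1, e2] at hval
      have hdk : 0 < d ^ (κ - e) := by positivity
      refine le_of_mul_le_mul_right ?_ hdk
      calc d ^ e * u x₀ * d ^ (κ - e) = d ^ e * d ^ (κ - e) * u x₀ := by ring
        _ ≤ (2 * ρ) ^ e * (2 * ρ) ^ (κ - e) * A := hval
        _ ≤ (2 * ρ) ^ e * d ^ (κ - e) * A := by gcongr
        _ = _ := by ring
    rw [Real.mul_rpow (by norm_num) hρ.le] at h3
    have h4 : (2:ℝ) ^ (-e) * 2 ^ e = 1 := by rw [← Real.rpow_add (by norm_num)]; simp
    have h5 : (0:ℝ) < 2 ^ e := by positivity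
    nlinarith
  · set r := Real.sqrt (A / K) with hr
    have hr0 : 0 < r := Real.sqrt_pos.2 (by positivity)
    have hr2 : r ^ 2 = A / K := Real.sq_sqrt (by positivity)
    have hKr : K * r ^ 2 = A := by rw [hr2]; field_simp
    have hrρ : r ≤ ρ := by
      have : r ^ 2 ≤ ρ ^ 2 := le_of_mul_le_mul_left (hKr.trans_le hcase.le) hK0
      exact (pow_le_pow_iff_left₀ hr0.le hρ.le two_ne_zero).1 this
    have h1 := (main r hr0 hrρ hKr.le).trans_le (min_le_right _ _)
    have h3 : A * r ^ e = (d ^ e * A) ^ (-θ / 2) * D ^ (-e / 2) := by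
      have e1 : r ^ e = (A / K) ^ (e / 2) := by
        rw [← hr2, ← Real.rpow_natCast, ← Real.rpow_mul hr0.le]; congr 1; push_cast; ring
      have e2 : A / K = A ^ (1 - s) * d ^ (-θ) * D ^ (-1 : ℝ) := by
        rw [hK, Real.rpow_sub hA0, Real.rpow_one, Real.rpow_neg hd0.le, Real.rpow_neg_one]
        field_simp
      rw [e1, e2, Real.mul_rpow (by positivity) (by positivity),
        Real.mul_rpow (by positivity) (by positivity), Real.mul_rpow (by positivity) hA0.le,
        ← Real.rpow_mul hA0.le, ← Real.rpow_mul hd0.le, ← Real.rpow_mul hD0.le,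
        ← Real.rpow_mul hd0.le]
      have e3 : A * A ^ ((1 - s) * (e / 2)) = A ^ (-θ / 2) := by
        rw [mul_comm, ← Real.rpow_add_one hA0.ne']; congr 1; linarith
      rw [← mul_assoc, ← mul_assoc, e3, show -θ * (e / 2) = e * (-θ / 2) by ring,
        show -1 * (e / 2) = -e / 2 by ring]
      ring
    have h4 : d ^ e * u x₀ ≤ d ^ e * A := by
      have : (2 * ρ) ^ κ * A ≤ d ^ κ * A :=
        mul_le_mul_of_nonneg_right (Real.rpow_le_rpow (by positivity) hρd hκ0.le) hA0.le
      have h5 := le_of_mul_le_mul_left (hval.trans this) (Real.rpow_pos_of_pos hd0 _)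
      gcongr
    have h5 : ε ^ (-θ / 2) ≤ (d ^ e * A) ^ (-θ / 2) :=
      Real.rpow_le_rpow hε.le (hbig.le.trans h4) (by linarith)
    rw [h3] at h1
    have h6 : 0 < D ^ (-e / 2) := by positivity
    have := lt_of_mul_lt_mul_right h1 h6.le
    linarith

theorem eventually_tail_small {f : Euc N → ℝ} (hf : Integrable f) (hf0 : ∀ x, 0 ≤ f x)
    {η : ℝ} (hη : 0 < η) :
    ∃ R : ℝ, ∀ x₀ : Euc N, R ≤ ‖x₀‖ → ∫ x in ball x₀ (‖x₀‖ / 2), f x < η := by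
  have ht : Tendsto (fun n : ℕ => ∫ x in (ball (0 : Euc N) n)ᶜ, f x) atTop
      (𝓝 (∫ x in ⋂ n : ℕ, (ball (0 : Euc N) n)ᶜ, f x)) := by
    refine tendsto_setIntegral_of_antitone (fun n => measurableSet_ball.compl) ?_
      ⟨0, hf.integrableOn⟩
    intro m n hmn
    exact compl_subset_compl.2 (ball_subset_ball (by exact_mod_cast hmn))
  have he : ⋂ n : ℕ, (ball (0 : Euc N) n)ᶜ = ∅ := by
    rw [← compl_iUnion, iUnion_ball_nat, compl_univ]
  rw [he, setIntegral_empty] at ht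
  obtain ⟨n, hn⟩ := (ht.eventually_lt_const hη).exists
  refine ⟨2 * n, fun x₀ hx₀ => lt_of_le_of_lt ?_ hn⟩
  refine setIntegral_mono_set hf.integrableOn (Eventually.of_forall hf0)
    (LE.le.eventuallyLE fun x hx => ?_)
  simp only [mem_compl_iff, mem_ball, dist_zero_right, not_lt]
  rw [mem_ball, dist_eq_norm] at hx
  have := norm_sub_norm_le x₀ x
  rw [norm_sub_rev] at this
  linarith

/-- Fast decay of solutions with finite critical mass. -/
theorem scaled_decay {u : Euc N → ℝ} (hN : 1 ≤ N) (hu : Continuous u)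
    (hpos : ∀ x, 0 < u x) (h2 : ∀ x, x ≠ 0 → ContDiffAt ℝ 2 u x) {C θ s e : ℝ} (hC : 0 < C)
    (hl : ∀ x, x ≠ 0 → -lap u x ≤ C * (‖x‖ ^ θ * u x ^ s)) (hθ : θ < 0) (hs : 1 < s)
    (he : 0 < e) (hes : e * (s - 1) = 2 + θ) (hintg : Integrable fun x => u x ^ ((N:ℝ) / e))
    {ε : ℝ} (hε : 0 < ε) : ∃ R > 0, ∀ x : Euc N, R ≤ ‖x‖ → ‖x‖ ^ e * u x ≤ ε := by
  obtain ⟨η, hη, h⟩ := exists_mass_threshold hN hu hpos h2 hC hl hθ hs he hes hintg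
    (show 0 < ε / 2 ^ e by positivity)
  obtain ⟨R, hR⟩ := eventually_tail_small hintg
    (fun x => (Real.rpow_pos_of_pos (hpos x) _).le) hη
  refine ⟨max R 1, by positivity, fun x hx => ?_⟩
  have hx0 : 0 < ‖x‖ := one_pos.trans_le ((le_max_right _ _).trans hx)
  have h1 := h x (norm_pos_iff.1 hx0) (hR x ((le_max_left _ _).trans hx))
  rw [Real.div_rpow hx0.le (by norm_num), div_mul_eq_mul_div,
    div_le_div_iff_of_pos_right (by positivity)] at h1
  exact h1

/-- Almost fundamental-solution decay. -/
theorem improved_decay {u : Euc N → ℝ} (hu : Continuous u)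
    (hpos : ∀ x, 0 < u x) (h2 : ∀ x, x ≠ 0 → ContDiffAt ℝ 2 u x) {C θ s e : ℝ} (hC : 0 < C)
    (hl : ∀ x, x ≠ 0 → -lap u x ≤ C * (‖x‖ ^ θ * u x ^ s)) (hs : 1 < s)
    (he : 0 < e) (heN : e < N - 2) (hes : e * (s - 1) = 2 + θ)
    (hdec : ∀ ε > 0, ∃ R > 0, ∀ x : Euc N, R ≤ ‖x‖ → ‖x‖ ^ e * u x ≤ ε)
    {k : ℝ} (hk : 0 < k) (hkN : k < N - 2) :
    ∃ A R, 0 < A ∧ 0 < R ∧ ∀ x : Euc N, R ≤ ‖x‖ → u x ≤ A * ‖x‖ ^ (-k) := by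
  set c := min (k * (N - 2 - k)) (e * (N - 2 - e)) with hc
  have hc0 : 0 < c := lt_min (mul_pos hk (by linarith)) (mul_pos he (by linarith))
  have hs1 : 0 < s - 1 := by linarith
  obtain ⟨R, hR0, hR⟩ := hdec ((c / (2 * C)) ^ (1 / (s - 1))) (by positivity)
  have hV : ∀ x : Euc N, R ≤ ‖x‖ → -lap u x < c * ‖x‖ ^ (-2 : ℝ) * u x := by
    intro x hx
    have hx0 : 0 < ‖x‖ := hR0.trans_le hx
    have hup := hpos x
    refine (hl x (norm_pos_iff.1 hx0)).trans_lt ?_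
    have h1 := Real.rpow_le_rpow (by positivity) (hR x hx) hs1.le
    rw [← Real.rpow_mul (by positivity), one_div_mul_cancel hs1.ne', Real.rpow_one,
      Real.mul_rpow (by positivity) hup.le, ← Real.rpow_mul hx0.le, hes] at h1
    have e1 : ‖x‖ ^ θ * u x ^ s = ‖x‖ ^ (-2 : ℝ) * u x * (‖x‖ ^ (2 + θ) * u x ^ (s - 1)) := by
      rw [show θ = -2 + (2 + θ) by ring, Real.rpow_add hx0, show s = (s - 1) + 1 by ring,
        Real.rpow_add_one hup.ne']
      ring_nf
    rw [e1]
    have h3 : 0 < ‖x‖ ^ (-2 : ℝ) * u x := by positivity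
    calc C * (‖x‖ ^ (-2 : ℝ) * u x * (‖x‖ ^ (2 + θ) * u x ^ (s - 1)))
        ≤ C * (‖x‖ ^ (-2 : ℝ) * u x * (c / (2 * C))) := by gcongr
      _ = c / 2 * (‖x‖ ^ (-2 : ℝ) * u x) := by field_simp
      _ < c * (‖x‖ ^ (-2 : ℝ) * u x) := by nlinarith
      _ = _ := by ring
  obtain ⟨M, hM⟩ := ((isCompact_sphere (0 : Euc N) R).image hu).bddAbove
  have hM' : ∀ x : Euc N, ‖x‖ = R → u x ≤ max M 1 := fun x hx =>
    (hM ⟨x, by simpa using hx, rfl⟩).trans (le_max_left _ _)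
  set A := max M 1 * R ^ k with hA
  have hA0 : 0 < A := by positivity
  refine ⟨A, R, hA0, hR0, fun x₁ hx₁ => ?_⟩
  have key : ∀ δ : ℝ, 0 < δ → u x₁ ≤ A * ‖x₁‖ ^ (-k) + δ * ‖x₁‖ ^ (-e) := by
    intro δ hδ
    by_contra! hlt
    let φ : Euc N → ℝ := fun x => A * ‖x‖ ^ (-k) + δ * ‖x‖ ^ (-e)
    have hφ0 : ∀ x : Euc N, 0 < ‖x‖ → 0 < φ x := fun x hx => by simp only [φ]; positivity
    have hφ2 : ∀ x : Euc N, x ≠ 0 → ContDiffAt ℝ 2 φ x := fun x hx =>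
      (contDiffAt_const.mul (contDiffAt_norm_rpow _ hx)).add
        (contDiffAt_const.mul (contDiffAt_norm_rpow _ hx))
    have hφl : ∀ x : Euc N, x ≠ 0 → c * ‖x‖ ^ (-2 : ℝ) * φ x ≤ -lap φ x := by
      intro x hx
      have hxp : 0 < ‖x‖ := norm_pos_iff.2 hx
      rw [lap_add (f := fun x : Euc N => A * ‖x‖ ^ (-k)) (g := fun x : Euc N => δ * ‖x‖ ^ (-e))
        (contDiffAt_const.mul (contDiffAt_norm_rpow _ hx))
        (contDiffAt_const.mul (contDiffAt_norm_rpow _ hx)),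
        lap_const_mul _ (contDiffAt_norm_rpow _ hx), lap_const_mul _ (contDiffAt_norm_rpow _ hx),
        lap_norm_rpow _ hx, lap_norm_rpow _ hx, sub_eq_add_neg (-k) 2, sub_eq_add_neg (-e) 2,
        Real.rpow_add hxp, Real.rpow_add hxp]
      have h1 : 0 < ‖x‖ ^ (-2 : ℝ) * (A * ‖x‖ ^ (-k)) := by positivity
      have h3 : 0 < ‖x‖ ^ (-2 : ℝ) * (δ * ‖x‖ ^ (-e)) := by positivity
      have h4 := mul_le_mul_of_nonneg_right (min_le_left _ _ : c ≤ k * (N - 2 - k)) h1.le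
      have h5 := mul_le_mul_of_nonneg_right (min_le_right _ _ : c ≤ e * (N - 2 - e)) h3.le
      simp only [φ]
      linarith
    obtain ⟨R₂, hR₂0, hR₂⟩ := hdec δ hδ
    have hfar : ∀ x : Euc N, R₂ ≤ ‖x‖ → u x ≤ φ x := by
      intro x hx
      have hxp : 0 < ‖x‖ := hR₂0.trans_le hx
      have h1 := hR₂ x hx
      have h3 : u x ≤ δ * ‖x‖ ^ (-e) := by
        rw [Real.rpow_neg hxp.le, ← div_eq_mul_inv, le_div_iff₀ (by positivity)]
        linarith
      have : 0 < A * ‖x‖ ^ (-k) := by positivity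
      simp only [φ]; linarith
    have hnear : ∀ x : Euc N, ‖x‖ = R → u x ≤ φ x := by
      intro x hx
      have h1 := hM' x hx
      have h3 : A * ‖x‖ ^ (-k) = max M 1 := by
        rw [hx, hA, mul_assoc, ← Real.rpow_add hR0]; simp
      have : 0 < δ * ‖x‖ ^ (-e) := by
        have : 0 < ‖x‖ := hx ▸ hR0
        positivity
      simp only [φ]; linarith
    let S : Set (Euc N) := closedBall 0 R₂ \ ball 0 R
    have hS : IsCompact S := (isCompact_closedBall 0 R₂).diff isOpen_ball
    have hSR : ∀ x ∈ S, R ≤ ‖x‖ := fun x hx => by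
      have := hx.2
      simpa using this
    have hx₁S : x₁ ∈ S := by
      refine ⟨?_, by simpa using hx₁⟩
      simp only [mem_closedBall, dist_zero_right]
      by_contra! h
      linarith [hfar x₁ h.le]
    obtain ⟨y, hyS, hy⟩ := hS.exists_isMaxOn (f := fun x => u x / φ x) ⟨x₁, hx₁S⟩ (by
      refine ContinuousOn.div hu.continuousOn (fun x hx => ?_) fun x hx => ?_
      · exact (hφ2 x (norm_pos_iff.1 (hR0.trans_le (hSR x hx)))).continuousAt.continuousWithinAt
      · exact (hφ0 x (hR0.trans_le (hSR x hx))).ne')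
    set t := u y / φ y with ht
    have hyR := hSR y hyS
    have hy0 : 0 < ‖y‖ := hR0.trans_le hyR
    have hyne := norm_pos_iff.1 hy0
    have hx₁0 : 0 < ‖x₁‖ := hR0.trans_le hx₁
    have ht1 : 1 < t := lt_of_lt_of_le ((one_lt_div (hφ0 x₁ hx₁0)).2 hlt) (hy hx₁S)
    have huy : u y = t * φ y := (div_mul_cancel₀ _ (hφ0 y hy0).ne').symm
    have hgt : φ y < u y := by rw [huy]; nlinarith [hφ0 y hy0]
    have hyR' : R < ‖y‖ := lt_of_le_of_ne hyR fun h => by linarith [hnear y h.symm]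
    have hyR₂ : ‖y‖ < R₂ := by
      by_contra! h
      linarith [hfar y h]
    have hmax : IsLocalMax (fun x => u x - t * φ x) y := by
      have h1 : ∀ᶠ x in 𝓝 y, R < ‖x‖ := (continuous_norm.tendsto y).eventually_const_lt hyR'
      have h3 : ∀ᶠ x in 𝓝 y, ‖x‖ < R₂ := (continuous_norm.tendsto y).eventually_lt_const hyR₂
      filter_upwards [h1, h3] with x h4 h5
      have h6 : u x / φ x ≤ t := hy (show x ∈ S from ⟨by simpa using h5.le, by simpa using h4.le⟩)
      rw [div_le_iff₀ (hφ0 x (hR0.trans h4))] at h6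
      linarith
    have h1 := hmax.lap_nonpos ((h2 y hyne).sub (contDiffAt_const.mul (hφ2 y hyne)))
    rw [lap_sub (h2 y hyne) (contDiffAt_const.mul (hφ2 y hyne)), lap_const_mul _ (hφ2 y hyne)] at h1
    have h3 := hV y hyR
    have h4 := mul_le_mul_of_nonneg_left (hφl y hyne) (zero_lt_one.trans ht1).le
    rw [huy] at h3
    linarith
  refine le_of_forall_pos_le_add fun ε hε => ?_
  have hK : 0 < ‖x₁‖ ^ (-e) := Real.rpow_pos_of_pos (hR0.trans_le hx₁) _
  have h1 := key (ε / ‖x₁‖ ^ (-e)) (by positivity)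
  rwa [div_mul_cancel₀ _ hK.ne'] at h1

end Decay

section PohozaevField

open Filter Topology

variable {N : ℕ} {u v h : Euc N → ℝ} {x : Euc N}

theorem pd_sum {ι : Type*} (s : Finset ι) {f : ι → Euc N → ℝ} {i : Fin N}
    (hf : ∀ j ∈ s, DifferentiableAt ℝ (f j) x) :
    pd i (fun y => ∑ j ∈ s, f j y) x = ∑ j ∈ s, pd i (f j) x := by
  simp [pd, fderiv_fun_sum hf]

/-- The radial derivative `x · ∇u`. -/
def radial (u : Euc N → ℝ) (x : Euc N) : ℝ := ∑ j, x j * pd j u x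

/-- The product `∇u · ∇v`. -/
def gradDot (u v : Euc N → ℝ) (x : Euc N) : ℝ := ∑ j, pd j u x * pd j v x

/-- The Rellich–Pohozaev vector field with potential `h`. -/
def pohField (h : Euc N → ℝ) (a₁ a₂ : ℝ) (u v : Euc N → ℝ) (i : Fin N) (x : Euc N) : ℝ :=
  pd i u x * radial v x + pd i v x * radial u x + x i * (h x - gradDot u v x)
    + (a₁ * (v x * pd i u x) + a₂ * (u x * pd i v x))

theorem differentiableAt_coord (j : Fin N) : DifferentiableAt ℝ (fun y : Euc N => y j) x :=
  (EuclideanSpace.proj j : Euc N →L[ℝ] ℝ).differentiableAt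

theorem contDiffAt_coord (j : Fin N) {n : WithTop ℕ∞} :
    ContDiffAt ℝ n (fun y : Euc N => y j) x :=
  (EuclideanSpace.proj j : Euc N →L[ℝ] ℝ).contDiff.contDiffAt

theorem contDiffAt_radial (hu : ContDiffAt ℝ 2 u x) : ContDiffAt ℝ 1 (radial u) x :=
  ContDiffAt.sum fun j _ => (contDiffAt_coord j).mul hu.pd_one

theorem contDiffAt_gradDot (hu : ContDiffAt ℝ 2 u x) (hv : ContDiffAt ℝ 2 v x) :
    ContDiffAt ℝ 1 (gradDot u v) x :=
  ContDiffAt.sum fun _ _ => hu.pd_one.mul hv.pd_one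

theorem pd_radial (hu : ContDiffAt ℝ 2 u x) (i : Fin N) :
    pd i (radial u) x = pd i u x + ∑ j, x j * pd i (pd j u) x := by
  unfold radial
  rw [pd_sum (f := fun j y => y j * pd j u y) Finset.univ
    fun j _ => (differentiableAt_coord j).mul hu.differentiableAt_pd]
  have : ∀ j, pd i (fun y : Euc N => y j * pd j u y) x
      = (if i = j then pd j u x else 0) + x j * pd i (pd j u) x := by
    intro j
    rw [pd_mul (f := fun y : Euc N => y j) (differentiableAt_coord j) hu.differentiableAt_pd,
      pd_coord]
    split_ifs <;> simp
  simp [this, Finset.sum_add_distrib]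

theorem pd_gradDot (hu : ContDiffAt ℝ 2 u x) (hv : ContDiffAt ℝ 2 v x) (i : Fin N) :
    pd i (gradDot u v) x
      = ∑ j, (pd i (pd j u) x * pd j v x + pd j u x * pd i (pd j v) x) := by
  unfold gradDot
  rw [pd_sum (f := fun j y => pd j u y * pd j v y) Finset.univ
    fun j _ => hu.differentiableAt_pd.mul hv.differentiableAt_pd]
  exact Finset.sum_congr rfl fun j _ => pd_mul hu.differentiableAt_pd hv.differentiableAt_pd

theorem contDiffAt_pohField (hu : ContDiffAt ℝ 2 u x) (hv : ContDiffAt ℝ 2 v x)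
    (hh : ContDiffAt ℝ 1 h x) (a₁ a₂ : ℝ) (i : Fin N) :
    ContDiffAt ℝ 1 (pohField h a₁ a₂ u v i) x := by
  have hu1 : ContDiffAt ℝ 1 u x := hu.of_le (by norm_num)
  have hv1 : ContDiffAt ℝ 1 v x := hv.of_le (by norm_num)
  exact (((hu.pd_one.mul (contDiffAt_radial hv)).add (hv.pd_one.mul (contDiffAt_radial hu))).add
    ((contDiffAt_coord i).mul (hh.sub (contDiffAt_gradDot hu hv)))).add
    ((contDiffAt_const.mul (hv1.mul hu.pd_one)).add (contDiffAt_const.mul (hu1.mul hv.pd_one)))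

theorem pd_pohField (hu : ContDiffAt ℝ 2 u x) (hv : ContDiffAt ℝ 2 v x)
    (hh : ContDiffAt ℝ 1 h x) (a₁ a₂ : ℝ) (i : Fin N) :
    pd i (pohField h a₁ a₂ u v i) x
      = pd i (pd i u) x * radial v x + pd i (pd i v) x * radial u x
        + 2 * (pd i u x * pd i v x)
        + (∑ j, pd i u x * (x j * pd i (pd j v) x) - ∑ j, x i * (pd j u x * pd i (pd j v) x))
        + (∑ j, pd i v x * (x j * pd i (pd j u) x) - ∑ j, x i * (pd j v x * pd i (pd j u) x))
        + (h x - gradDot u v x) + x i * pd i h x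
        + (a₁ * (pd i u x * pd i v x) + a₁ * (v x * pd i (pd i u) x))
        + (a₂ * (pd i u x * pd i v x) + a₂ * (u x * pd i (pd i v) x)) := by
  have du := hu.differentiableAt_two
  have dv := hv.differentiableAt_two
  have dpu : DifferentiableAt ℝ (pd i u) x := hu.differentiableAt_pd
  have dpv : DifferentiableAt ℝ (pd i v) x := hv.differentiableAt_pd
  have dru := (contDiffAt_radial hu).differentiableAt (by norm_num)
  have drv := (contDiffAt_radial hv).differentiableAt (by norm_num)
  have dg := (contDiffAt_gradDot hu hv).differentiableAt (by norm_num)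
  have dh := hh.differentiableAt (by norm_num)
  have dx := differentiableAt_coord (x := x) i
  have e1 : pd i (fun y => h y - gradDot u v y) x = pd i h x - pd i (gradDot u v) x := by
    simp [pd, fderiv_fun_sub dh dg]
  unfold pohField
  rw [pd_add (f := fun y => pd i u y * radial v y + pd i v y * radial u y
        + y i * (h y - gradDot u v y)) (g := fun y => a₁ * (v y * pd i u y) + a₂ * (u y * pd i v y))
      (((dpu.mul drv).add (dpv.mul dru)).add (dx.mul (dh.sub dg)))
      (((dv.mul dpu).const_mul a₁).add ((du.mul dpv).const_mul a₂)),
    pd_add (f := fun y => pd i u y * radial v y + pd i v y * radial u y)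
      (g := fun y => y i * (h y - gradDot u v y))
      ((dpu.mul drv).add (dpv.mul dru)) (dx.mul (dh.sub dg)),
    pd_add (f := fun y => pd i u y * radial v y) (g := fun y => pd i v y * radial u y)
      (dpu.mul drv) (dpv.mul dru),
    pd_mul dpu drv, pd_mul dpv dru,
    pd_mul (f := fun y : Euc N => y i) (g := fun y => h y - gradDot u v y) dx (dh.sub dg), e1,
    pd_coord, if_pos rfl,
    pd_add (f := fun y => a₁ * (v y * pd i u y)) (g := fun y => a₂ * (u y * pd i v y))
      ((dv.mul dpu).const_mul a₁) ((du.mul dpv).const_mul a₂),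
    pd_const_mul (f := fun y => v y * pd i u y) a₁ (dv.mul dpu),
    pd_const_mul (f := fun y => u y * pd i v y) a₂ (du.mul dpv),
    pd_mul dv dpu, pd_mul du dpv, pd_radial hu, pd_radial hv, pd_gradDot hu hv,
    Finset.sum_add_distrib, ← Finset.mul_sum, ← Finset.mul_sum, ← Finset.mul_sum, ← Finset.mul_sum]
  have e2 : ∑ j, pd j v x * pd i (pd j u) x = ∑ j, pd i (pd j u) x * pd j v x :=
    Finset.sum_congr rfl fun j _ => mul_comm _ _
  rw [e2]
  ring

theorem div_pohField (hu : ContDiffAt ℝ 2 u x) (hv : ContDiffAt ℝ 2 v x)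
    (hh : ContDiffAt ℝ 1 h x) (a₁ a₂ : ℝ) :
    ∑ i, pd i (pohField h a₁ a₂ u v i) x
      = lap u x * radial v x + lap v x * radial u x + (2 - N + a₁ + a₂) * gradDot u v x
        + N * h x + radial h x + a₁ * (v x * lap u x) + a₂ * (u x * lap v x) := by
  simp only [pd_pohField hu hv hh, Finset.sum_add_distrib, Finset.sum_sub_distrib,
    ← Finset.mul_sum, ← Finset.sum_mul, Finset.sum_const, Finset.card_univ, Fintype.card_fin,
    nsmul_eq_mul]
  have swap : ∀ f g : Euc N → ℝ, ContDiffAt ℝ 2 g x →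
      ∑ i, pd i f x * ∑ j, x j * pd i (pd j g) x = ∑ i, x i * ∑ j, pd j f x * pd i (pd j g) x := by
    intro f g hg
    simp only [Finset.mul_sum]
    rw [Finset.sum_comm]
    refine Finset.sum_congr rfl fun i _ => Finset.sum_congr rfl fun j _ => ?_
    rw [pd_comm hg]
    ring
  rw [swap u v hv, swap v u hu, lap_eq hu, lap_eq hv]
  simp only [radial, gradDot]
  ring

variable {p q a b : ℝ}

/-- The potential of the Hénon–Lane–Emden system. -/
def pohPot (p q a b : ℝ) (u v : Euc N → ℝ) (x : Euc N) : ℝ :=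
  (p + 1)⁻¹ * (‖x‖ ^ a * v x ^ (p + 1)) + (q + 1)⁻¹ * (‖x‖ ^ b * u x ^ (q + 1))

theorem contDiffAt_weight_rpow (hx : x ≠ 0) (hv : ContDiffAt ℝ 2 v x) (hv0 : 0 < v x) (a p : ℝ) :
    ContDiffAt ℝ 1 (fun y => ‖y‖ ^ a * v y ^ p) x :=
  (contDiffAt_norm_rpow a hx).mul
    ((Real.contDiffAt_rpow_const_of_ne hv0.ne').comp x (hv.of_le (by norm_num)))

theorem radial_weight_rpow (hx : x ≠ 0) (hv : ContDiffAt ℝ 2 v x) (hv0 : 0 < v x) (a p : ℝ) :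
    radial (fun y => ‖y‖ ^ a * v y ^ p) x
      = a * (‖x‖ ^ a * v x ^ p) + p * (‖x‖ ^ a * v x ^ (p - 1)) * radial v x := by
  have hxp : 0 < ‖x‖ := norm_pos_iff.2 hx
  have hd : HasDerivAt (fun t : ℝ => t ^ p) (p * v x ^ (p - 1)) (v x) :=
    Real.hasDerivAt_rpow_const (Or.inl hv0.ne')
  have h1 : ∀ i : Fin N, x i * pd i (fun y => ‖y‖ ^ a * v y ^ p) x
      = a * ‖x‖ ^ (a - 2) * v x ^ p * x i ^ 2
        + p * (‖x‖ ^ a * v x ^ (p - 1)) * (x i * pd i v x) := by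
    intro i
    rw [pd_mul (f := fun y : Euc N => ‖y‖ ^ a) (g := fun y => v y ^ p)
      ((contDiffAt_norm_rpow (n := 1) a hx).differentiableAt (by norm_num))
      (hd.differentiableAt.comp x hv.differentiableAt_two), pd_norm_rpow _ hx,
      pd_comp (φ := fun t => t ^ p) hd hv.differentiableAt_two]
    ring
  simp only [radial, h1, Finset.sum_add_distrib, ← Finset.mul_sum, sum_sq_eq_norm_sq]
  have : ‖x‖ ^ a = ‖x‖ ^ (a - 2) * ‖x‖ ^ 2 := by
    rw [← Real.rpow_natCast, ← Real.rpow_add hxp]; congr 1; push_cast; ring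
  rw [this]
  ring

theorem IsPosSol.contDiffAt_pohPot (hs : IsPosSol p q a b u v) (hx : x ≠ 0) :
    ContDiffAt ℝ 1 (pohPot p q a b u v) x :=
  (contDiffAt_const.mul (contDiffAt_weight_rpow hx (hs.cdV x hx) (hs.posV x) _ _)).add
    (contDiffAt_const.mul (contDiffAt_weight_rpow hx (hs.cdU x hx) (hs.posU x) _ _))

theorem IsPosSol.div_pohField (hs : IsPosSol p q a b u v) (hp : 0 < p) (hq : 0 < q) (hx : x ≠ 0)
    {a₁ a₂ μ : ℝ} (h₁ : a₁ = (N + a) / (p + 1) + μ) (h₂ : a₂ = (N + b) / (q + 1) + μ)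
    (h₁₂ : a₁ + a₂ = N - 2) :
    ∑ i, pd i (pohField (pohPot p q a b u v) a₁ a₂ u v i) x
      = -(μ * (‖x‖ ^ a * v x ^ (p + 1) + ‖x‖ ^ b * u x ^ (q + 1))) := by
  have hu := hs.cdU x hx
  have hv := hs.cdV x hx
  rw [_root_.div_pohField hu hv (hs.contDiffAt_pohPot hx)]
  have d1 := (contDiffAt_weight_rpow hx hv (hs.posV x) a (p + 1)).differentiableAt (by norm_num)
  have d2 := (contDiffAt_weight_rpow hx hu (hs.posU x) b (q + 1)).differentiableAt (by norm_num)
  have hr : radial (pohPot p q a b u v) x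
      = (p + 1)⁻¹ * radial (fun y => ‖y‖ ^ a * v y ^ (p + 1)) x
        + (q + 1)⁻¹ * radial (fun y => ‖y‖ ^ b * u y ^ (q + 1)) x := by
    simp only [radial, Finset.mul_sum, ← Finset.sum_add_distrib]
    refine Finset.sum_congr rfl fun i _ => ?_
    unfold pohPot
    rw [pd_add (f := fun y => (p + 1)⁻¹ * (‖y‖ ^ a * v y ^ (p + 1)))
      (g := fun y => (q + 1)⁻¹ * (‖y‖ ^ b * u y ^ (q + 1))) (d1.const_mul _) (d2.const_mul _),
      pd_const_mul _ d1, pd_const_mul _ d2]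
    ring
  have e1 : lap u x = -(‖x‖ ^ a * v x ^ p) := by rw [← hs.eqU x hx, neg_neg]
  have e2 : lap v x = -(‖x‖ ^ b * u x ^ q) := by rw [← hs.eqV x hx, neg_neg]
  rw [hr, radial_weight_rpow hx hv (hs.posV x), radial_weight_rpow hx hu (hs.posU x), e1, e2,
    pohPot, add_sub_cancel_right, add_sub_cancel_right, Real.rpow_add_one (hs.posV x).ne',
    Real.rpow_add_one (hs.posU x).ne', show 2 - (N:ℝ) + a₁ + a₂ = 0 by linarith, h₁, h₂]
  have hp1 : p + 1 ≠ 0 := by positivity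
  have hq1 : q + 1 ≠ 0 := by positivity
  field_simp
  ring

end PohozaevField

section FluxBound

open Filter Topology
open scoped ContDiff

variable {N : ℕ}

theorem pd_eq_zero_of_eventually_const {f : Euc N → ℝ} {x : Euc N} {c : ℝ} {i : Fin N}
    (h : ∀ᶠ y in 𝓝 x, f y = c) : pd i f x = 0 := by
  rw [pd_congr (g := fun _ => c) h]; simp [pd]

theorem lap_eq_zero_of_eventually_const {f : Euc N → ℝ} {x : Euc N} {c : ℝ}
    (h : ∀ᶠ y in 𝓝 x, f y = c) : lap f x = 0 := by
  rw [lap_congr (g := fun _ => c) h, lap_const]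

theorem eventually_norm_lt {x : Euc N} {r : ℝ} (h : ‖x‖ < r) : ∀ᶠ y in 𝓝 x, ‖y‖ < r :=
  continuous_norm.continuousAt.eventually (eventually_lt_nhds h)

theorem eventually_lt_norm {x : Euc N} {r : ℝ} (h : r < ‖x‖) : ∀ᶠ y in 𝓝 x, r < ‖y‖ :=
  continuous_norm.continuousAt.eventually (eventually_gt_nhds h)

/-- A function supported in an annulus around the origin. -/
def AnnularSupport (η : Euc N → ℝ) : Prop :=
  ∃ ε R : ℝ, 0 < ε ∧ (∀ z, ‖z‖ < ε → η z = 0) ∧ ∀ z, R ≤ ‖z‖ → η z = 0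

variable {η F G : Euc N → ℝ}

theorem AnnularSupport.lap (h : AnnularSupport η) : AnnularSupport (lap η) := by
  obtain ⟨ε, R, he, h0, h1⟩ := h
  refine ⟨ε, R + 1, he, fun z hz => lap_eq_zero_of_eventually_const (c := 0) ?_,
    fun z hz => lap_eq_zero_of_eventually_const (c := 0) ?_⟩
  · filter_upwards [eventually_norm_lt hz] with y hy using h0 y hy
  · filter_upwards [eventually_lt_norm (r := R) (by linarith)] with y hy using h1 y hy.le

theorem AnnularSupport.hasCompactSupport (h : AnnularSupport η) : HasCompactSupport η := by
  obtain ⟨ε, R, _, _, h⟩ := h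
  exact hasCompactSupport_of_eq_zero h

theorem AnnularSupport.pd (h : AnnularSupport η) (i : Fin N) : AnnularSupport (pd i η) := by
  obtain ⟨ε, R, he, h0, h1⟩ := h
  refine ⟨ε, R + 1, he, fun z hz => pd_eq_zero_of_eventually_const (c := 0) ?_,
    fun z hz => pd_eq_zero_of_eventually_const (c := 0) ?_⟩
  · filter_upwards [eventually_norm_lt hz] with y hy using h0 y hy
  · filter_upwards [eventually_lt_norm (r := R) (by linarith)] with y hy using h1 y hy.le

theorem AnnularSupport.continuous_mul (h : AnnularSupport η) (hη : Continuous η)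
    (hG : ∀ x ≠ 0, ContinuousAt G x) : Continuous fun x => η x * G x := by
  obtain ⟨ε, R, he, h0, _⟩ := h
  refine continuous_iff_continuousAt.2 fun x => ?_
  rcases eq_or_ne x 0 with rfl | hx
  · have : (fun _ : Euc N => (0:ℝ)) =ᶠ[𝓝 0] fun x => η x * G x := by
      filter_upwards [eventually_norm_lt (x := (0 : Euc N)) (r := ε) (by simpa)] with y hy
      rw [h0 y hy, zero_mul]
    exact continuousAt_const.congr this
  · exact hη.continuousAt.mul (hG x hx)

theorem AnnularSupport.integrable_mul (h : AnnularSupport η) (hη : Continuous η)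
    (hG : ∀ x ≠ 0, ContinuousAt G x) : Integrable fun x => η x * G x :=
  (h.continuous_mul hη hG).integrable_of_hasCompactSupport h.hasCompactSupport.mul_right

theorem continuous_pd (hη : ContDiff ℝ 1 η) (i : Fin N) : Continuous (pd i η) :=
  (hη.continuous_fderiv (by norm_num)).clm_apply continuous_const

theorem continuousAt_pd {x : Euc N} (hF : ContDiffAt ℝ 1 F x) (i : Fin N) :
    ContinuousAt (pd i F) x :=
  (hF.fderiv_right (m := 0) (by norm_num)).continuousAt.clm_apply continuousAt_const

theorem AnnularSupport.integral_mul_pd (h : AnnularSupport η) (hη : ContDiff ℝ 1 η)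
    (hF : ∀ x ≠ 0, ContDiffAt ℝ 1 F x) (i : Fin N) :
    ∫ x, η x * _root_.pd i F x = -∫ x, _root_.pd i η x * F x := by
  have hF0 : ∀ x ≠ 0, ContinuousAt F x := fun x hx => (hF x hx).continuousAt
  have hts : ∀ x ∈ tsupport η, x ≠ 0 := by
    obtain ⟨ε, R, he, h0, _⟩ := h
    rintro x hx rfl
    refine (notMem_tsupport_iff_eventuallyEq.2 ?_) hx
    filter_upwards [eventually_norm_lt (x := (0 : Euc N)) (r := ε) (by simpa)] with y hy
      using h0 y hy
  exact integral_mul_fderiv_eq_neg_fderiv_mul_of_integrable (μ := (volume : Measure (Euc N)))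
    (f := η) (g := F) (v := EuclideanSpace.single i 1)
    ((h.pd i).integrable_mul (continuous_pd hη i) hF0)
    (h.integrable_mul hη.continuous fun x hx => continuousAt_pd (hF x hx) i)
    (h.integrable_mul hη.continuous hF0)
    (fun x _ => hη.differentiable (by norm_num) x)
    (fun x hx => (hF x (hts x hx)).differentiableAt (by norm_num))

theorem continuousAt_lap {x : Euc N} (hF : ContDiffAt ℝ 2 F x) : ContinuousAt (lap F) x := by
  have h1 : (fun y => ∑ i, pd i (pd i F) y) =ᶠ[𝓝 x] lap F := by
    filter_upwards [hF.eventually_two] with y hy using (lap_eq hy).symm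
  have h2 : ContinuousAt (fun y => ∑ i, pd i (pd i F) y) x :=
    tendsto_finsetSum _ fun i _ => continuousAt_pd hF.pd_one i
  exact h2.congr h1

theorem AnnularSupport.integral_mul_lap (h : AnnularSupport η) (hη : ContDiff ℝ 2 η)
    (hF : ∀ x ≠ 0, ContDiffAt ℝ 2 F x) : ∫ x, η x * _root_.lap F x = ∫ x, _root_.lap η x * F x := by
  have hη1 : ContDiff ℝ 1 η := hη.of_le (by norm_num)
  have hpη : ∀ i, ContDiff ℝ 1 (_root_.pd i η) := fun i =>
    contDiff_iff_contDiffAt.2 fun y => hη.contDiffAt.pd_one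
  have hpF : ∀ i, ∀ x ≠ 0, ContDiffAt ℝ 1 (_root_.pd i F) x := fun i x hx => (hF x hx).pd_one
  have e1 : (fun x => η x * _root_.lap F x) = fun x => ∑ i, η x * _root_.pd i (_root_.pd i F) x := by
    funext x
    rcases eq_or_ne x 0 with rfl | hx
    · obtain ⟨ε, R, he, h0, _⟩ := h
      simp [h0 0 (by simpa)]
    · rw [lap_eq (hF x hx), Finset.mul_sum]
  have e2 : (fun x => _root_.lap η x * F x) = fun x => ∑ i, _root_.pd i (_root_.pd i η) x * F x := by
    funext x
    rw [lap_eq hη.contDiffAt, Finset.sum_mul]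
  rw [e1, e2, integral_finsetSum _ fun i _ => h.integrable_mul hη.continuous
      fun x hx => continuousAt_pd (hpF i x hx) i,
    integral_finsetSum _ fun i _ => ((h.pd i).pd i).integrable_mul (continuous_pd (hpη i) i)
      fun x hx => (hF x hx).continuousAt]
  refine Finset.sum_congr rfl fun i _ => ?_
  rw [h.integral_mul_pd hη1 (hpF i) i, (h.pd i).integral_mul_pd (hpη i)
    (fun x hx => (hF x hx).of_le (by norm_num)) i |> neg_eq_iff_eq_neg.2]

theorem lap_sq {x : Euc N} (hF : ContDiffAt ℝ 2 F x) :
    lap (fun y => F y * F y) x = 2 * (F x * lap F x) + 2 * gradDot F F x := by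
  rw [lap_mul hF hF]; simp only [gradDot]; ring

/-- Caccioppoli estimate on an annulus. -/
theorem AnnularSupport.caccioppoli (h : AnnularSupport η) (hη : ContDiff ℝ 2 η)
    (hη0 : ∀ x, 0 ≤ η x) : ∃ C : ℝ, 0 ≤ C ∧ ∀ (u : Euc N → ℝ) (P : ℝ), 0 ≤ P →
      (∀ x ≠ 0, ContDiffAt ℝ 2 u x) → (∀ x, (∃ᶠ y in 𝓝 x, η y ≠ 0) → |u x| ≤ P ∧ |_root_.lap u x| ≤ P) →
      ∫ x, η x * gradDot u u x ≤ C * P ^ 2 := by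
  have hlη : Continuous (_root_.lap η) :=
    continuous_iff_continuousAt.2 fun x => continuousAt_lap hη.contDiffAt
  have hη1 : ∀ x, ¬ (∃ᶠ y in 𝓝 x, η y ≠ 0) → η x = 0 ∧ _root_.lap η x = 0 := by
    intro x hx
    simp only [not_frequently, not_not] at hx
    exact ⟨hx.self_of_nhds, lap_eq_zero_of_eventually_const hx⟩
  have hi1 : Integrable fun x => |_root_.lap η x| :=
    (hlη.integrable_of_hasCompactSupport h.lap.hasCompactSupport).abs
  have hi2 : Integrable η := hη.continuous.integrable_of_hasCompactSupport h.hasCompactSupport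
  refine ⟨∫ x, (|_root_.lap η x| + η x), integral_nonneg fun x => add_nonneg (abs_nonneg _) (hη0 x),
    fun u P hP hu hb => ?_⟩
  have hsq : ∀ x ≠ 0, ContDiffAt ℝ 2 (fun y => u y * u y) x := fun x hx => (hu x hx).mul (hu x hx)
  have hg := h.integral_mul_lap hη hsq
  have hgc : ∀ x ≠ 0, ContinuousAt (gradDot u u) x := fun x hx =>
    (contDiffAt_gradDot (hu x hx) (hu x hx)).continuousAt
  have hul : ∀ x ≠ 0, ContinuousAt (fun x => u x * _root_.lap u x) x := fun x hx =>
    (hu x hx).continuousAt.mul (continuousAt_lap (hu x hx))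
  have I1 := h.integrable_mul hη.continuous hgc
  have I2 := h.integrable_mul hη.continuous hul
  have e1 : ∫ x, η x * _root_.lap (fun y => u y * u y) x
      = 2 * (∫ x, η x * (u x * _root_.lap u x)) + 2 * ∫ x, η x * gradDot u u x := by
    rw [← integral_const_mul, ← integral_const_mul, ← integral_add (I2.const_mul 2) (I1.const_mul 2)]
    congr 1
    funext x
    rcases eq_or_ne x 0 with rfl | hx
    · obtain ⟨ε, R, he, h0, _⟩ := h
      simp [h0 0 (by simpa)]
    · rw [lap_sq (hu x hx)]; ring
  have b1 : ∫ x, _root_.lap η x * (u x * u x) ≤ ∫ x, |_root_.lap η x| * P ^ 2 := by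
    refine integral_mono (h.lap.integrable_mul hlη fun x hx => (hsq x hx).continuousAt)
      (hi1.mul_const _) fun x => ?_
    by_cases hx : ∃ᶠ y in 𝓝 x, η y ≠ 0
    · have := (hb x hx).1
      calc _root_.lap η x * (u x * u x) ≤ |_root_.lap η x| * (u x * u x) :=
            mul_le_mul_of_nonneg_right (le_abs_self _) (mul_self_nonneg _)
        _ ≤ _ := mul_le_mul_of_nonneg_left (by nlinarith [abs_mul_abs_self (u x), abs_nonneg (u x)])
            (abs_nonneg _)
    · simp [(hη1 x hx).2]
  have b2 : -(∫ x, η x * (u x * _root_.lap u x)) ≤ ∫ x, η x * P ^ 2 := by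
    rw [← integral_neg]
    refine integral_mono I2.neg (hi2.mul_const _) fun x => ?_
    by_cases hx : ∃ᶠ y in 𝓝 x, η y ≠ 0
    · rw [← mul_neg]
      refine mul_le_mul_of_nonneg_left ?_ (hη0 x)
      calc -(u x * _root_.lap u x) ≤ |u x * _root_.lap u x| := neg_le_abs _
        _ = |u x| * |_root_.lap u x| := abs_mul _ _
        _ ≤ P * P := mul_le_mul (hb x hx).1 (hb x hx).2 (abs_nonneg _) hP
        _ = P ^ 2 := (sq P).symm
    · simp [(hη1 x hx).1]
  rw [integral_add hi1 hi2, add_mul, ← integral_mul_const, ← integral_mul_const]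
  have : 0 ≤ ∫ x, |_root_.lap η x| * P ^ 2 := integral_nonneg fun x => by positivity
  linarith

end FluxBound

section UnitScaleFlux

open Filter Topology
open scoped ContDiff

variable {N : ℕ} {U V H : Euc N → ℝ}

theorem gradDot_self_nonneg (U : Euc N → ℝ) (x : Euc N) : 0 ≤ gradDot U U x :=
  Finset.sum_nonneg fun _ _ => mul_self_nonneg _

theorem abs_pd_le (U : Euc N → ℝ) (i : Fin N) (x : Euc N) : |pd i U x| ≤ √(gradDot U U x) := by
  refine Real.abs_le_sqrt ?_
  rw [sq]
  exact Finset.single_le_sum (f := fun j => pd j U x * pd j U x)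
    (fun _ _ => mul_self_nonneg _) (Finset.mem_univ i)

theorem abs_radial_le (U : Euc N → ℝ) (x : Euc N) : |radial U x| ≤ ‖x‖ * √(gradDot U U x) := by
  rw [← Real.sqrt_sq (norm_nonneg x), ← Real.sqrt_mul (sq_nonneg _)]
  refine Real.abs_le_sqrt ?_
  have := Finset.sum_mul_sq_le_sq_mul_sq Finset.univ (fun j => x j) fun j => pd j U x
  rw [sum_sq_eq_norm_sq] at this
  simpa only [radial, gradDot, sq] using this

theorem abs_gradDot_le (U V : Euc N → ℝ) (x : Euc N) :
    |gradDot U V x| ≤ √(gradDot U U x) * √(gradDot V V x) := by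
  rw [← Real.sqrt_mul (gradDot_self_nonneg U x)]
  refine Real.abs_le_sqrt ?_
  simpa only [gradDot, sq] using
    Finset.sum_mul_sq_le_sq_mul_sq Finset.univ (fun j => pd j U x) fun j => pd j V x

theorem abs_coord_le_norm (x : Euc N) (i : Fin N) : |x i| ≤ ‖x‖ := PiLp.norm_apply_le x i

theorem abs_pohField_le (a₁ a₂ : ℝ) (i : Fin N) {x : Euc N} (hx : ‖x‖ ≤ 2) :
    |pohField H a₁ a₂ U V i x| ≤ 6 * (√(gradDot U U x) * √(gradDot V V x)) + 2 * |H x|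
      + (|a₁| * (|V x| * √(gradDot U U x)) + |a₂| * (|U x| * √(gradDot V V x))) := by
  set A := √(gradDot U U x)
  set B := √(gradDot V V x)
  have hA : 0 ≤ A := Real.sqrt_nonneg _
  have hB : 0 ≤ B := Real.sqrt_nonneg _
  have r1 : |radial U x| ≤ 2 * A := (abs_radial_le U x).trans (by gcongr)
  have r2 : |radial V x| ≤ 2 * B := (abs_radial_le V x).trans (by gcongr)
  have t1 : |pd i U x * radial V x| ≤ A * (2 * B) := by
    rw [abs_mul]; exact mul_le_mul (abs_pd_le U i x) r2 (abs_nonneg _) hA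
  have t2 : |pd i V x * radial U x| ≤ B * (2 * A) := by
    rw [abs_mul]; exact mul_le_mul (abs_pd_le V i x) r1 (abs_nonneg _) hB
  have t3 : |x i * (H x - gradDot U V x)| ≤ 2 * (|H x| + A * B) := by
    rw [abs_mul]
    exact mul_le_mul ((abs_coord_le_norm x i).trans hx)
      ((abs_sub _ _).trans (by gcongr; exact abs_gradDot_le U V x)) (abs_nonneg _) two_pos.le
  have t4 : |a₁ * (V x * pd i U x)| ≤ |a₁| * (|V x| * A) := by
    rw [abs_mul, abs_mul]; gcongr; exact abs_pd_le U i x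
  have t5 : |a₂ * (U x * pd i V x)| ≤ |a₂| * (|U x| * B) := by
    rw [abs_mul, abs_mul]; gcongr; exact abs_pd_le V i x
  unfold pohField
  calc _ ≤ |pd i U x * radial V x| + |pd i V x * radial U x| + |x i * (H x - gradDot U V x)|
        + (|a₁ * (V x * pd i U x)| + |a₂ * (U x * pd i V x)|) :=
      (abs_add_le _ _).trans (add_le_add ((abs_add_le _ _).trans (add_le_add_left (abs_add_le _ _) _))
        (abs_add_le _ _))
    _ ≤ _ := by linarith

theorem abs_pohField_le_mul {a₁ a₂ c P Q : ℝ} (i : Fin N) {x : Euc N} (hx : ‖x‖ ≤ 2)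
    (hP : 0 < P) (hQ : 0 < Q) (hc : 0 ≤ c) (hU : |U x| ≤ P) (hV : |V x| ≤ Q)
    (hH : |H x| ≤ c * (P * Q)) :
    |pohField H a₁ a₂ U V i x| ≤ (6 + 2 * c + |a₁| + |a₂|) * (P * Q)
      * (1 + (P ^ 2)⁻¹ * gradDot U U x + (Q ^ 2)⁻¹ * gradDot V V x) := by
  refine (abs_pohField_le a₁ a₂ i hx).trans ?_
  have eA := Real.sq_sqrt (gradDot_self_nonneg U x)
  have eB := Real.sq_sqrt (gradDot_self_nonneg V x)
  set A := √(gradDot U U x)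
  set B := √(gradDot V V x)
  have hA : 0 ≤ A := Real.sqrt_nonneg _
  have hB : 0 ≤ B := Real.sqrt_nonneg _
  rw [← eA, ← eB]
  obtain ⟨s, hs⟩ : ∃ s, A = P * s := ⟨A / P, by field_simp⟩
  obtain ⟨t, ht⟩ : ∃ t, B = Q * t := ⟨B / Q, by field_simp⟩
  rw [hs, ht]
  have e1 : (P ^ 2)⁻¹ * (P * s) ^ 2 = s ^ 2 := by field_simp
  have e2 : (Q ^ 2)⁻¹ * (Q * t) ^ 2 = t ^ 2 := by field_simp
  rw [e1, e2]
  have hs0 : 0 ≤ s := by rw [hs] at hA; exact nonneg_of_mul_nonneg_right hA hP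
  have ht0 : 0 ≤ t := by rw [ht] at hB; exact nonneg_of_mul_nonneg_right hB hQ
  have hPQ := mul_pos hP hQ
  have b1 : P * s * (Q * t) ≤ P * Q * (1 + s ^ 2 + t ^ 2) := by
    rw [show P * s * (Q * t) = P * Q * (s * t) by ring]
    gcongr; nlinarith [sq_nonneg (s - t)]
  have b2 : |H x| ≤ c * (P * Q * (1 + s ^ 2 + t ^ 2)) := by
    refine hH.trans ?_
    exact mul_le_mul_of_nonneg_left
      (le_mul_of_one_le_right hPQ.le (by nlinarith [sq_nonneg s, sq_nonneg t])) hc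
  have b3 : |V x| * (P * s) ≤ P * Q * (1 + s ^ 2 + t ^ 2) := by
    calc |V x| * (P * s) ≤ Q * (P * s) := by gcongr
      _ = P * Q * s := by ring
      _ ≤ _ := by gcongr; nlinarith [sq_nonneg (s - 1)]
  have b4 : |U x| * (Q * t) ≤ P * Q * (1 + s ^ 2 + t ^ 2) := by
    calc |U x| * (Q * t) ≤ P * (Q * t) := by gcongr
      _ = P * Q * t := by ring
      _ ≤ _ := by gcongr; nlinarith [sq_nonneg (t - 1)]
  calc _ ≤ 6 * (P * Q * (1 + s ^ 2 + t ^ 2)) + 2 * (c * (P * Q * (1 + s ^ 2 + t ^ 2)))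
        + (|a₁| * (P * Q * (1 + s ^ 2 + t ^ 2)) + |a₂| * (P * Q * (1 + s ^ 2 + t ^ 2))) := by
        gcongr
    _ = _ := by ring

/-- The flux of the Rellich–Pohozaev field through an annulus at unit scale is controlled by
pointwise bounds of the functions and their Laplacians. -/
theorem exists_flux_bound {k : Euc N → ℝ} (hk : ContDiff ℝ 1 k) (hk1 : ∀ x, ‖x‖ < 1 → k x = 1)
    (hk2 : ∀ x, 2 < ‖x‖ → k x = 0) (a₁ a₂ : ℝ) {c : ℝ} (hc : 0 ≤ c) :
    ∃ C : ℝ, 0 ≤ C ∧ ∀ (H U V : Euc N → ℝ) (P Q : ℝ), 0 < P → 0 < Q →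
      (∀ x ≠ 0, ContDiffAt ℝ 2 U x) → (∀ x ≠ 0, ContDiffAt ℝ 2 V x) →
      (∀ y, 1 / 2 ≤ ‖y‖ → ‖y‖ ≤ 3 → |U y| ≤ P ∧ |lap U y| ≤ P ∧ |V y| ≤ Q ∧ |lap V y| ≤ Q ∧
        |H y| ≤ c * (P * Q)) →
      |∫ y, ∑ i, pd i k y * pohField H a₁ a₂ U V i y| ≤ C * (P * Q) := by
  let k₁ : ContDiffBump (0 : Euc N) := ⟨1 / 2, 1, by norm_num, by norm_num⟩
  let k₃ : ContDiffBump (0 : Euc N) := ⟨2, 3, by norm_num, by norm_num⟩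
  set ζ : Euc N → ℝ := fun x => k₃ x - k₁ x with hζ
  have hζc : ContDiff ℝ 2 ζ := k₃.contDiff.sub k₁.contDiff
  have k₁one : ∀ x : Euc N, ‖x‖ ≤ 1 / 2 → k₁ x = 1 := fun x hx =>
    k₁.one_of_mem_closedBall (by rw [mem_closedBall_zero_iff]; exact hx)
  have k₃one : ∀ x : Euc N, ‖x‖ ≤ 2 → k₃ x = 1 := fun x hx =>
    k₃.one_of_mem_closedBall (by simpa using hx)
  have k₁zero : ∀ x : Euc N, 1 ≤ ‖x‖ → k₁ x = 0 := fun x hx =>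
    k₁.zero_of_le_dist (by simpa using hx)
  have k₃zero : ∀ x : Euc N, 3 ≤ ‖x‖ → k₃ x = 0 := fun x hx =>
    k₃.zero_of_le_dist (by simpa using hx)
  have hζ0 : ∀ x, 0 ≤ ζ x := by
    intro x
    rcases le_total ‖x‖ 2 with h | h
    · simp only [hζ, k₃one x h, sub_nonneg]; exact k₁.le_one
    · simp only [hζ, k₁zero x (by linarith), sub_zero]; exact k₃.nonneg
  have hζi : ∀ x : Euc N, ‖x‖ < 1 / 2 → ζ x = 0 := fun x hx => by
    simp [hζ, k₁one x hx.le, k₃one x (by linarith)]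
  have hζo : ∀ x : Euc N, 3 ≤ ‖x‖ → ζ x = 0 := fun x hx => by
    simp [hζ, k₁zero x (by linarith), k₃zero x hx]
  have hζ1 : ∀ x : Euc N, 1 ≤ ‖x‖ → ‖x‖ ≤ 2 → ζ x = 1 := fun x h1 h2 => by
    simp [hζ, k₁zero x h1, k₃one x h2]
  have hann : AnnularSupport ζ := ⟨1 / 2, 3, by norm_num, hζi, hζo⟩
  have hfreq : ∀ x, (∃ᶠ y in 𝓝 x, ζ y ≠ 0) → 1 / 2 ≤ ‖x‖ ∧ ‖x‖ ≤ 3 := by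
    intro x hx
    constructor <;> by_contra hlt <;> rw [not_le] at hlt <;> refine hx ?_
    · filter_upwards [eventually_norm_lt hlt] with y hy using not_not.2 (hζi y hy)
    · filter_upwards [eventually_lt_norm hlt] with y hy using not_not.2 (hζo y hy.le)
  obtain ⟨C₀, hC₀, hcac⟩ := hann.caccioppoli hζc hζ0
  have hpd0 : ∀ i x, ¬ (1 ≤ ‖x‖ ∧ ‖x‖ ≤ 2) → pd i k x = 0 := by
    intro i x hx
    rw [not_and_or, not_le, not_le] at hx
    rcases hx with hx | hx
    · refine pd_eq_zero_of_eventually_const (c := 1) ?_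
      filter_upwards [eventually_norm_lt hx] with y hy using hk1 y hy
    · refine pd_eq_zero_of_eventually_const (c := 0) ?_
      filter_upwards [eventually_lt_norm hx] with y hy using hk2 y hy
  have hD : ∃ D : ℝ, 0 ≤ D ∧ ∀ i x, |pd i k x| ≤ D * ζ x := by
    have hc' : Continuous fun x => ∑ i, |pd i k x| :=
      continuous_finsetSum _ fun i _ => (continuous_pd hk i).abs
    obtain ⟨D, hD⟩ := (isCompact_closedBall (0 : Euc N) 2).exists_bound_of_continuousOn
      hc'.continuousOn
    refine ⟨|D|, abs_nonneg _, fun i x => ?_⟩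
    by_cases hx : 1 ≤ ‖x‖ ∧ ‖x‖ ≤ 2
    · rw [hζ1 x hx.1 hx.2, mul_one]
      refine (Finset.single_le_sum (f := fun i => |pd i k x|) (fun _ _ => abs_nonneg _)
        (Finset.mem_univ i)).trans ((le_abs_self _).trans ((hD x (by simpa using hx.2)).trans
        (le_abs_self _)))
    · rw [hpd0 i x hx, abs_zero]; exact mul_nonneg (abs_nonneg _) (hζ0 x)
  obtain ⟨D, hD0, hD⟩ := hD
  have hζint : Integrable ζ := hζc.continuous.integrable_of_hasCompactSupport hann.hasCompactSupport
  have hζI : 0 ≤ ∫ x, ζ x := integral_nonneg hζ0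
  set K := 6 + 2 * c + |a₁| + |a₂|
  have hK : 0 ≤ K := by positivity
  refine ⟨N * D * K * ((∫ x, ζ x) + C₀ + C₀), by positivity, fun H U V P Q hP hQ hU hV hb => ?_⟩
  have hgU : Integrable fun x => ζ x * gradDot U U x := hann.integrable_mul hζc.continuous
    fun x hx => (contDiffAt_gradDot (hU x hx) (hU x hx)).continuousAt
  have hgV : Integrable fun x => ζ x * gradDot V V x := hann.integrable_mul hζc.continuous
    fun x hx => (contDiffAt_gradDot (hV x hx) (hV x hx)).continuousAt
  have cU := hcac U P hP.le hU fun x hx =>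
    have := hb x (hfreq x hx).1 (hfreq x hx).2; ⟨this.1, this.2.1⟩
  have cV := hcac V Q hQ.le hV fun x hx =>
    have := hb x (hfreq x hx).1 (hfreq x hx).2; ⟨this.2.2.1, this.2.2.2.1⟩
  have hbd : ∀ y, |∑ i, pd i k y * pohField H a₁ a₂ U V i y|
      ≤ N * D * K * (P * Q) * (ζ y + (P ^ 2)⁻¹ * (ζ y * gradDot U U y)
        + (Q ^ 2)⁻¹ * (ζ y * gradDot V V y)) := by
    intro y
    have each : ∀ i, |pd i k y * pohField H a₁ a₂ U V i y| ≤ D * ζ y * (K * (P * Q)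
        * (1 + (P ^ 2)⁻¹ * gradDot U U y + (Q ^ 2)⁻¹ * gradDot V V y)) := by
      intro i
      have nn : 0 ≤ K * (P * Q)
        * (1 + (P ^ 2)⁻¹ * gradDot U U y + (Q ^ 2)⁻¹ * gradDot V V y) := by
        have := gradDot_self_nonneg U y
        have := gradDot_self_nonneg V y
        positivity
      by_cases hy : 1 ≤ ‖y‖ ∧ ‖y‖ ≤ 2
      · obtain ⟨h1, -, h3, -, h5⟩ := hb y (by linarith) (by linarith)
        rw [abs_mul]
        exact mul_le_mul (hD i y) (abs_pohField_le_mul i hy.2 hP hQ hc h1 h3 h5) (abs_nonneg _)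
          (mul_nonneg hD0 (hζ0 y))
      · rw [hpd0 i y hy, zero_mul, abs_zero]
        exact mul_nonneg (mul_nonneg hD0 (hζ0 y)) nn
    calc _ ≤ ∑ i, |pd i k y * pohField H a₁ a₂ U V i y| := Finset.abs_sum_le_sum_abs _ _
      _ ≤ ∑ _i : Fin N, D * ζ y * (K * (P * Q)
        * (1 + (P ^ 2)⁻¹ * gradDot U U y + (Q ^ 2)⁻¹ * gradDot V V y)) :=
        Finset.sum_le_sum fun i _ => each i
      _ = _ := by
        simp only [Finset.sum_const, Finset.card_univ, Fintype.card_fin, nsmul_eq_mul]; ring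
  have hI := (hζint.add (hgU.const_mul (P ^ 2)⁻¹)).add (hgV.const_mul (Q ^ 2)⁻¹)
  calc _ ≤ ∫ y, N * D * K * (P * Q) * (ζ y + (P ^ 2)⁻¹ * (ζ y * gradDot U U y)
        + (Q ^ 2)⁻¹ * (ζ y * gradDot V V y)) := by
        rw [← Real.norm_eq_abs]
        exact norm_integral_le_of_norm_le (hI.const_mul _) (Eventually.of_forall hbd)
    _ = N * D * K * (P * Q) * ((∫ x, ζ x) + (P ^ 2)⁻¹ * (∫ x, ζ x * gradDot U U x)
        + (Q ^ 2)⁻¹ * ∫ x, ζ x * gradDot V V x) := by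
        rw [integral_const_mul, integral_add (f := fun y => ζ y + (P ^ 2)⁻¹ * (ζ y * gradDot U U y))
          (hζint.add (hgU.const_mul _)) (hgV.const_mul _),
          integral_add hζint (hgU.const_mul _), integral_const_mul, integral_const_mul]
    _ ≤ N * D * K * (P * Q) * ((∫ x, ζ x) + (P ^ 2)⁻¹ * (C₀ * P ^ 2)
        + (Q ^ 2)⁻¹ * (C₀ * Q ^ 2)) := by gcongr
    _ = _ := by field_simp

end UnitScaleFlux

section IntegralPohozaev

open Filter Topology
open scoped ContDiff

variable {N : ℕ} {u v : Euc N → ℝ} {p q a b : ℝ}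

theorem pd_comp_smul {F : Euc N → ℝ} (s : ℝ) (i : Fin N) (z : Euc N)
    (hF : DifferentiableAt ℝ F (s • z)) :
    pd i (fun z => F (s • z)) z = s * pd i F (s • z) := by
  have h := pd_comp_affine (F := F) 0 s i z (by simpa using hF)
  simpa using h

theorem contDiffAt_comp_smul {F : Euc N → ℝ} {n : WithTop ℕ∞} {s : ℝ} {z : Euc N}
    (hF : ContDiffAt ℝ n F (s • z)) : ContDiffAt ℝ n (fun z => F (s • z)) z :=
  hF.comp z (contDiff_id.const_smul s).contDiffAt

theorem lap_comp_smul {F : Euc N → ℝ} {s : ℝ} {z : Euc N} (hF : ContDiffAt ℝ 2 F (s • z)) :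
    lap (fun z => F (s • z)) z = s ^ 2 * lap F (s • z) := by
  rw [lap_eq (contDiffAt_comp_smul hF), lap_eq hF, Finset.mul_sum]
  refine Finset.sum_congr rfl fun i _ => ?_
  have h1 : pd i (fun z => F (s • z)) =ᶠ[𝓝 z] fun z => s * pd i F (s • z) := by
    have hc : ContinuousAt (fun z : Euc N => s • z) z := (continuous_const_smul s).continuousAt
    filter_upwards [hc.eventually hF.eventually_two] with y hy
      using pd_comp_smul s i y hy.differentiableAt_two
  have h2 : DifferentiableAt ℝ (fun z => pd i F (s • z)) z :=
    (contDiffAt_comp_smul hF.pd_one).differentiableAt (by norm_num)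
  rw [pd_congr h1, pd_const_mul (f := fun z => pd i F (s • z)) s h2,
    pd_comp_smul s i z hF.differentiableAt_pd]
  ring

theorem pohField_comp_smul {h : Euc N → ℝ} {a₁ a₂ s : ℝ} {z : Euc N} (i : Fin N)
    (hu : DifferentiableAt ℝ u (s • z)) (hv : DifferentiableAt ℝ v (s • z)) :
    pohField (fun y => s ^ 2 * h (s • y)) a₁ a₂ (fun y => u (s • y)) (fun y => v (s • y)) i z
      = s * pohField h a₁ a₂ u v i (s • z) := by
  simp only [pohField, radial, gradDot, pd_comp_smul s _ z hu, pd_comp_smul s _ z hv]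
  simp only [PiLp.smul_apply, smul_eq_mul, mul_assoc, mul_left_comm _ s, ← Finset.mul_sum]
  ring

/-- A cutoff function, equal to one on the unit ball and vanishing outside the ball of radius
two. -/
def cutoff : ContDiffBump (0 : Euc N) := ⟨1, 2, one_pos, by norm_num⟩

theorem cutoff_one {x : Euc N} (hx : ‖x‖ ≤ 1) : cutoff x = 1 :=
  cutoff.one_of_mem_closedBall (by rw [mem_closedBall_zero_iff]; exact hx)

theorem cutoff_zero {x : Euc N} (hx : 2 ≤ ‖x‖) : cutoff x = 0 :=
  cutoff.zero_of_le_dist (by rw [dist_zero_right]; exact hx)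

/-- The rescaled cutoff function. -/
def cutoffAt (R : ℝ) (x : Euc N) : ℝ := cutoff (R⁻¹ • x)

theorem contDiff_cutoffAt (R : ℝ) {n : ℕ∞} : ContDiff ℝ n (cutoffAt R : Euc N → ℝ) :=
  cutoff.contDiff.comp (contDiff_id.const_smul R⁻¹)

theorem cutoffAt_one {R : ℝ} (hR : 0 < R) {x : Euc N} (hx : ‖x‖ ≤ R) : cutoffAt R x = 1 :=
  cutoff_one (by rw [norm_smul, Real.norm_of_nonneg (by positivity), inv_mul_le_iff₀ hR]; linarith)

theorem cutoffAt_zero {R : ℝ} (hR : 0 < R) {x : Euc N} (hx : 2 * R ≤ ‖x‖) : cutoffAt R x = 0 :=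
  cutoff_zero (by rw [norm_smul, Real.norm_of_nonneg (by positivity), le_inv_mul_iff₀ hR]; linarith)

theorem cutoffAt_nonneg (R : ℝ) (x : Euc N) : 0 ≤ cutoffAt R x := cutoff.nonneg

theorem cutoffAt_le_one (R : ℝ) (x : Euc N) : cutoffAt R x ≤ 1 := cutoff.le_one

theorem pd_cutoffAt_eq_zero {R : ℝ} (hR : 0 < R) {x : Euc N} (hx : ‖x‖ < R) (i : Fin N) :
    pd i (cutoffAt R) x = 0 :=
  pd_eq_zero_of_eventually_const (c := 1) (by
    filter_upwards [eventually_norm_lt hx] with y hy using cutoffAt_one hR hy.le)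

theorem annularSupport_pd_cutoffAt {R : ℝ} (hR : 0 < R) (i : Fin N) :
    AnnularSupport (pd i (cutoffAt R)) := by
  refine ⟨R, 2 * R + 1, hR, fun z hz => pd_cutoffAt_eq_zero hR hz i,
    fun z hz => pd_eq_zero_of_eventually_const (c := 0) ?_⟩
  filter_upwards [eventually_lt_norm (r := 2 * R) (by linarith)] with y hy
    using cutoffAt_zero hR hy.le

/-- The flux of the Rellich–Pohozaev field at scale `R`. -/
def flux (p q a b a₁ a₂ : ℝ) (u v : Euc N → ℝ) (R : ℝ) : ℝ :=
  ∫ x, ∑ i, pd i (cutoffAt R) x * pohField (pohPot p q a b u v) a₁ a₂ u v i x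

/-- The density of the bulk term in the Rellich–Pohozaev identity. -/
def bulk (p q a b : ℝ) (u v : Euc N → ℝ) (x : Euc N) : ℝ :=
  ‖x‖ ^ a * v x ^ (p + 1) + ‖x‖ ^ b * u x ^ (q + 1)

theorem IsPosSol.bulk_pos (hs : IsPosSol p q a b u v) {x : Euc N} (hx : x ≠ 0) :
    0 < bulk p q a b u v x := by
  have := norm_pos_iff.2 hx
  have := hs.posU x
  have := hs.posV x
  unfold bulk
  positivity

theorem annularSupport_cutoffAt_sub {r R : ℝ} (hr : 0 < r) (hrR : r ≤ R) :
    AnnularSupport (fun x : Euc N => cutoffAt R x - cutoffAt r x) := by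
  refine ⟨r, 2 * R, hr, fun z hz => ?_, fun z hz => ?_⟩
  · beta_reduce
    rw [cutoffAt_one hr hz.le, cutoffAt_one (hr.trans_le hrR) (hz.le.trans hrR), sub_self]
  · beta_reduce
    rw [cutoffAt_zero hr (by linarith), cutoffAt_zero (hr.trans_le hrR) hz, sub_self]

theorem contDiff_cutoffAt_sub (r R : ℝ) {n : ℕ∞} :
    ContDiff ℝ n (fun x : Euc N => cutoffAt R x - cutoffAt r x) :=
  (contDiff_cutoffAt R).sub (contDiff_cutoffAt r)

theorem IsPosSol.continuousAt_bulk (hs : IsPosSol p q a b u v) {x : Euc N} (hx : x ≠ 0) :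
    ContinuousAt (bulk p q a b u v) x :=
  ((contDiffAt_weight_rpow hx (hs.cdV x hx) (hs.posV x) _ _).add
    (contDiffAt_weight_rpow hx (hs.cdU x hx) (hs.posU x) _ _)).continuousAt

theorem IsPosSol.flux_sub (hs : IsPosSol p q a b u v) (hp : 0 < p) (hq : 0 < q)
    {a₁ a₂ μ : ℝ} (h₁ : a₁ = (N + a) / (p + 1) + μ) (h₂ : a₂ = (N + b) / (q + 1) + μ)
    (h₁₂ : a₁ + a₂ = N - 2) {r R : ℝ} (hr : 0 < r) (hrR : r ≤ R) :
    flux p q a b a₁ a₂ u v R - flux p q a b a₁ a₂ u v r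
      = μ * ∫ x, (cutoffAt R x - cutoffAt r x) * bulk p q a b u v x := by
  have hR := hr.trans_le hrR
  set X := pohField (pohPot p q a b u v) a₁ a₂ u v with hX
  have hXc : ∀ i, ∀ x ≠ 0, ContDiffAt ℝ 1 (X i) x := fun i x hx =>
    contDiffAt_pohField (hs.cdU x hx) (hs.cdV x hx) (hs.contDiffAt_pohPot hx) a₁ a₂ i
  have hXc0 : ∀ i, ∀ x ≠ 0, ContinuousAt (X i) x := fun i x hx => (hXc i x hx).continuousAt
  have hann := annularSupport_cutoffAt_sub (N := N) hr hrR
  have hη : ContDiff ℝ 1 (fun x : Euc N => cutoffAt R x - cutoffAt r x) :=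
    contDiff_cutoffAt_sub r R (n := 1)
  have hintg : ∀ ρ, 0 < ρ → ∀ i, Integrable fun x => pd i (cutoffAt ρ) x * X i x := fun ρ hρ i =>
    (annularSupport_pd_cutoffAt hρ i).integrable_mul
      (continuous_pd (contDiff_cutoffAt ρ (n := 1)) i) (hXc0 i)
  have e1 : ∀ ρ, 0 < ρ → flux p q a b a₁ a₂ u v ρ = ∑ i, ∫ x, pd i (cutoffAt ρ) x * X i x :=
    fun ρ hρ => integral_finsetSum _ fun i _ => hintg ρ hρ i
  have e2 : ∀ i, ∫ x, (cutoffAt R x - cutoffAt r x) * pd i (X i) x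
      = -((∫ x, pd i (cutoffAt R) x * X i x) - ∫ x, pd i (cutoffAt r) x * X i x) := by
    intro i
    rw [hann.integral_mul_pd hη (hXc i) i, ← integral_sub (hintg R hR i) (hintg r hr i)]
    congr 1
    refine integral_congr_ae (Eventually.of_forall fun x => ?_)
    have d1 : DifferentiableAt ℝ (cutoffAt R) x :=
      (contDiff_cutoffAt R (n := 1)).differentiable (by norm_num) x
    have d2 : DifferentiableAt ℝ (cutoffAt r) x :=
      (contDiff_cutoffAt r (n := 1)).differentiable (by norm_num) x
    simp only [pd, fderiv_fun_sub d1 d2, sub_apply, sub_mul]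
  rw [e1 R hR, e1 r hr, ← Finset.sum_sub_distrib, ← neg_inj, ← Finset.sum_neg_distrib,
    ← Finset.sum_congr rfl fun i _ => e2 i, ← integral_finsetSum _ fun i _ =>
    hann.integrable_mul hη.continuous fun x hx => continuousAt_pd (hXc i x hx) i,
    ← integral_const_mul, ← integral_neg]
  refine integral_congr_ae (Eventually.of_forall fun x => ?_)
  simp only [← Finset.mul_sum]
  rcases eq_or_ne x 0 with rfl | hx
  · simp [cutoffAt_one hr (x := (0 : Euc N)) (by simpa using hr.le),
      cutoffAt_one hR (x := (0 : Euc N)) (by simpa using hR.le)]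
  · rw [hs.div_pohField hp hq hx h₁ h₂ h₁₂, bulk]
    ring

theorem IsPosSol.exists_flux_bound (hs : IsPosSol p q a b u v) (hp : 0 < p) (hq : 0 < q)
    (a₁ a₂ : ℝ) : ∃ C : ℝ, 0 ≤ C ∧ ∀ R P Q : ℝ, 0 < R → 0 < P → 0 < Q →
      (∀ x : Euc N, R / 2 ≤ ‖x‖ → ‖x‖ ≤ 3 * R → u x ≤ P ∧ 4 * (‖x‖ ^ (2 + a) * v x ^ p) ≤ P ∧
        v x ≤ Q ∧ 4 * (‖x‖ ^ (2 + b) * u x ^ q) ≤ Q) →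
      |flux p q a b a₁ a₂ u v R| ≤ C * R ^ ((N:ℝ) - 2) * (P * Q) := by
  obtain ⟨C, hC, hbd⟩ := _root_.exists_flux_bound (N := N) (k := cutoff)
    (cutoff.contDiff (n := 1)) (fun x hx => cutoff_one hx.le) (fun x hx => cutoff_zero hx.le)
    a₁ a₂ (c := (p + 1)⁻¹ + (q + 1)⁻¹) (by positivity)
  refine ⟨C, hC, fun R P Q hR hP hQ hb => ?_⟩
  have hsm : ∀ {y : Euc N}, y ≠ 0 → R • y ≠ 0 := fun hy => smul_ne_zero hR.ne' hy
  have hj := hbd (fun y => R ^ 2 * pohPot p q a b u v (R • y)) (fun y => u (R • y))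
    (fun y => v (R • y)) P Q hP hQ (fun x hx => contDiffAt_comp_smul (hs.cdU _ (hsm hx)))
    (fun x hx => contDiffAt_comp_smul (hs.cdV _ (hsm hx))) (by
      intro y hy1 hy2
      have hy0 : y ≠ 0 := norm_pos_iff.1 (by linarith)
      have hn : ‖R • y‖ = R * ‖y‖ := by rw [norm_smul, Real.norm_of_nonneg hR.le]
      have hnp : 0 < ‖R • y‖ := norm_pos_iff.2 (hsm hy0)
      obtain ⟨b1, b2, b3, b4⟩ := hb (R • y) (by rw [hn]; nlinarith) (by rw [hn]; nlinarith)
      have pu := hs.posU (R • y)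
      have pv := hs.posV (R • y)
      have hR2 : R ^ 2 ≤ 4 * ‖R • y‖ ^ 2 := by
        have : R ≤ 2 * ‖R • y‖ := by rw [hn]; nlinarith
        nlinarith
      have lU : -lap (fun y => u (R • y)) y = R ^ 2 * (‖R • y‖ ^ a * v (R • y) ^ p) := by
        rw [lap_comp_smul (hs.cdU _ (hsm hy0)), ← hs.eqU _ (hsm hy0), mul_neg]
      have lV : -lap (fun y => v (R • y)) y = R ^ 2 * (‖R • y‖ ^ b * u (R • y) ^ q) := by
        rw [lap_comp_smul (hs.cdV _ (hsm hy0)), ← hs.eqV _ (hsm hy0), mul_neg]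
      have c1 : R ^ 2 * (‖R • y‖ ^ a * v (R • y) ^ p) ≤ P := by
        refine le_trans ?_ b2
        rw [Real.rpow_add hnp, Real.rpow_two, ← mul_assoc, ← mul_assoc, ← mul_assoc]
        gcongr
      have c2 : R ^ 2 * (‖R • y‖ ^ b * u (R • y) ^ q) ≤ Q := by
        refine le_trans ?_ b4
        rw [Real.rpow_add hnp, Real.rpow_two, ← mul_assoc, ← mul_assoc, ← mul_assoc]
        gcongr
      refine ⟨by rwa [abs_of_pos pu], ?_, by rwa [abs_of_pos pv], ?_, ?_⟩
      · rw [← abs_neg, lU, abs_of_pos (by positivity)]; exact c1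
      · rw [← abs_neg, lV, abs_of_pos (by positivity)]; exact c2
      · have e : R ^ 2 * pohPot p q a b u v (R • y)
            = (p + 1)⁻¹ * (R ^ 2 * (‖R • y‖ ^ a * v (R • y) ^ p) * v (R • y))
              + (q + 1)⁻¹ * (R ^ 2 * (‖R • y‖ ^ b * u (R • y) ^ q) * u (R • y)) := by
          rw [pohPot, Real.rpow_add_one pv.ne', Real.rpow_add_one pu.ne']
          ring
        rw [e, abs_of_pos (by positivity), add_mul]
        have c3 := mul_le_mul c1 b3 pv.le hP.le
        have c4 := mul_le_mul c2 b1 pu.le hQ.le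
        rw [mul_comm Q P] at c4
        gcongr)
  set j := ∫ y, ∑ i, pd i cutoff y * pohField (fun y => R ^ 2 * pohPot p q a b u v (R • y)) a₁ a₂
    (fun y => u (R • y)) (fun y => v (R • y)) i y with hjdef
  have hfl : flux p q a b a₁ a₂ u v R = R ^ ((N:ℝ) - 2) * j := by
    have e := Measure.integral_comp_smul (volume : Measure (Euc N)) (fun x => ∑ i,
      pd i (cutoffAt R) x * pohField (pohPot p q a b u v) a₁ a₂ u v i x) R
    have e' : j = R ^ 2 * ∫ y, ∑ i,
        pd i (cutoffAt R) (R • y) * pohField (pohPot p q a b u v) a₁ a₂ u v i (R • y) := by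
      rw [hjdef, ← integral_const_mul]
      refine integral_congr_ae (Eventually.of_forall fun y => ?_)
      simp only [Finset.mul_sum]
      refine Finset.sum_congr rfl fun i _ => ?_
      have hk : pd i cutoff y = R * pd i (cutoffAt R) (R • y) := by
        have := pd_comp_smul (F := (cutoffAt R : Euc N → ℝ)) R i y
          ((contDiff_cutoffAt R (n := 1)).differentiable (by norm_num) _)
        rw [← this]
        congr 1
        funext z
        simp [cutoffAt, smul_smul, inv_mul_cancel₀ hR.ne']
      rcases eq_or_ne y 0 with rfl | hy
      · rw [hk, smul_zero, pd_cutoffAt_eq_zero hR (by simpa using hR)]; ring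
      · rw [pohField_comp_smul i (hs.cdU _ (hsm hy)).differentiableAt_two
          (hs.cdV _ (hsm hy)).differentiableAt_two, hk]
        ring
    rw [e', e, finrank_euclideanSpace_fin, abs_of_pos (by positivity), smul_eq_mul,
      Real.rpow_sub hR, Real.rpow_natCast, Real.rpow_two, flux]
    field_simp
  rw [hfl, abs_mul, abs_of_pos (by positivity)]
  calc R ^ ((N:ℝ) - 2) * |j| ≤ R ^ ((N:ℝ) - 2) * (C * (P * Q)) := by gcongr
    _ = _ := by ring

end IntegralPohozaev

section NoDecay

open Filter Topology

variable {N : ℕ} {u v : Euc N → ℝ} {p q a b : ℝ}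

theorem IsPosSol.flux_sub_lower (hs : IsPosSol p q a b u v) (hN : 1 ≤ N) (hp : 0 < p) (hq : 0 < q)
    {a₁ a₂ μ : ℝ} (h₁ : a₁ = (N + a) / (p + 1) + μ) (h₂ : a₂ = (N + b) / (q + 1) + μ)
    (h₁₂ : a₁ + a₂ = N - 2) (hμ : 0 < μ) :
    ∃ c > 0, ∀ r R, 0 < r → r ≤ 1 / 4 → 4 ≤ R →
      c ≤ flux p q a b a₁ a₂ u v R - flux p q a b a₁ a₂ u v r := by
  have key : ∀ {r R : ℝ}, 0 < r → r ≤ R → Continuous fun x : Euc N =>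
      (cutoffAt R x - cutoffAt r x) * bulk p q a b u v x := fun hr hrR =>
    (annularSupport_cutoffAt_sub hr hrR).continuous_mul
      (contDiff_cutoffAt_sub _ _ (n := 1)).continuous fun x hx => hs.continuousAt_bulk hx
  have keyI : ∀ {r R : ℝ}, 0 < r → r ≤ R → Integrable fun x : Euc N =>
      (cutoffAt R x - cutoffAt r x) * bulk p q a b u v x := fun hr hrR =>
    (annularSupport_cutoffAt_sub hr hrR).integrable_mul
      (contDiff_cutoffAt_sub _ _ (n := 1)).continuous fun x hx => hs.continuousAt_bulk hx
  have mono : ∀ {r R r' R' : ℝ}, 0 < r → 2 * r ≤ r' → r' ≤ R' → 2 * R' ≤ R → ∀ x : Euc N,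
      cutoffAt R' x - cutoffAt r' x ≤ cutoffAt R x - cutoffAt r x := by
    intro r R r' R' h1 h2 h3 h4 x
    refine sub_le_sub ?_ ?_
    · rcases le_total ‖x‖ R with h | h
      · rw [cutoffAt_one (by linarith) h]; exact cutoffAt_le_one _ _
      · rw [cutoffAt_zero (R := R') (by linarith) (by linarith)]; exact cutoffAt_nonneg _ _
    · rcases le_total ‖x‖ r' with h | h
      · rw [cutoffAt_one (R := r') (by linarith) h]; exact cutoffAt_le_one _ _
      · rw [cutoffAt_zero (R := r) (by linarith) (by linarith)]; exact cutoffAt_nonneg _ _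
  have nn : ∀ {r R : ℝ}, 0 < r → 2 * r ≤ R → ∀ x : Euc N, 0 ≤ cutoffAt R x - cutoffAt r x := by
    intro r R h1 h2 x
    rw [sub_nonneg]
    rcases le_total ‖x‖ R with h | h
    · rw [cutoffAt_one (R := R) (by linarith) h]; exact cutoffAt_le_one _ _
    · rw [cutoffAt_zero (R := r) (by linarith) (by linarith)]; exact cutoffAt_nonneg _ _
  refine ⟨μ * ∫ x, (cutoffAt 2 x - cutoffAt (1 / 2) x) * bulk p q a b u v x, mul_pos hμ ?_,
    fun r R hr hr' hR => ?_⟩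
  · let x₀ : Euc N := EuclideanSpace.single ⟨0, hN⟩ (3 / 2)
    have hx₀ : ‖x₀‖ = 3 / 2 := by simp [x₀]
    have hx0 : x₀ ≠ 0 := norm_pos_iff.1 (by rw [hx₀]; norm_num)
    refine (key (r := 1 / 2) (R := 2) (by norm_num)
      (by norm_num)).integral_pos_of_hasCompactSupport_nonneg_nonzero
      (annularSupport_cutoffAt_sub (by norm_num) (by norm_num)).hasCompactSupport.mul_right
      (fun x => ?_) (x := x₀) ?_
    · rcases eq_or_ne x 0 with rfl | hx
      · simp [cutoffAt_one (R := 2) (x := (0 : Euc N)) (by norm_num) (by simp),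
          cutoffAt_one (R := 2⁻¹) (x := (0 : Euc N)) (by norm_num) (by simp)]
      · exact mul_nonneg (nn (by norm_num) (by norm_num) x) (hs.bulk_pos hx).le
    · rw [cutoffAt_one (by norm_num) (by rw [hx₀]; norm_num),
        cutoffAt_zero (by norm_num) (by rw [hx₀]; norm_num), sub_zero, one_mul]
      exact (hs.bulk_pos hx0).ne'
  · rw [hs.flux_sub hp hq h₁ h₂ h₁₂ hr (by linarith)]
    refine mul_le_mul_of_nonneg_left (integral_mono (keyI (by norm_num) (by norm_num))
      (keyI hr (by linarith)) fun x => ?_) hμ.le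
    rcases eq_or_ne x 0 with rfl | hx
    · simp [cutoffAt_one (R := 2) (x := (0 : Euc N)) (by norm_num) (by simp),
        cutoffAt_one (R := 2⁻¹) (x := (0 : Euc N)) (by norm_num) (by simp),
        cutoffAt_one (R := R) (x := (0 : Euc N)) (by linarith) (by simp; linarith),
        cutoffAt_one (R := r) (x := (0 : Euc N)) hr (by simp; linarith)]
    · exact mul_le_mul_of_nonneg_right (mono hr (by linarith) (by norm_num) (by linarith) x)
        (hs.bulk_pos hx).le

theorem IsPosSol.tendsto_flux_zero (hs : IsPosSol p q a b u v) (hN : 3 ≤ N) (hp : 0 < p)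
    (hq : 0 < q) (ha : -2 < a) (hb : -2 < b) (a₁ a₂ : ℝ) :
    Tendsto (flux p q a b a₁ a₂ u v) (𝓝[>] 0) (𝓝 0) := by
  obtain ⟨C, hC, hbd⟩ := hs.exists_flux_bound hp hq a₁ a₂
  have hN' : (3:ℝ) ≤ N := by exact_mod_cast hN
  obtain ⟨M, hM⟩ := (isCompact_closedBall (0 : Euc N) 3).exists_bound_of_continuousOn
    (f := fun x => u x + v x + 4 * (‖x‖ ^ (2 + a) * v x ^ p) + 4 * (‖x‖ ^ (2 + b) * u x ^ q)) (by
      refine Continuous.continuousOn ?_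
      have c1 := continuous_norm (E := Euc N) |>.rpow_const (p := 2 + a) fun x => Or.inr (by linarith)
      have c2 := continuous_norm (E := Euc N) |>.rpow_const (p := 2 + b) fun x => Or.inr (by linarith)
      have c3 := hs.contV.rpow_const (p := p) fun x => Or.inr hp.le
      have c4 := hs.contU.rpow_const (p := q) fun x => Or.inr hq.le
      exact ((hs.contU.add hs.contV).add (continuous_const.mul (c1.mul c3))).add
        (continuous_const.mul (c2.mul c4)))
  have hlim : Tendsto (fun R : ℝ => C * R ^ ((N:ℝ) - 2) * ((|M| + 1) * (|M| + 1))) (𝓝[>] 0) (𝓝 0) := by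
    have h0 : Tendsto (fun R : ℝ => R ^ ((N:ℝ) - 2)) (𝓝[>] 0) (𝓝 0) := by
      have := (Real.continuousAt_rpow_const (0:ℝ) ((N:ℝ) - 2) (Or.inr (by linarith))).tendsto
      rw [Real.zero_rpow (by linarith)] at this
      exact this.mono_left nhdsWithin_le_nhds
    simpa using (h0.const_mul C).mul_const ((|M| + 1) * (|M| + 1))
  refine squeeze_zero_norm' ?_ hlim
  filter_upwards [Ioo_mem_nhdsGT (show (0:ℝ) < 1 by norm_num)] with R hR
  rw [Real.norm_eq_abs]
  refine hbd R _ _ hR.1 (by positivity) (by positivity) fun x _ hx => ?_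
  have hx3 := hM x (by rw [mem_closedBall_zero_iff]; linarith [hR.2])
  have pu := hs.posU x
  have pv := hs.posV x
  have p1 : 0 ≤ 4 * (‖x‖ ^ (2 + a) * v x ^ p) := by positivity
  have p2 : 0 ≤ 4 * (‖x‖ ^ (2 + b) * u x ^ q) := by positivity
  have := (le_abs_self _).trans (hx3.trans (le_abs_self M))
  refine ⟨?_, ?_, ?_, ?_⟩ <;> linarith

/-- A decaying positive solution has vanishing flux at infinity. -/
theorem IsPosSol.tendsto_flux_atTop (hs : IsPosSol p q a b u v) (hp : 0 < p)
    (hq : 0 < q) (a₁ a₂ : ℝ) {l γ σ C₀ θ s k e A R₀ : ℝ} (hl : 0 < l) (hC₀ : 0 < C₀) (hA : 0 < A)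
    (hv : ∀ x, x ≠ 0 → v x ≤ l * (‖x‖ ^ (-γ) * u x ^ σ)) (hσ : 0 < σ) (hs0 : 0 < s)
    (hlap : ∀ x, x ≠ 0 → -lap u x ≤ C₀ * (‖x‖ ^ θ * u x ^ s))
    (hu : ∀ x : Euc N, R₀ ≤ ‖x‖ → u x ≤ A * ‖x‖ ^ (-k))
    (hk : 0 < k) (he : 0 < e) (h1 : 2 + θ ≤ k * (s - 1)) (h2 : e ≤ γ + k * σ)
    (h3 : 2 + b + e ≤ k * q) (hke : N - 2 < k + e) :
    Tendsto (flux p q a b a₁ a₂ u v) atTop (𝓝 0) := by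
  obtain ⟨C, hC, hbd⟩ := hs.exists_flux_bound hp hq a₁ a₂
  set A₁ := max A (4 * (C₀ * A ^ s))
  set A₂ := max (l * A ^ σ) (4 * A ^ q)
  have hA₁ : 0 < A₁ := lt_max_of_lt_left hA
  have hA₂ : 0 < A₂ := lt_max_of_lt_left (by positivity)
  have hlim : Tendsto (fun R : ℝ => C * (2 ^ k * 2 ^ e * (A₁ * A₂)) * R ^ (-(k + e - (N - 2))))
      atTop (𝓝 0) := by
    simpa using (tendsto_rpow_neg_atTop (show 0 < k + e - (N - 2) by linarith)).const_mul
      (C * (2 ^ k * 2 ^ e * (A₁ * A₂)))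
  refine squeeze_zero_norm' ?_ hlim
  filter_upwards [eventually_ge_atTop (2 * R₀), eventually_ge_atTop 2] with R hR hR2
  have hR0 : 0 < R := by linarith
  rw [Real.norm_eq_abs]
  have hhalf : ∀ {m : ℝ} {x : Euc N}, 0 < m → R / 2 ≤ ‖x‖ → ‖x‖ ^ (-m) ≤ 2 ^ m * R ^ (-m) := by
    intro m x hm hx
    calc ‖x‖ ^ (-m) ≤ (R / 2) ^ (-m) :=
          Real.rpow_le_rpow_of_nonpos (by linarith) hx (by linarith)
      _ = 2 ^ m * R ^ (-m) := by
          rw [Real.div_rpow hR0.le two_pos.le, Real.rpow_neg two_pos.le, div_inv_eq_mul, mul_comm]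
  have := hbd R (A₁ * (2 ^ k * R ^ (-k))) (A₂ * (2 ^ e * R ^ (-e))) hR0 (by positivity)
    (by positivity) (by
      intro x hx _
      have hx1 : 1 ≤ ‖x‖ := by linarith
      have hx0 : 0 < ‖x‖ := by linarith
      have hxne : x ≠ 0 := norm_pos_iff.1 hx0
      have pu := hs.posU x
      have pv := hs.posV x
      have bu := hu x (by linarith)
      have bum : ∀ {m : ℝ}, 0 < m → u x ^ m ≤ A ^ m * ‖x‖ ^ (-(k * m)) := by
        intro m hm
        calc u x ^ m ≤ (A * ‖x‖ ^ (-k)) ^ m := Real.rpow_le_rpow pu.le bu hm.le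
          _ = _ := by rw [Real.mul_rpow hA.le (by positivity), ← Real.rpow_mul hx0.le, neg_mul]
      have up : ∀ {B m n : ℝ}, 0 ≤ B → m ≤ -n → B * ‖x‖ ^ m ≤ B * ‖x‖ ^ (-n) := fun hB hmn =>
        mul_le_mul_of_nonneg_left (Real.rpow_le_rpow_of_exponent_le hx1 hmn) hB
      refine ⟨?_, ?_, ?_, ?_⟩
      · calc u x ≤ A * ‖x‖ ^ (-k) := bu
          _ ≤ A₁ * (2 ^ k * R ^ (-k)) :=
            mul_le_mul (le_max_left _ _) (hhalf hk hx) (by positivity) hA₁.le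
      · calc 4 * (‖x‖ ^ (2 + a) * v x ^ p) = 4 * (‖x‖ ^ (2:ℝ) * -lap u x) := by
              rw [hs.eqU x hxne, Real.rpow_add hx0]; ring
          _ ≤ 4 * (‖x‖ ^ (2:ℝ) * (C₀ * (‖x‖ ^ θ * (A ^ s * ‖x‖ ^ (-(k * s)))))) := by
              gcongr
              refine (hlap x hxne).trans ?_
              gcongr
              exact bum hs0
          _ = 4 * (C₀ * A ^ s) * ‖x‖ ^ (2 + θ - k * s) := by
              rw [sub_eq_add_neg, Real.rpow_add hx0, Real.rpow_add hx0]; ring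
          _ ≤ 4 * (C₀ * A ^ s) * ‖x‖ ^ (-k) := up (by positivity) (by linarith)
          _ ≤ A₁ * (2 ^ k * R ^ (-k)) :=
            mul_le_mul (le_max_right _ _) (hhalf hk hx) (by positivity) hA₁.le
      · calc v x ≤ l * (‖x‖ ^ (-γ) * u x ^ σ) := hv x hxne
          _ ≤ l * (‖x‖ ^ (-γ) * (A ^ σ * ‖x‖ ^ (-(k * σ)))) := by gcongr; exact bum hσ
          _ = l * A ^ σ * ‖x‖ ^ (-γ + -(k * σ)) := by rw [Real.rpow_add hx0]; ring
          _ ≤ l * A ^ σ * ‖x‖ ^ (-e) := up (by positivity) (by linarith)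
          _ ≤ A₂ * (2 ^ e * R ^ (-e)) :=
            mul_le_mul (le_max_left _ _) (hhalf he hx) (by positivity) hA₂.le
      · calc 4 * (‖x‖ ^ (2 + b) * u x ^ q) ≤ 4 * (‖x‖ ^ (2 + b) * (A ^ q * ‖x‖ ^ (-(k * q)))) := by
              gcongr; exact bum hq
          _ = 4 * A ^ q * ‖x‖ ^ (2 + b + -(k * q)) := by rw [Real.rpow_add hx0 (2 + b)]; ring
          _ ≤ 4 * A ^ q * ‖x‖ ^ (-e) := up (by positivity) (by linarith)
          _ ≤ A₂ * (2 ^ e * R ^ (-e)) :=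
            mul_le_mul (le_max_right _ _) (hhalf he hx) (by positivity) hA₂.le)
  refine this.trans (le_of_eq ?_)
  rw [show -(k + e - ((N:ℝ) - 2)) = (N:ℝ) - 2 + (-k + -e) by ring, Real.rpow_add hR0,
    Real.rpow_add hR0]
  ring

theorem IsPosSol.false_of_decay (hs : IsPosSol p q a b u v) (hN : 3 ≤ N) (hq : 0 < q)
    (hqp : q ≤ p) (ha : -2 < a) (hb : -2 < b)
    (hsup : ((N : ℝ) + a) / (p + 1) + ((N : ℝ) + b) / (q + 1) < (N : ℝ) - 2)
    (hab0 : 0 ≤ a - b) (hab : a - b ≤ ((N : ℝ) - 2) * (p - q)) {e₀ : ℝ}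
    (heN : e₀ < N - 2) (hss : 1 < p * (q + 1) / (p + 1))
    (hes : e₀ * (p * (q + 1) / (p + 1) - 1) = 2 + (a + p * b) / (p + 1))
    (hdec : ∀ k : ℝ, 0 < k → k < N - 2 →
      ∃ A R, 0 < A ∧ 0 < R ∧ ∀ x : Euc N, R ≤ ‖x‖ → u x ≤ A * ‖x‖ ^ (-k)) : False := by
  have hp : 0 < p := hq.trans_le hqp
  have hp1 : 0 < p + 1 := by linarith
  have hq1 : 0 < q + 1 := by linarith
  have hN' : (3:ℝ) ≤ N := by exact_mod_cast hN
  set μ := ((N:ℝ) - 2 - ((N + a) / (p + 1) + (N + b) / (q + 1))) / 2 with hμ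
  have hμ0 : 0 < μ := by rw [hμ]; linarith
  obtain ⟨l, hl, hv⟩ := hs.comparison hN hq hqp ha hab0 hab
  obtain ⟨C₀, hC₀, hlap⟩ := hs.exists_lap_bound hN hq hqp ha hab0 hab
  set σ := (q + 1) / (p + 1)
  set γ := (a - b) / (p + 1)
  have hσ : 0 < σ := by positivity
  have hγ : 0 ≤ γ := by positivity
  have hNa : 0 < ((N:ℝ) + a) / (p + 1) := div_pos (by linarith) hp1
  have hkey : ((N:ℝ) + b) / (q + 1) < N - 2 := by linarith
  obtain ⟨k, hk1, hk2⟩ : ∃ k : ℝ, max (max e₀ 0) (max (((N:ℝ) - 2) / (1 + σ)) ((N + b) / (q + 1))) < k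
      ∧ k < N - 2 := exists_between (max_lt (max_lt heN (by linarith))
        (max_lt ((div_lt_iff₀ (by linarith)).2 (by nlinarith)) hkey))
  simp only [max_lt_iff] at hk1
  obtain ⟨⟨ke, k0⟩, kσ, kb⟩ := hk1
  rw [div_lt_iff₀ (by linarith)] at kσ
  rw [div_lt_iff₀ hq1] at kb
  obtain ⟨A, R₀, hA, -, hu⟩ := hdec k k0 hk2
  set a₁ := ((N:ℝ) + a) / (p + 1) + μ
  set a₂ := ((N:ℝ) + b) / (q + 1) + μ
  have h₁₂ : a₁ + a₂ = N - 2 := by simp only [a₁, a₂, hμ]; ring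
  have hke : (N:ℝ) - 2 < k + min (γ + k * σ) (k * q - (2 + b)) := by
    rw [← sub_lt_iff_lt_add', lt_min_iff]
    constructor <;> nlinarith
  have t1 := hs.tendsto_flux_atTop hp hq a₁ a₂ hl hC₀ hA hv hσ (by linarith) hlap hu k0
    (e := min (γ + k * σ) (k * q - (2 + b))) (by linarith)
    (by rw [← hes]; exact mul_le_mul_of_nonneg_right ke.le (by linarith))
    (min_le_left _ _) (by have := min_le_right (γ + k * σ) (k * q - (2 + b)); linarith) hke
  have t0 := hs.tendsto_flux_zero hN hp hq ha hb a₁ a₂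
  obtain ⟨c, hc, hlow⟩ := hs.flux_sub_lower (by omega) hp hq rfl rfl h₁₂ hμ0
  obtain ⟨R, hR4, hR⟩ := ((eventually_ge_atTop 4).and (t1.eventually
    (eventually_lt_nhds (show 0 < c / 2 by linarith)))).exists
  obtain ⟨r, hr4, hr⟩ := ((Eventually.and (Ioo_mem_nhdsGT (show (0:ℝ) < 1 / 4 by norm_num))) (t0.eventually
    (eventually_gt_nhds (show -(c / 2) < 0 by linarith)))).exists
  linarith [hlow r R hr4.1 hr4.2.le hR4]

end NoDecay

section HenonNonexistence

open Filter Topology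

variable {N : ℕ} {u v : Euc N → ℝ} {p q a b : ℝ}

theorem integrable_of_lintegral_ofReal_lt_top {f : Euc N → ℝ} (hf : Continuous f)
    (hf0 : ∀ x, 0 ≤ f x) (h : (∫⁻ x, ENNReal.ofReal (f x)) < ⊤) : Integrable f :=
  ⟨hf.aestronglyMeasurable, (hasFiniteIntegral_iff_ofReal (Eventually.of_forall hf0)).2 h⟩

/-- Nonexistence for the weighted system when the unweighted exponents are not supercritical. -/
theorem IsPosSol.false_of_integrable (hs : IsPosSol p q a b u v) (hN : 3 ≤ N) (hq : 0 < q)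
    (hqp : q ≤ p) (hpq : 1 < p * q) (ha : -2 < a) (hb : -2 < b)
    (hsup : ((N : ℝ) + a) / (p + 1) + ((N : ℝ) + b) / (q + 1) < (N : ℝ) - 2)
    (hab0 : 0 ≤ a - b) (hab : a - b ≤ ((N : ℝ) - 2) * (p - q))
    (hsub : (N : ℝ) - 2 ≤ N / (p + 1) + N / (q + 1))
    (hintg : (∫⁻ x : Euc N, ENNReal.ofReal
      (u x ^ ((N : ℝ) / ((2 * (p + 1) + a + p * b) / (p * q - 1))))) < ⊤) : False := by
  have hp : 0 < p := hq.trans_le hqp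
  have hp1 : 0 < p + 1 := by linarith
  have hq1 : 0 < q + 1 := by linarith
  have hpq1 : 0 < p * q - 1 := by linarith
  have hnum : 0 < 2 * (p + 1) + a + p * b := by nlinarith
  set e₀ := (2 * (p + 1) + a + p * b) / (p * q - 1) with he₀
  have he₀pos : 0 < e₀ := div_pos hnum hpq1
  have hss : p * (q + 1) / (p + 1) - 1 = (p * q - 1) / (p + 1) := by field_simp; ring
  have hs1 : 1 < p * (q + 1) / (p + 1) := by
    have : 0 < (p * q - 1) / (p + 1) := div_pos hpq1 hp1
    linarith
  have hes : e₀ * (p * (q + 1) / (p + 1) - 1) = 2 + (a + p * b) / (p + 1) := by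
    rw [hss, he₀]; field_simp; ring
  have heN : e₀ < N - 2 := by
    rw [he₀, div_lt_iff₀ hpq1]
    rw [div_add_div _ _ hp1.ne' hq1.ne', div_lt_iff₀ (by positivity)] at hsup
    nlinarith
  have hθ : (a + p * b) / (p + 1) < 0 := by
    have h1 : a * (q + 1) + b * (p + 1) < 0 := by
      have h2 := hsup.trans_le hsub
      rw [div_add_div _ _ hp1.ne' hq1.ne', div_add_div _ _ hp1.ne' hq1.ne',
        div_lt_div_iff_of_pos_right (by positivity)] at h2
      linarith
    have hb0 : b < 0 := by
      by_contra hb0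
      rw [not_lt] at hb0
      nlinarith [mul_nonneg (show 0 ≤ a by linarith) hq1.le, mul_nonneg hb0 hp1.le]
    refine div_neg_of_neg_of_pos ?_ hp1
    have h3 : (a + p * b) * (q + 1) < 0 := by nlinarith
    exact neg_of_mul_neg_left h3 hq1.le
  obtain ⟨C, hC, hlap⟩ := hs.exists_lap_bound hN hq hqp ha hab0 hab
  have hI : Integrable fun x => u x ^ ((N:ℝ) / e₀) :=
    integrable_of_lintegral_ofReal_lt_top
      (hs.contU.rpow_const fun x => Or.inl (hs.posU x).ne')
      (fun x => (Real.rpow_pos_of_pos (hs.posU x) _).le) hintg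
  exact hs.false_of_decay hN hq hqp ha hb hsup hab0 hab heN hs1 hes fun k hk hkN =>
    improved_decay hs.contU hs.posU hs.cdU hC hlap hs1 he₀pos heN hes
      (fun ε hε => scaled_decay (by omega) hs.contU hs.posU hs.cdU hC hlap hθ hs1 he₀pos hes hI hε)
      hk hkN

end HenonNonexistence

section RadialOperator

open Filter Topology

/-- The weighted average `∫₀¹ τ^d h(τ s) dτ`. -/
def avg (d : ℕ) (h : ℝ → ℝ) (s : ℝ) : ℝ := ∫ τ in (0:ℝ)..1, τ ^ d * h (τ * s)

/-- The radial solution operator of `Δ w = h`, `w(0) = 0`, in dimension `d + 1`. -/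
def radInt (d : ℕ) (h : ℝ → ℝ) (r : ℝ) : ℝ := ∫ s in (0:ℝ)..r, s * avg d h s

variable {d : ℕ} {h h₁ h₂ : ℝ → ℝ} {r s : ℝ}

theorem continuous_avg (hh : Continuous h) : Continuous (avg d h) := by
  refine intervalIntegral.continuous_parametric_intervalIntegral_of_continuous'
    (f := fun s τ => τ ^ d * h (τ * s)) ?_ 0 1
  fun_prop

theorem hasDerivAt_radInt (hh : Continuous h) (r : ℝ) :
    HasDerivAt (radInt d h) (r * avg d h r) r :=
  (continuous_id.mul (continuous_avg hh)).integral_hasStrictDerivAt 0 r |>.hasDerivAt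

theorem continuous_radInt (hh : Continuous h) : Continuous (radInt d h) :=
  continuous_iff_continuousAt.2 fun r => (hasDerivAt_radInt hh r).continuousAt

theorem radInt_zero : radInt d h 0 = 0 := intervalIntegral.integral_same

theorem radInt_eq (d : ℕ) (h : ℝ → ℝ) (r : ℝ) :
    radInt d h r = r ^ 2 * ∫ σ in (0:ℝ)..1, σ * avg d h (σ * r) := by
  have := intervalIntegral.smul_integral_comp_mul_left (E := ℝ) (a := (0:ℝ)) (b := 1)
    (fun s : ℝ => s * avg d h s) r
  rw [mul_zero, mul_one, smul_eq_mul] at this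
  have h2 : ∫ x in (0:ℝ)..1, r * x * avg d h (r * x)
      = r * ∫ σ in (0:ℝ)..1, σ * avg d h (σ * r) := by
    rw [← intervalIntegral.integral_const_mul]
    simp only [mul_comm r, mul_assoc]
  rw [radInt, ← this, h2]
  ring

theorem mul_mem_uIcc_zero {τ : ℝ} (hτ : τ ∈ Icc (0:ℝ) 1) (s : ℝ) : τ * s ∈ uIcc 0 s := by
  rcases le_total 0 s with h | h
  · rw [uIcc_of_le h]
    exact ⟨mul_nonneg hτ.1 h, mul_le_of_le_one_left h hτ.2⟩
  · rw [uIcc_of_ge h]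
    exact ⟨by nlinarith [hτ.2], mul_nonpos_of_nonneg_of_nonpos hτ.1 h⟩

theorem abs_le_of_mem_uIcc_zero {x : ℝ} (hx : x ∈ uIcc 0 s) : |x| ≤ |s| := by
  simpa using abs_sub_left_of_mem_uIcc hx

theorem avg_mono (c₁ : Continuous h₁) (c₂ : Continuous h₂)
    (hle : ∀ x ∈ uIcc 0 s, h₁ x ≤ h₂ x) : avg d h₁ s ≤ avg d h₂ s :=
  intervalIntegral.integral_mono_on zero_le_one
    (Continuous.intervalIntegrable (by fun_prop) _ _)
    (Continuous.intervalIntegrable (by fun_prop) _ _) fun τ hτ =>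
    mul_le_mul_of_nonneg_left (hle _ (mul_mem_uIcc_zero hτ s)) (pow_nonneg hτ.1 _)

theorem radInt_mono (c₁ : Continuous h₁) (c₂ : Continuous h₂)
    (hle : ∀ x ∈ uIcc 0 r, h₁ x ≤ h₂ x) : radInt d h₁ r ≤ radInt d h₂ r := by
  rw [radInt_eq, radInt_eq]
  have a₁ := continuous_avg (d := d) c₁
  have a₂ := continuous_avg (d := d) c₂
  refine mul_le_mul_of_nonneg_left (intervalIntegral.integral_mono_on zero_le_one
    (Continuous.intervalIntegrable (by fun_prop) _ _)
    (Continuous.intervalIntegrable (by fun_prop) _ _) fun τ hτ => ?_) (sq_nonneg r)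
  exact mul_le_mul_of_nonneg_left (avg_mono c₁ c₂ fun x hx =>
    hle x (uIcc_subset_uIcc_left (mul_mem_uIcc_zero hτ r) hx)) hτ.1

theorem avg_const (c : ℝ) : avg d (fun _ => c) s = c / (d + 1) := by
  simp [avg, intervalIntegral.integral_mul_const, integral_pow]
  ring

theorem radInt_const (c : ℝ) : radInt d (fun _ => c) r = c * r ^ 2 / (2 * (d + 1)) := by
  have : (d:ℝ) + 1 ≠ 0 := by positivity
  simp only [radInt, avg_const, intervalIntegral.integral_mul_const, integral_id]
  field_simp
  ring

theorem avg_sub (c₁ : Continuous h₁) (c₂ : Continuous h₂) :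
    avg d (fun x => h₁ x - h₂ x) s = avg d h₁ s - avg d h₂ s := by
  rw [avg, avg, avg, ← intervalIntegral.integral_sub
    (Continuous.intervalIntegrable (by fun_prop) _ _)
    (Continuous.intervalIntegrable (by fun_prop) _ _)]
  simp only [mul_sub]

theorem radInt_sub (c₁ : Continuous h₁) (c₂ : Continuous h₂) :
    radInt d (fun x => h₁ x - h₂ x) r = radInt d h₁ r - radInt d h₂ r := by
  have a₁ := continuous_avg (d := d) c₁
  have a₂ := continuous_avg (d := d) c₂
  rw [radInt, radInt, radInt, ← intervalIntegral.integral_sub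
    (Continuous.intervalIntegrable (by fun_prop) _ _)
    (Continuous.intervalIntegrable (by fun_prop) _ _)]
  simp only [avg_sub c₁ c₂, mul_sub]

theorem avg_nonneg (hh : Continuous h) (h0 : ∀ x, 0 ≤ h x) : 0 ≤ avg d h s := by
  simpa [avg_const] using avg_mono (d := d) (s := s) continuous_const hh fun x _ => h0 x

theorem radInt_nonneg (hh : Continuous h) (h0 : ∀ x, 0 ≤ h x) : 0 ≤ radInt d h r := by
  simpa [radInt_const] using radInt_mono (d := d) (r := r) continuous_const hh fun x _ => h0 x

theorem monotoneOn_radInt (hh : Continuous h) (h0 : ∀ x, 0 ≤ h x) :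
    MonotoneOn (radInt d h) (Ici 0) := by
  refine monotoneOn_of_deriv_nonneg (convex_Ici 0) (continuous_radInt hh).continuousOn
    (fun r _ => (hasDerivAt_radInt hh r).differentiableAt.differentiableWithinAt) fun r hr => ?_
  rw [interior_Ici] at hr
  rw [(hasDerivAt_radInt hh r).deriv]
  exact mul_nonneg (le_of_lt hr) (avg_nonneg hh h0)

theorem avg_pos (hh : Continuous h) (hs : 0 < s) (h0 : ∀ x, 0 ≤ x → x < s → 0 < h x) :
    0 < avg d h s := by
  refine intervalIntegral.intervalIntegral_pos_of_pos_on
    (Continuous.intervalIntegrable (by fun_prop) _ _) (fun τ hτ => ?_) one_pos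
  exact mul_pos (pow_pos hτ.1 _) (h0 _ (mul_nonneg hτ.1.le hs.le) (by nlinarith [hτ.2]))

theorem radInt_lt (hh : Continuous h) {r₁ r₂ : ℝ} (h1 : 0 ≤ r₁) (h12 : r₁ < r₂)
    (h0 : ∀ x, 0 ≤ x → x < r₂ → 0 < h x) : radInt d h r₁ < radInt d h r₂ := by
  refine strictMonoOn_of_deriv_pos (convex_Icc 0 r₂) (continuous_radInt hh).continuousOn
    (fun r hr => ?_) ⟨h1, h12.le⟩ ⟨h1.trans h12.le, le_rfl⟩ h12
  rw [interior_Icc] at hr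
  rw [(hasDerivAt_radInt hh r).deriv]
  exact mul_pos hr.1 (avg_pos hh hr.1 fun x hx hxr => h0 x hx (hxr.trans hr.2))

theorem abs_avg_le (hh : Continuous h) {M : ℝ} (hM : ∀ x, |x| ≤ |s| → |h x| ≤ M) :
    |avg d h s| ≤ M := by
  have hM0 : 0 ≤ M := (abs_nonneg _).trans (hM s le_rfl)
  have h1 := avg_mono (d := d) (s := s) hh continuous_const fun x hx => (abs_le.1 (hM x (abs_le_of_mem_uIcc_zero hx))).2
  have h2 := avg_mono (d := d) (s := s) continuous_const hh fun x hx => (abs_le.1 (hM x (abs_le_of_mem_uIcc_zero hx))).1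
  rw [avg_const] at h1 h2
  have h3 : M / (d + 1) ≤ M := div_le_self hM0 (by linarith [(Nat.cast_nonneg d : (0:ℝ) ≤ d)])
  rw [neg_div] at h2
  exact abs_le.2 ⟨by linarith, by linarith⟩

theorem abs_radInt_sub_le (hh : Continuous h) {M R : ℝ} (hM : ∀ x, |x| ≤ R → |h x| ≤ M)
    {r₁ r₂ : ℝ} (h1 : |r₁| ≤ R) (h2 : |r₂| ≤ R) :
    |radInt d h r₁ - radInt d h r₂| ≤ R * M * |r₁ - r₂| := by
  have hconv : Convex ℝ {x : ℝ | |x| ≤ R} := by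
    have : {x : ℝ | |x| ≤ R} = Icc (-R) R := by ext; simp [abs_le]
    rw [this]; exact convex_Icc _ _
  have hR : 0 ≤ R := (abs_nonneg _).trans h1
  refine hconv.norm_image_sub_le_of_norm_hasDerivWithin_le (f := radInt d h)
    (fun x _ => (hasDerivAt_radInt hh x).hasDerivWithinAt) (fun x hx => ?_) h2 h1
  rw [Real.norm_eq_abs, abs_mul]
  exact mul_le_mul hx (abs_avg_le hh fun y hy => hM y (hy.trans hx)) (abs_nonneg _) hR

/-- A sequence of continuous functions converging pointwise and locally boundedly. -/
structure TendstoBdd (h : ℕ → ℝ → ℝ) (h' : ℝ → ℝ) : Prop where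
  cont : ∀ n, Continuous (h n)
  bdd : ∀ R, ∃ M, ∀ n x, |x| ≤ R → |h n x| ≤ M
  lim : ∀ x, Tendsto (fun n => h n x) atTop (𝓝 (h' x))

variable {hn : ℕ → ℝ → ℝ} {h' : ℝ → ℝ}

theorem TendstoBdd.avg (H : TendstoBdd hn h') (s : ℝ) :
    Tendsto (fun n => avg d (hn n) s) atTop (𝓝 (avg d h' s)) := by
  obtain ⟨M, hM⟩ := H.bdd |s|
  refine intervalIntegral.tendsto_integral_filter_of_dominated_convergence (fun _ => M)
    (Eventually.of_forall fun n => ?_) (Eventually.of_forall fun n => ?_)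
    intervalIntegrable_const (Eventually.of_forall fun τ _ => ?_)
  · have := H.cont n
    exact Continuous.aestronglyMeasurable (by fun_prop)
  · refine Eventually.of_forall fun τ hτ => ?_
    rw [uIoc_of_le zero_le_one] at hτ
    rw [norm_mul, Real.norm_of_nonneg (pow_nonneg hτ.1.le d), Real.norm_eq_abs]
    have hb : |hn n (τ * s)| ≤ M := hM n _ (by
      rw [abs_mul, abs_of_pos hτ.1]; exact mul_le_of_le_one_left (abs_nonneg _) hτ.2)
    exact (mul_le_of_le_one_left (abs_nonneg _) (pow_le_one₀ hτ.1.le hτ.2)).trans hb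
  · exact (H.lim _).const_mul _

theorem TendstoBdd.radInt (H : TendstoBdd hn h') (r : ℝ) :
    Tendsto (fun n => radInt d (hn n) r) atTop (𝓝 (radInt d h' r)) := by
  obtain ⟨M, hM⟩ := H.bdd |r|
  refine intervalIntegral.tendsto_integral_filter_of_dominated_convergence (fun _ => |r| * M)
    (Eventually.of_forall fun n => ?_) (Eventually.of_forall fun n => ?_)
    intervalIntegrable_const (Eventually.of_forall fun τ _ => ?_)
  · have := continuous_avg (d := d) (H.cont n)
    exact Continuous.aestronglyMeasurable (by fun_prop)
  · refine Eventually.of_forall fun τ hτ => ?_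
    have hτ' : |τ| ≤ |r| := by
      have := abs_sub_left_of_mem_uIcc (uIoc_subset_uIcc hτ)
      simpa using this
    rw [norm_mul, Real.norm_eq_abs, Real.norm_eq_abs]
    exact mul_le_mul hτ' (abs_avg_le (H.cont n) fun x hx => hM n x (hx.trans hτ')) (abs_nonneg _)
      (abs_nonneg _)
  · exact (H.avg τ).const_mul _

theorem TendstoBdd.continuous_radInt (H : TendstoBdd hn h') : Continuous (_root_.radInt d h') := by
  refine continuous_iff_continuousAt.2 fun r => ?_
  obtain ⟨M, hM⟩ := H.bdd (|r| + 1)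
  refine continuousAt_of_locally_lipschitz one_pos ((|r| + 1) * M) fun y hy => ?_
  rw [Real.dist_eq] at hy ⊢
  have hy' : |y| ≤ |r| + 1 := by
    have := abs_add_le (y - r) r
    rw [sub_add_cancel] at this
    linarith
  have l1 := (((H.radInt (d := d) y).sub (H.radInt (d := d) r)).abs)
  exact le_of_tendsto' l1 fun n => abs_radInt_sub_le (H.cont n) (hM n) hy' (by linarith)

theorem TendstoBdd.comp (H : TendstoBdd hn h') {φ : ℝ → ℝ} (hφ : Continuous φ) :
    TendstoBdd (fun n x => φ (hn n x)) fun x => φ (h' x) := by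
  refine ⟨fun n => hφ.comp (H.cont n), fun R => ?_, fun x => (hφ.tendsto _).comp (H.lim x)⟩
  obtain ⟨M, hM⟩ := H.bdd R
  obtain ⟨K, hK⟩ := (isCompact_Icc (a := -M) (b := M)).exists_bound_of_continuousOn
    (f := φ) hφ.continuousOn
  exact ⟨K, fun n x hx => hK _ (abs_le.1 (hM n x hx))⟩

end RadialOperator

section Shooting

open Filter Topology

theorem exists_tendsto_of_abs_le {s : ℕ → ℝ} {M : ℝ} (h : Monotone s ∨ Antitone s)
    (hb : ∀ n, |s n| ≤ M) : ∃ l, Tendsto s atTop (𝓝 l) := by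
  rcases h with h | h
  · exact ⟨_, tendsto_atTop_ciSup h ⟨M, by rintro _ ⟨n, rfl⟩; exact (abs_le.1 (hb n)).2⟩⟩
  · exact ⟨_, tendsto_atTop_ciInf h ⟨-M, by rintro _ ⟨n, rfl⟩; exact (abs_le.1 (hb n)).1⟩⟩

/-- A continuous, monotone nonlinearity, vanishing on `(-∞, 0]` and positive on `(0, ∞)`. -/
structure IsNonlin (f : ℝ → ℝ) : Prop where
  cont : Continuous f
  mono : Monotone f
  eq_zero : ∀ x ≤ 0, f x = 0
  pos : ∀ x, 0 < x → 0 < f x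

theorem IsNonlin.nonneg {f : ℝ → ℝ} (hf : IsNonlin f) (x : ℝ) : 0 ≤ f x := by
  rcases le_or_gt x 0 with h | h
  · exact (hf.eq_zero x h).ge
  · exact (hf.pos x h).le

/-- The integral form of the radial system `-Δu = f(v)`, `-Δv = g(u)`
with `u(0) = 1`, `v(0) = t`. -/
structure IsShoot (d : ℕ) (f g : ℝ → ℝ) (t : ℝ) (u v : ℝ → ℝ) : Prop where
  cont_u : Continuous u
  cont_v : Continuous v
  eq_u : ∀ r, u r = 1 - radInt d (fun x => f (v x)) r
  eq_v : ∀ r, v r = t - radInt d (fun x => g (u x)) r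

variable {d : ℕ} {f g : ℝ → ℝ} {t t' : ℝ} {u v u' v' : ℝ → ℝ}

theorem radInt_le_of_le {h : ℝ → ℝ} {M : ℝ} (hh : Continuous h) (hM : ∀ x, h x ≤ M) (r : ℝ) :
    radInt d h r ≤ M * r ^ 2 / (2 * (d + 1)) := by
  rw [← radInt_const]
  exact radInt_mono hh continuous_const fun x _ => hM x

theorem abs_sub_radInt_le {h : ℝ → ℝ} {M c C R r : ℝ} (hh : Continuous h) (h0 : ∀ x, 0 ≤ h x)
    (hM : ∀ x, h x ≤ M) (hc : |c| ≤ C) (hr : |r| ≤ R) :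
    |c - radInt d h r| ≤ C + M * R ^ 2 / (2 * (d + 1)) := by
  have h1 := radInt_nonneg (d := d) (r := r) hh h0
  have h2 := radInt_le_of_le (d := d) hh hM r
  have hM0 : 0 ≤ M := (h0 0).trans (hM 0)
  have h3 : M * r ^ 2 / (2 * (d + 1)) ≤ M * R ^ 2 / (2 * (d + 1)) := by
    have : r ^ 2 ≤ R ^ 2 := by
      rw [← sq_abs r]; exact pow_le_pow_left₀ (abs_nonneg _) hr 2
    gcongr
  have := abs_le.1 hc
  exact abs_le.2 ⟨by linarith, by linarith⟩

theorem IsShoot.zero_u (h : IsShoot d f g t u v) : u 0 = 1 := by rw [h.eq_u, radInt_zero, sub_zero]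

theorem IsShoot.antitoneOn_u (h : IsShoot d f g t u v) (hf : IsNonlin f) :
    AntitoneOn u (Ici 0) := fun x hx y hy hxy => by
  have := monotoneOn_radInt (d := d) (hf.cont.comp h.cont_v) (fun x => hf.nonneg _) hx hy hxy
  rw [h.eq_u, h.eq_u]
  exact sub_le_sub_left this 1

theorem IsShoot.antitoneOn_v (h : IsShoot d f g t u v) (hg : IsNonlin g) :
    AntitoneOn v (Ici 0) := fun x hx y hy hxy => by
  have := monotoneOn_radInt (d := d) (hg.cont.comp h.cont_u) (fun x => hg.nonneg _) hx hy hxy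
  rw [h.eq_v, h.eq_v]
  exact sub_le_sub_left this t

theorem IsShoot.u_le (h : IsShoot d f g t u v) (hf : IsNonlin f) (r : ℝ) : u r ≤ 1 := by
  rw [h.eq_u]
  exact sub_le_self _ (radInt_nonneg (hf.cont.comp h.cont_v) fun x => hf.nonneg _)

theorem IsShoot.v_le (h : IsShoot d f g t u v) (hg : IsNonlin g) (r : ℝ) : v r ≤ t := by
  rw [h.eq_v]
  exact sub_le_self _ (radInt_nonneg (hg.cont.comp h.cont_u) fun x => hg.nonneg _)

/-- Passage to the limit in the integral equations. -/
theorem IsShoot.of_tendsto {tn : ℕ → ℝ} {un vn wn : ℕ → ℝ → ℝ} {T : ℝ} (hf : IsNonlin f)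
    (hg : IsNonlin g) (cw : ∀ n, Continuous (wn n))
    (hwT : ∀ n x, wn n x ≤ T) (hwb : ∀ R, ∃ M, ∀ n x, |x| ≤ R → |wn n x| ≤ M)
    (hu : ∀ n r, un n r = 1 - radInt d (fun x => f (wn n x)) r)
    (hv : ∀ n r, vn n r = tn n - radInt d (fun x => g (un n x)) r)
    (lt : Tendsto tn atTop (𝓝 t)) (lw : ∀ x, Tendsto (fun n => wn n x) atTop (𝓝 (v x)))
    (lv : ∀ x, Tendsto (fun n => vn n x) atTop (𝓝 (v x))) :
    ∃ u, IsShoot d f g t u v ∧ ∀ x, Tendsto (fun n => un n x) atTop (𝓝 (u x)) := by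
  have W : TendstoBdd wn v := ⟨cw, hwb, lw⟩
  have FW := W.comp hf.cont
  have lu : ∀ x, Tendsto (fun n => un n x) atTop (𝓝 (1 - radInt d (fun x => f (v x)) x)) :=
    fun x => by
      simp only [hu]
      exact (FW.radInt x).const_sub 1
  have U : TendstoBdd un (fun x => 1 - radInt d (fun x => f (v x)) x) := by
    refine ⟨fun n => ?_, fun R => ⟨|1| + f T * R ^ 2 / (2 * (d + 1)), fun n x hx => ?_⟩, lu⟩
    · rw [funext (hu n)]
      exact continuous_const.sub (continuous_radInt (hf.cont.comp (cw n)))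
    · rw [hu]
      exact abs_sub_radInt_le (hf.cont.comp (cw n)) (fun x => hf.nonneg _)
        (fun x => hf.mono (hwT n x)) le_rfl hx
  have GU := U.comp hg.cont
  have ev : ∀ r, v r = t - radInt d (fun x => g (1 - radInt d (fun x => f (v x)) x)) r := fun r => by
    refine tendsto_nhds_unique (lv r) ?_
    simp only [hv]
    exact lt.sub (GU.radInt r)
  refine ⟨_, ⟨continuous_const.sub FW.continuous_radInt, ?_, fun r => rfl, ev⟩, lu⟩
  rw [funext ev]
  exact continuous_const.sub GU.continuous_radInt

/-- The Picard iterates for the second component. -/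
def shootIter (d : ℕ) (f g : ℝ → ℝ) (t : ℝ) : ℕ → ℝ → ℝ
  | 0 => fun _ => t
  | n + 1 => fun r => t - radInt d
      (fun x => g (1 - radInt d (fun y => f (shootIter d f g t n y)) x)) r

theorem continuous_shootIter (hf : IsNonlin f) (hg : IsNonlin g) (t : ℝ) (n : ℕ) :
    Continuous (shootIter d f g t n) := by
  induction n with
  | zero => exact continuous_const
  | succ n ih =>
    exact continuous_const.sub (continuous_radInt (hg.cont.comp
      (continuous_const.sub (continuous_radInt (hf.cont.comp ih)))))

theorem shoot_step_mono {w w' : ℝ → ℝ} (hf : IsNonlin f) (hg : IsNonlin g) (cw : Continuous w)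
    (cw' : Continuous w') (hw : ∀ x, w x ≤ w' x) (ht : t ≤ t') (r : ℝ) :
    t - radInt d (fun x => g (1 - radInt d (fun y => f (w y)) x)) r ≤
      t' - radInt d (fun x => g (1 - radInt d (fun y => f (w' y)) x)) r := by
  refine sub_le_sub ht (radInt_mono ?_ ?_ fun x _ => hg.mono (sub_le_sub_left ?_ 1))
  · exact hg.cont.comp (continuous_const.sub (continuous_radInt (hf.cont.comp cw')))
  · exact hg.cont.comp (continuous_const.sub (continuous_radInt (hf.cont.comp cw)))
  · exact radInt_mono (hf.cont.comp cw) (hf.cont.comp cw') fun y _ => hf.mono (hw y)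

theorem shootIter_mono (hf : IsNonlin f) (hg : IsNonlin g) (ht : t ≤ t') (n : ℕ) (r : ℝ) :
    shootIter d f g t n r ≤ shootIter d f g t' n r := by
  induction n generalizing r with
  | zero => exact ht
  | succ n ih =>
    exact shoot_step_mono hf hg (continuous_shootIter hf hg t n) (continuous_shootIter hf hg t' n)
      ih ht r

theorem shootIter_le (hf : IsNonlin f) (hg : IsNonlin g) (n : ℕ) (r : ℝ) :
    shootIter d f g t n r ≤ t := by
  cases n with
  | zero => exact le_rfl
  | succ n =>
    exact sub_le_self _ (radInt_nonneg (hg.cont.comp (continuous_const.sub (continuous_radInt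
      (hf.cont.comp (continuous_shootIter hf hg t n))))) fun x => hg.nonneg _)

theorem antitone_shootIter (hf : IsNonlin f) (hg : IsNonlin g) (r : ℝ) :
    Antitone fun n => shootIter d f g t n r := by
  refine antitone_nat_of_succ_le fun n => ?_
  induction n generalizing r with
  | zero => exact shootIter_le hf hg 1 r
  | succ n ih =>
    exact shoot_step_mono hf hg (continuous_shootIter hf hg t (n + 1))
      (continuous_shootIter hf hg t n) ih le_rfl r

theorem abs_shootIter_le (hf : IsNonlin f) (hg : IsNonlin g) {R : ℝ} (n : ℕ) {r : ℝ}
    (hr : |r| ≤ R) : |shootIter d f g t n r| ≤ |t| + g 1 * R ^ 2 / (2 * (d + 1)) := by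
  cases n with
  | zero =>
    have := hg.nonneg 1
    exact le_add_of_nonneg_right (by positivity)
  | succ n =>
    have c := hf.cont.comp (continuous_shootIter (d := d) hf hg t n)
    exact abs_sub_radInt_le (hg.cont.comp (continuous_const.sub (continuous_radInt c)))
      (fun x => hg.nonneg _)
      (fun x => hg.mono (sub_le_self _ (radInt_nonneg c fun y => hf.nonneg _))) le_rfl hr

/-- Solutions of the shooting problem exist for every `t`, monotonically in `t`. -/
theorem exists_shoot (d : ℕ) (hf : IsNonlin f) (hg : IsNonlin g) :
    ∃ u v : ℝ → ℝ → ℝ, (∀ t, IsShoot d f g t (u t) (v t)) ∧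
      ∀ t t', t ≤ t' → ∀ r, v t r ≤ v t' r ∧ u t' r ≤ u t r := by
  have hl : ∀ t r, ∃ l, Tendsto (fun n => shootIter d f g t n r) atTop (𝓝 l) := fun t r =>
    exists_tendsto_of_abs_le (Or.inr (antitone_shootIter hf hg r))
      fun n => abs_shootIter_le hf hg n le_rfl
  choose v hv using hl
  have hS : ∀ t, ∃ u, IsShoot d f g t u (v t) := fun t => by
    obtain ⟨u, hu, -⟩ := IsShoot.of_tendsto (d := d) (T := |t|) (tn := fun _ => t)
      (wn := shootIter d f g t) (vn := fun n => shootIter d f g t (n + 1))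
      (un := fun n r => 1 - radInt d (fun x => f (shootIter d f g t n x)) r) hf hg
      (continuous_shootIter hf hg t)
      (fun n x => (shootIter_le hf hg n x).trans (le_abs_self t))
      (fun R => ⟨_, fun n x hx => abs_shootIter_le hf hg n hx⟩) (fun _ _ => rfl) (fun _ _ => rfl)
      tendsto_const_nhds (hv t) fun x => (hv t x).comp (tendsto_add_atTop_nat 1)
    exact ⟨u, hu⟩
  choose u hu using hS
  refine ⟨u, v, hu, fun t t' ht r => ?_⟩
  have hvv : ∀ r, v t r ≤ v t' r := fun r =>
    le_of_tendsto_of_tendsto' (hv t r) (hv t' r) fun n => shootIter_mono hf hg ht n r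
  refine ⟨hvv r, ?_⟩
  rw [(hu t).eq_u, (hu t').eq_u]
  exact sub_le_sub_left (radInt_mono (hf.cont.comp (hu t).cont_v) (hf.cont.comp (hu t').cont_v)
    fun x _ => hf.mono (hvv x)) 1

/-- Limits of shooting solutions along monotone sequences of parameters. -/
theorem exists_shoot_limit (hf : IsNonlin f) (hg : IsNonlin g) {u v : ℝ → ℝ → ℝ}
    (hS : ∀ t, IsShoot d f g t (u t) (v t))
    (hmono : ∀ t t', t ≤ t' → ∀ r, v t r ≤ v t' r ∧ u t' r ≤ u t r)
    {tn : ℕ → ℝ} (ht : Monotone tn ∨ Antitone tn) (lt : Tendsto tn atTop (𝓝 t)) :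
    ∃ u' v', IsShoot d f g t u' v' ∧ (∀ x, Tendsto (fun n => u (tn n) x) atTop (𝓝 (u' x))) ∧
      ∀ x, Tendsto (fun n => v (tn n) x) atTop (𝓝 (v' x)) := by
  obtain ⟨T, hT⟩ := lt.abs.bddAbove_range
  have hT' : ∀ n, |tn n| ≤ T := fun n => hT ⟨n, rfl⟩
  have hvb : ∀ R n x, |x| ≤ R → |v (tn n) x| ≤ T + g 1 * R ^ 2 / (2 * (d + 1)) :=
    fun R n x hx => by
      rw [(hS _).eq_v]
      exact abs_sub_radInt_le (hg.cont.comp (hS _).cont_u) (fun x => hg.nonneg _)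
        (fun x => hg.mono ((hS _).u_le hf x)) (hT' n) hx
  have hl : ∀ r, ∃ l, Tendsto (fun n => v (tn n) r) atTop (𝓝 l) := fun r => by
    refine exists_tendsto_of_abs_le ?_ fun n => hvb |r| n r le_rfl
    exact ht.imp (fun h m n hmn => (hmono _ _ (h hmn) r).1)
      fun h m n hmn => (hmono _ _ (h hmn) r).1
  choose v' hv' using hl
  obtain ⟨u', hu', lu⟩ := IsShoot.of_tendsto (d := d) hf hg (fun n => (hS (tn n)).cont_v)
    (fun n x => ((hS _).v_le hg x).trans ((le_abs_self _).trans (hT' n)))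
    (fun R => ⟨_, hvb R⟩) (fun n => (hS _).eq_u) (fun n => (hS _).eq_v) lt hv' hv'
  exact ⟨u', v', hu', lu, hv'⟩

end Shooting

section Crossing

open Filter Topology

variable {d : ℕ} {f g : ℝ → ℝ} {t : ℝ} {u v u' v' : ℝ → ℝ}

theorem avg_le_of_monotone {h : ℝ → ℝ} {r : ℝ} (hh : Continuous h) (hm : MonotoneOn h (Ici 0))
    (h0 : 0 ≤ h r) (hr : 0 ≤ r) : avg d h r ≤ h r := by
  have h1 := avg_mono (d := d) (s := r) hh continuous_const (h₂ := fun _ => h r) fun x hx => by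
    rw [uIcc_of_le hr] at hx
    exact hm hx.1 hr hx.2
  rw [avg_const] at h1
  exact h1.trans (div_le_self h0 (by linarith [(Nat.cast_nonneg d : (0:ℝ) ≤ d)]))

theorem radInt_exp_le {L C : ℝ} (hL : 0 ≤ L) (hC : 0 ≤ C) {r : ℝ} (hr : 0 ≤ r) :
    radInt d (fun x => L * (C * Real.exp (L * x ^ 2))) r ≤ C / 2 * Real.exp (L * r ^ 2) := by
  have hc : Continuous fun x : ℝ => L * (C * Real.exp (L * x ^ 2)) := by fun_prop
  have hd : ∀ r : ℝ, HasDerivAt (fun r => C / 2 * Real.exp (L * r ^ 2)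
      - radInt d (fun x => L * (C * Real.exp (L * x ^ 2))) r)
      (C / 2 * (Real.exp (L * r ^ 2) * (L * (2 * r)))
        - r * avg d (fun x => L * (C * Real.exp (L * x ^ 2))) r) r := fun r => by
    refine HasDerivAt.sub (HasDerivAt.const_mul _ (HasDerivAt.exp (HasDerivAt.const_mul _ ?_)))
      (hasDerivAt_radInt hc r)
    simpa using hasDerivAt_pow 2 r
  have hm : MonotoneOn (fun x : ℝ => L * (C * Real.exp (L * x ^ 2))) (Ici 0) :=
    fun x hx y _ hxy => by
      have : x ^ 2 ≤ y ^ 2 := pow_le_pow_left₀ hx hxy 2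
      beta_reduce
      gcongr
  have hmono : MonotoneOn (fun r => C / 2 * Real.exp (L * r ^ 2)
      - radInt d (fun x => L * (C * Real.exp (L * x ^ 2))) r) (Ici 0) := by
    refine monotoneOn_of_deriv_nonneg (convex_Ici 0)
      (fun r _ => (hd r).continuousAt.continuousWithinAt)
      (fun r _ => (hd r).differentiableAt.differentiableWithinAt) fun r hr => ?_
    rw [interior_Ici] at hr
    rw [(hd r).deriv]
    have := mul_le_mul_of_nonneg_left
      (avg_le_of_monotone (d := d) hc hm (by positivity) hr.le) hr.le
    linarith
  have := hmono (mem_Ici.2 le_rfl) hr hr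
  simp only [radInt_zero] at this
  have h1 : 0 ≤ C / 2 * Real.exp (L * 0 ^ 2) := by positivity
  linarith

theorem abs_radInt_sub_radInt_le {h₁ h₂ w : ℝ → ℝ} (c₁ : Continuous h₁) (c₂ : Continuous h₂)
    (cw : Continuous w) {r : ℝ} (hr : 0 ≤ r) (hw : ∀ x ∈ Icc 0 r, |h₁ x - h₂ x| ≤ w x) :
    |radInt d h₁ r - radInt d h₂ r| ≤ radInt d w r := by
  rw [← radInt_sub c₁ c₂]
  have h1 := radInt_mono (d := d) (r := r) (h₁ := fun x => h₁ x - h₂ x) (c₁.sub c₂) cw fun x hx =>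
    (abs_le.1 (hw x (by rwa [uIcc_of_le hr] at hx))).2
  have h2 := radInt_mono (d := d) (r := r) (h₁ := fun x => h₂ x - h₁ x) (c₂.sub c₁) cw fun x hx => by
    have := (abs_le.1 (hw x (by rwa [uIcc_of_le hr] at hx))).1
    linarith
  rw [radInt_sub c₂ c₁] at h2
  rw [radInt_sub c₁ c₂] at h1 ⊢
  exact abs_le.2 ⟨by linarith, h1⟩

/-- Uniqueness for the integral system where the nonlinearities are Lipschitz. -/
theorem IsShoot.eqOn (h1 : IsShoot d f g t u v) (h2 : IsShoot d f g t u' v') (cf : Continuous f)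
    (cg : Continuous g) {L r₁ : ℝ} (hL : 0 ≤ L) (hr₁ : 0 ≤ r₁)
    (hLf : ∀ r ∈ Icc 0 r₁, |f (v r) - f (v' r)| ≤ L * |v r - v' r|)
    (hLg : ∀ r ∈ Icc 0 r₁, |g (u r) - g (u' r)| ≤ L * |u r - u' r|) :
    ∀ r ∈ Icc 0 r₁, u r = u' r ∧ v r = v' r := by
  have c1 := h1.cont_u
  have c2 := h1.cont_v
  have c3 := h2.cont_u
  have c4 := h2.cont_v
  obtain ⟨s, hs, hmax⟩ := isCompact_Icc.exists_isMaxOn (nonempty_Icc.2 hr₁)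
    (f := fun r => (|u r - u' r| + |v r - v' r|) * Real.exp (-((2 * L) * r ^ 2)))
    (Continuous.continuousOn (by fun_prop))
  set C := (|u s - u' s| + |v s - v' s|) * Real.exp (-((2 * L) * s ^ 2)) with hCdef
  have hC0 : 0 ≤ C := by positivity
  have hw : ∀ r ∈ Icc 0 r₁, |u r - u' r| + |v r - v' r| ≤ C * Real.exp ((2 * L) * r ^ 2) :=
    fun r hr => by
      have := hmax hr
      simp only [mem_ofPred_eq] at this
      rw [ Real.exp_neg, ← div_eq_mul_inv, div_le_iff₀ (Real.exp_pos _)] at this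
      exact this
  have key : |u s - u' s| + |v s - v' s| ≤ C / 2 * Real.exp ((2 * L) * s ^ 2) := by
    have hce : Continuous fun x : ℝ => L * (C * Real.exp ((2 * L) * x ^ 2)) := by fun_prop
    have e1 : |u s - u' s| ≤ radInt d (fun x => L * (C * Real.exp ((2 * L) * x ^ 2))) s := by
      rw [h1.eq_u, h2.eq_u, sub_sub_sub_cancel_left, abs_sub_comm]
      refine abs_radInt_sub_radInt_le (cf.comp c2) (cf.comp c4) hce hs.1 fun x hx => ?_
      have hx' : x ∈ Icc 0 r₁ := ⟨hx.1, hx.2.trans hs.2⟩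
      exact (hLf x hx').trans (mul_le_mul_of_nonneg_left
        (by linarith [hw x hx', abs_nonneg (u x - u' x)]) hL)
    have e2 : |v s - v' s| ≤ radInt d (fun x => L * (C * Real.exp ((2 * L) * x ^ 2))) s := by
      rw [h1.eq_v, h2.eq_v, sub_sub_sub_cancel_left, abs_sub_comm]
      refine abs_radInt_sub_radInt_le (cg.comp c1) (cg.comp c3) hce hs.1 fun x hx => ?_
      have hx' : x ∈ Icc 0 r₁ := ⟨hx.1, hx.2.trans hs.2⟩
      exact (hLg x hx').trans (mul_le_mul_of_nonneg_left
        (by linarith [hw x hx', abs_nonneg (v x - v' x)]) hL)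
    have e3 := radInt_exp_le (d := d) (L := 2 * L) (C := C / 2) (by positivity) (by positivity)
      hs.1
    have e4 : (fun x : ℝ => 2 * L * (C / 2 * Real.exp (2 * L * x ^ 2)))
        = fun x => L * (C * Real.exp ((2 * L) * x ^ 2)) := by funext x; ring
    rw [e4] at e3
    linarith
  have hC : C = 0 := by
    have h3 : C ≤ C / 2 := by
      have h4 := mul_le_mul_of_nonneg_right key (Real.exp_pos (-((2 * L) * s ^ 2))).le
      rwa [mul_assoc (C / 2), ← Real.exp_add, add_neg_cancel, Real.exp_zero, mul_one] at h4
    linarith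
  intro r hr
  have := hw r hr
  rw [hC, zero_mul] at this
  have a1 := abs_nonneg (u r - u' r)
  have a2 := abs_nonneg (v r - v' r)
  exact ⟨sub_eq_zero.1 (abs_eq_zero.1 (by linarith)), sub_eq_zero.1 (abs_eq_zero.1 (by linarith))⟩

theorem exists_small_shoot (hf : IsNonlin f) (hg : IsNonlin g) :
    ∃ t > 0, ∀ u v, IsShoot d f g t u v → v 1 < 0 ∧ 0 < u 1 := by
  have hg2 : 0 < g (1 / 2) / (2 * (d + 1)) := div_pos (hg.pos _ (by norm_num)) (by positivity)
  have e1 : ∀ᶠ t in 𝓝[>] (0:ℝ), f t < 1 :=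
    (hf.cont.tendsto 0).mono_left nhdsWithin_le_nhds |>.eventually_lt_const
      (by rw [hf.eq_zero 0 le_rfl]; exact one_pos)
  have e2 : ∀ᶠ t in 𝓝[>] (0:ℝ), t < g (1 / 2) / (2 * (d + 1)) :=
    (tendsto_id.mono_left nhdsWithin_le_nhds).eventually_lt_const hg2
  obtain ⟨t, ⟨h1, h2⟩, h3⟩ := ((e1.and e2).and self_mem_nhdsWithin).exists
  refine ⟨t, h3, fun u v h => ?_⟩
  have hu : ∀ x ∈ uIcc (0:ℝ) 1, 1 / 2 ≤ u x := fun x hx => by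
    have hd : (0:ℝ) ≤ d := Nat.cast_nonneg d
    have hb := radInt_le_of_le (d := d) (h := fun x => f (v x)) (hf.cont.comp h.cont_v) (M := 1)
      (fun y => (hf.mono (h.v_le hg y)).trans h1.le) x
    have hx1 : x ^ 2 ≤ 1 := by
      rw [uIcc_of_le zero_le_one] at hx
      exact pow_le_one₀ hx.1 hx.2
    have : 1 * x ^ 2 / (2 * ((d:ℝ) + 1)) ≤ 1 / 2 := by
      rw [div_le_iff₀ (by positivity)]; linarith
    rw [h.eq_u]
    linarith
  refine ⟨?_, by linarith [hu 1 right_mem_uIcc]⟩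
  have := radInt_mono (d := d) (r := 1) (h₂ := fun x => g (u x)) continuous_const (hg.cont.comp h.cont_u)
    (fun x hx => hg.mono (hu x hx))
  rw [radInt_const] at this
  rw [h.eq_v]
  have h4 : g (1 / 2) * 1 ^ 2 / (2 * ((d:ℝ) + 1)) = g (1 / 2) / (2 * (d + 1)) := by ring
  linarith [this]

theorem exists_large_shoot (hf : IsNonlin f) (hg : IsNonlin g) (hft : Tendsto f atTop atTop) :
    ∃ t > 0, ∀ u v, IsShoot d f g t u v → u 1 < 0 ∧ 0 < v 1 := by
  obtain ⟨s, ⟨h1, h2⟩, h3⟩ := ((hft.eventually_gt_atTop (2 * ((d:ℝ) + 1))).and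
    (eventually_ge_atTop (g 1)) |>.and (eventually_gt_atTop 0)).exists
  refine ⟨2 * s, by linarith, fun u v h => ?_⟩
  have hd : (0:ℝ) ≤ d := Nat.cast_nonneg d
  have hv : ∀ x ∈ uIcc (0:ℝ) 1, s ≤ v x := fun x hx => by
    have hb := radInt_le_of_le (d := d) (h := fun x => g (u x)) (hg.cont.comp h.cont_u) (M := g 1)
      (fun y => hg.mono (h.u_le hf y)) x
    have hx1 : x ^ 2 ≤ 1 := by
      rw [uIcc_of_le zero_le_one] at hx
      exact pow_le_one₀ hx.1 hx.2
    have : g 1 * x ^ 2 / (2 * ((d:ℝ) + 1)) ≤ g 1 := by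
      rw [div_le_iff₀ (by positivity)]
      exact mul_le_mul_of_nonneg_left (by linarith) (hg.nonneg 1)
    rw [h.eq_v]
    linarith
  refine ⟨?_, by linarith [hv 1 right_mem_uIcc]⟩
  have := radInt_mono (d := d) (r := 1) (h₂ := fun x => f (v x)) continuous_const (hf.cont.comp h.cont_v)
    (fun x hx => hf.mono (hv x hx))
  rw [radInt_const] at this
  rw [h.eq_u]
  have h4 : 1 < f s * 1 ^ 2 / (2 * ((d:ℝ) + 1)) := by
    rw [lt_div_iff₀ (by positivity)]; linarith
  linarith [this]

/-- At the critical shooting parameter there are two ordered solutions, one whose first component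
does not cross zero first and one whose second component does not cross zero first. -/
theorem exists_critical_shoot (d : ℕ) (hf : IsNonlin f) (hg : IsNonlin g)
    (hft : Tendsto f atTop atTop) :
    ∃ t u v u' v', IsShoot d f g t u v ∧ IsShoot d f g t u' v' ∧ (∀ r, u r ≤ u' r) ∧
      (∀ r, 0 ≤ r → ¬ (v r < 0 ∧ 0 < u r)) ∧ ∀ r, 0 ≤ r → ¬ (u' r < 0 ∧ 0 < v' r) := by
  obtain ⟨u, v, hS, hmono⟩ := exists_shoot d hf hg
  set A : Set ℝ := {t | ∃ r, 0 ≤ r ∧ u t r < 0 ∧ 0 < v t r} with hA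
  have hup : ∀ t t', t ≤ t' → t ∈ A → t' ∈ A := fun t t' h ⟨r, hr, h1, h2⟩ =>
    ⟨r, hr, (hmono t t' h r).2.trans_lt h1, h2.trans_le (hmono t t' h r).1⟩
  have hAB : ∀ t ∈ A, ∀ r, 0 ≤ r → ¬ (v t r < 0 ∧ 0 < u t r) := fun t ⟨r, hr, h1, h2⟩ s hs h => by
    rcases le_total r s with hrs | hrs
    · exact absurd ((hS t).antitoneOn_u hf hr hs hrs) (by linarith [h.2])
    · exact absurd ((hS t).antitoneOn_v hg hs hr hrs) (by linarith [h.1])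
  obtain ⟨t₁, -, ht₁⟩ := exists_small_shoot (d := d) hf hg
  obtain ⟨t₂, -, ht₂⟩ := exists_large_shoot (d := d) hf hg hft
  have hne : A.Nonempty := ⟨t₂, 1, zero_le_one, ht₂ _ _ (hS t₂)⟩
  have hbdd : BddBelow A := ⟨t₁, fun t ht => by
    by_contra hlt
    exact hAB t₁ (hup t t₁ (not_le.1 hlt).le ht) 1 zero_le_one (ht₁ _ _ (hS t₁))⟩
  obtain ⟨a, am, alt, al⟩ := exists_seq_strictMono_tendsto (sInf A)
  obtain ⟨b, bm, blt, bl⟩ := exists_seq_strictAnti_tendsto (sInf A)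
  obtain ⟨u', v', hs', lu', lv'⟩ := exists_shoot_limit hf hg hS hmono (Or.inl am.monotone) al
  obtain ⟨u'', v'', hs'', lu'', lv''⟩ := exists_shoot_limit hf hg hS hmono (Or.inr bm.antitone) bl
  refine ⟨sInf A, u'', v'', u', v', hs'', hs', fun r => ?_, fun r hr h => ?_, fun r hr h => ?_⟩
  · exact le_of_tendsto_of_tendsto' (lu'' r) (lu' r) fun n =>
      (hmono _ _ ((alt n).trans (blt n)).le r).2
  · obtain ⟨n, h1, h2⟩ := (((lv'' r).eventually_lt_const h.1).and
      ((lu'' r).eventually_const_lt h.2)).exists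
    obtain ⟨s, hs, hlt⟩ := exists_lt_of_csInf_lt hne (blt n)
    exact hAB _ (hup s _ hlt.le hs) r hr ⟨h1, h2⟩
  · obtain ⟨n, h1, h2⟩ := (((lu' r).eventually_lt_const h.1).and
      ((lv' r).eventually_const_lt h.2)).exists
    exact notMem_of_lt_csInf (alt n) hbdd ⟨r, hr, h1, h2⟩

end Crossing

section RadialPohozaev

open Filter Topology

variable {d : ℕ} {p q t : ℝ} {u v : ℝ → ℝ}

/-- The truncated power `x ↦ (x⁺)^p`. -/
def posPow (p x : ℝ) : ℝ := max x 0 ^ p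

theorem posPow_of_pos {x : ℝ} (hx : 0 < x) : posPow p x = x ^ p := by
  rw [posPow, max_eq_left hx.le]

theorem isNonlin_posPow (hp : 0 < p) : IsNonlin (posPow p) where
  cont := (continuous_id.max continuous_const).rpow_const fun _ => Or.inr hp.le
  mono := fun x y hxy => Real.rpow_le_rpow (le_max_right _ _) (max_le_max_right 0 hxy) hp.le
  eq_zero := fun x hx => by rw [posPow, max_eq_right hx, Real.zero_rpow hp.ne']
  pos := fun x hx => by rw [posPow_of_pos hx]; exact Real.rpow_pos_of_pos hx p

theorem tendsto_posPow_atTop (hp : 0 < p) : Tendsto (posPow p) atTop atTop :=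
  (tendsto_rpow_atTop hp).congr' ((eventually_gt_atTop 0).mono fun _ hx => (posPow_of_pos hx).symm)

theorem exists_lipschitz_posPow {κ M : ℝ} (h : 0 < κ ∨ 1 ≤ p) :
    ∃ L, 0 ≤ L ∧ ∀ x y, x ∈ Icc κ M → y ∈ Icc κ M →
      |posPow p x - posPow p y| ≤ L * |x - y| := by
  have hcd : ContDiffOn ℝ 1 (fun x : ℝ => x ^ p) (Icc (max κ 0) (max M 0)) := fun x hx => by
    refine (Real.contDiffAt_rpow_const (n := 1) ?_).contDiffWithinAt
    rcases h with h | h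
    · exact Or.inl (h.trans_le ((le_max_left _ _).trans hx.1)).ne'
    · exact Or.inr (by simpa using h)
  obtain ⟨K, hK⟩ := hcd.exists_lipschitzOnWith one_ne_zero (convex_Icc _ _) isCompact_Icc
  have hmem : ∀ x ∈ Icc κ M, max x 0 ∈ Icc (max κ 0) (max M 0) := fun x hx =>
    ⟨max_le_max_right 0 hx.1, max_le_max_right 0 hx.2⟩
  refine ⟨K, K.2, fun x y hx hy => ?_⟩
  have := hK.dist_le_mul _ (hmem x hx) _ (hmem y hy)
  rw [Real.dist_eq, Real.dist_eq] at this
  exact this.trans (mul_le_mul_of_nonneg_left (abs_max_sub_max_le_abs x y 0) K.2)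

theorem hasDerivAt_pow_mul_avg {h : ℝ → ℝ} (hh : Continuous h) (r : ℝ) :
    HasDerivAt (fun r => r ^ (d + 1) * avg d h r) (r ^ d * h r) r := by
  have h1 : ∀ r : ℝ, r ^ (d + 1) * avg d h r = ∫ s in (0:ℝ)..r, s ^ d * h s := fun r => by
    have := intervalIntegral.smul_integral_comp_mul_left (E := ℝ) (a := (0:ℝ)) (b := 1)
      (fun s : ℝ => s ^ d * h s) r
    rw [mul_zero, mul_one, smul_eq_mul] at this
    rw [← this, avg, pow_succ', mul_assoc, ← intervalIntegral.integral_const_mul]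
    simp only [mul_pow, mul_assoc, mul_comm r]
    congr 1
    refine intervalIntegral.integral_congr fun x _ => ?_
    ring
  rw [funext h1]
  exact (((continuous_pow d).mul hh).integral_hasStrictDerivAt 0 r).hasDerivAt

theorem hasDerivAt_avg {h : ℝ → ℝ} (hh : Continuous h) {r : ℝ} (hr : 0 < r) :
    HasDerivAt (avg d h) ((h r - (d + 1) * avg d h r) / r) r := by
  have h1 := (hasDerivAt_pow_mul_avg (d := d) hh r).div (hasDerivAt_pow (d + 1) r)
    (pow_ne_zero _ hr.ne')
  refine (h1.congr_of_eventuallyEq ?_).congr_deriv ?_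
  · filter_upwards [lt_mem_nhds hr] with x hx
    have : x ^ (d + 1) ≠ 0 := pow_ne_zero _ hx.ne'
    simp only [Pi.div_apply]
    field_simp
  · have : r ^ d ≠ 0 := pow_ne_zero _ hr.ne'
    push_cast
    field_simp
    ring

/-- A radial Pohozaev argument: in the (super)critical range the two components of a positive
radial solution cannot vanish simultaneously for the first time. -/
theorem IsShoot.not_simultaneous_zero (h : IsShoot d (posPow p) (posPow q) t u v) (hp : 0 < p)
    (hq : 0 < q) (hpq : ((d:ℝ) + 1) / (p + 1) + ((d:ℝ) + 1) / (q + 1) ≤ d - 1) {r₀ : ℝ}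
    (hr₀ : 0 < r₀) (hu : ∀ r, 0 ≤ r → r < r₀ → 0 < u r) (hv : ∀ r, 0 ≤ r → r < r₀ → 0 < v r)
    (hu0 : u r₀ = 0) (hv0 : v r₀ = 0) : False := by
  have Nf := isNonlin_posPow hp
  have Ng := isNonlin_posPow hq
  have cu := h.cont_u
  have cv := h.cont_v
  have cf : Continuous fun x => posPow p (v x) := Nf.cont.comp cv
  have cg : Continuous fun x => posPow q (u x) := Ng.cont.comp cu
  set P := avg d fun x => posPow p (v x) with hP
  set Q := avg d fun x => posPow q (u x) with hQ
  have cP : Continuous P := continuous_avg cf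
  have cQ : Continuous Q := continuous_avg cg
  set a := ((d:ℝ) + 1) / (p + 1) with ha
  set b := (d:ℝ) - 1 - a with hb
  set E : ℝ → ℝ := fun r => r ^ (d + 3) * (P r * Q r)
    + r ^ (d + 1) * (v r ^ (p + 1) / (p + 1) + u r ^ (q + 1) / (q + 1))
    - a * (v r * (r ^ (d + 1) * P r)) - b * (u r * (r ^ (d + 1) * Q r)) with hE
  have cvp : Continuous fun r => v r ^ (p + 1) := cv.rpow_const fun _ => Or.inr (by linarith)
  have cuq : Continuous fun r => u r ^ (q + 1) := cu.rpow_const fun _ => Or.inr (by linarith)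
  have cE : Continuous E := by fun_prop
  have hdu : ∀ r, HasDerivAt u (-(r * P r)) r := fun r => by
    rw [funext h.eq_u]
    exact (hasDerivAt_radInt cf r).const_sub 1
  have hdv : ∀ r, HasDerivAt v (-(r * Q r)) r := fun r => by
    rw [funext h.eq_v]
    exact (hasDerivAt_radInt cg r).const_sub t
  have hdE : ∀ r, 0 < r → r < r₀ →
      HasDerivAt E (-(r ^ d * ((b - ((d:ℝ) + 1) / (q + 1)) * u r ^ (q + 1)))) r :=
    fun r hr hrr => by
    have pu := hu r hr.le hrr
    have pv := hv r hr.le hrr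
    have d1 := (hdv r).rpow_const (p := p + 1) (Or.inl pv.ne')
    have d2 := (hdu r).rpow_const (p := q + 1) (Or.inl pu.ne')
    have dP : HasDerivAt P _ r := hasDerivAt_avg cf hr
    have dQ : HasDerivAt Q _ r := hasDerivAt_avg cg hr
    have mP : HasDerivAt (fun r => r ^ (d + 1) * P r) _ r := hasDerivAt_pow_mul_avg cf r
    have mQ : HasDerivAt (fun r => r ^ (d + 1) * Q r) _ r := hasDerivAt_pow_mul_avg cg r
    have D := ((((hasDerivAt_pow (d + 3) r).mul (dP.mul dQ)).add
      ((hasDerivAt_pow (d + 1) r).mul ((d1.div_const (p + 1)).add (d2.div_const (q + 1))))).sub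
      (((hdv r).mul mP).const_mul a)).sub (((hdu r).mul mQ).const_mul b)
    refine D.congr_deriv ?_
    simp only [← hP, ← hQ, Pi.mul_apply, Pi.add_apply, posPow_of_pos pu, posPow_of_pos pv]
    rw [add_sub_cancel_right, add_sub_cancel_right, Real.rpow_add_one pv.ne',
      Real.rpow_add_one pu.ne', hb, ha]
    push_cast
    have : p + 1 ≠ 0 := by positivity
    have : q + 1 ≠ 0 := by positivity
    field_simp
    ring
  have hanti : AntitoneOn E (Icc 0 r₀) := by
    refine antitoneOn_of_deriv_nonpos (convex_Icc 0 r₀) cE.continuousOn (fun r hr => ?_)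
      fun r hr => ?_
    all_goals rw [interior_Icc] at hr
    · exact (hdE r hr.1 hr.2).differentiableAt.differentiableWithinAt
    · rw [(hdE r hr.1 hr.2).deriv, neg_nonpos]
      exact mul_nonneg (pow_nonneg hr.1.le _) (mul_nonneg (by linarith)
        (Real.rpow_nonneg (hu r hr.1.le hr.2).le _))
  have hle := hanti (left_mem_Icc.2 hr₀.le) (right_mem_Icc.2 hr₀.le) hr₀.le
  have hP0 : 0 < P r₀ := avg_pos cf hr₀ fun x hx hxr => Nf.pos _ (hv x hx hxr)
  have hQ0 : 0 < Q r₀ := avg_pos cg hr₀ fun x hx hxr => Ng.pos _ (hu x hx hxr)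
  have h0 : E 0 = 0 := by simp [hE]
  have h1 : E r₀ = r₀ ^ (d + 3) * (P r₀ * Q r₀) := by
    have : p + 1 ≠ 0 := by positivity
    have : q + 1 ≠ 0 := by positivity
    simp [Real.zero_rpow, *]
  rw [h0, h1] at hle
  have : 0 < r₀ ^ (d + 3) * (P r₀ * Q r₀) := by positivity
  linarith

/-- Positive radial solutions exist globally in the (super)critical range. -/
theorem exists_pos_shoot (hp : 1 ≤ p) (hq : 0 < q)
    (hpq : ((d:ℝ) + 1) / (p + 1) + ((d:ℝ) + 1) / (q + 1) ≤ d - 1) :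
    ∃ t u v, IsShoot d (posPow p) (posPow q) t u v ∧ ∀ r, 0 ≤ r → 0 < u r ∧ 0 < v r := by
  have hp0 : 0 < p := by linarith
  have Nf := isNonlin_posPow hp0
  have Ng := isNonlin_posPow hq
  obtain ⟨t, u, v, u', v', h, h', hle, hvu, huv⟩ :=
    exists_critical_shoot d Nf Ng (tendsto_posPow_atTop hp0)
  have cf : Continuous fun x => posPow p (v' x) := Nf.cont.comp h'.cont_v
  have cg : Continuous fun x => posPow q (u x) := Ng.cont.comp h.cont_u
  have hvdec : ∀ r s, 0 ≤ r → r < s → (∀ x, 0 ≤ x → x < s → 0 < u x) → v s < v r :=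
    fun r s hr hrs hpos => by
      rw [h.eq_v, h.eq_v]
      exact sub_lt_sub_left (radInt_lt cg hr hrs fun x hx hxs => Ng.pos _ (hpos x hx hxs)) t
  by_cases hpos : ∀ r, 0 ≤ r → 0 < u r
  · refine ⟨t, u, v, h, fun r hr => ⟨hpos r hr, ?_⟩⟩
    have h1 : 0 ≤ v (r + 1) := not_lt.1 fun hlt =>
      hvu (r + 1) (by linarith) ⟨hlt, hpos _ (by linarith)⟩
    exact h1.trans_lt (hvdec r (r + 1) hr (by linarith) fun x hx _ => hpos x hx)
  exfalso
  push Not at hpos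
  set Z : Set ℝ := {r | 0 ≤ r ∧ u r ≤ 0} with hZ
  have hZne : Z.Nonempty := hpos
  have hZb : BddBelow Z := ⟨0, fun r hr => hr.1⟩
  have hZc : IsClosed Z := isClosed_Ici.inter (isClosed_le h.cont_u continuous_const)
  obtain ⟨hr0, hur0⟩ := hZc.csInf_mem hZne hZb
  set r₀ := sInf Z with hr₀
  have hupos : ∀ r, 0 ≤ r → r < r₀ → 0 < u r := fun r hr hrr => not_le.1 fun hle =>
    notMem_of_lt_csInf hrr hZb ⟨hr, hle⟩
  have hr0' : 0 < r₀ := by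
    refine lt_of_le_of_ne hr0 fun h0 => ?_
    rw [← h0, h.zero_u] at hur0
    linarith
  have hmemlt : ∀ᶠ r in 𝓝[<] r₀, 0 ≤ r ∧ r < r₀ := by
    filter_upwards [Ioo_mem_nhdsLT hr0'] with r hr
    exact ⟨hr.1.le, hr.2⟩
  have hur0' : u r₀ = 0 := le_antisymm hur0 (ge_of_tendsto
    (h.cont_u.continuousAt.mono_left nhdsWithin_le_nhds)
    (hmemlt.mono fun r hr => (hupos r hr.1 hr.2).le))
  have hv0 : 0 ≤ v r₀ := ge_of_tendsto (h.cont_v.continuousAt.mono_left nhdsWithin_le_nhds)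
    (hmemlt.mono fun r hr => not_lt.1 fun hlt => hvu r hr.1 ⟨hlt, hupos r hr.1 hr.2⟩)
  have hvpos : ∀ r, 0 ≤ r → r < r₀ → 0 < v r := fun r hr hrr =>
    hv0.trans_lt (hvdec r r₀ hr hrr hupos)
  have heq : ∀ r, 0 ≤ r → r < r₀ → u r = u' r ∧ v r = v' r := fun r₁ h1 h1' => by
    have bdd : ∀ w : ℝ → ℝ, Continuous w → ∃ M, ∀ r ∈ Icc 0 r₁, |w r| ≤ M := fun w hw =>
      isCompact_Icc.exists_bound_of_continuousOn hw.continuousOn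
    obtain ⟨M₁, hM₁⟩ := bdd v h.cont_v
    obtain ⟨M₂, hM₂⟩ := bdd v' h'.cont_v
    obtain ⟨L₁, hL₁, hf⟩ := exists_lipschitz_posPow (p := p) (κ := -max M₁ M₂) (M := max M₁ M₂)
      (Or.inr hp)
    obtain ⟨L₂, hL₂, hg⟩ := exists_lipschitz_posPow (p := q) (κ := u r₁) (M := 1)
      (Or.inl (hupos r₁ h1 h1'))
    refine h.eqOn h' Nf.cont Ng.cont (L := max L₁ L₂) (le_max_of_le_left hL₁) h1
      (fun r hr => ?_) (fun r hr => ?_) r₁ ⟨h1, le_rfl⟩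
    · refine (hf _ _ (abs_le.1 ((hM₁ r hr).trans (le_max_left _ _)))
        (abs_le.1 ((hM₂ r hr).trans (le_max_right _ _)))).trans ?_
      exact mul_le_mul_of_nonneg_right (le_max_left _ _) (abs_nonneg _)
    · have hκ : u r₁ ≤ u r := h.antitoneOn_u Nf hr.1 h1 hr.2
      refine (hg _ _ ⟨hκ, h.u_le Nf r⟩ ⟨hκ.trans (hle r), h'.u_le Nf r⟩).trans ?_
      exact mul_le_mul_of_nonneg_right (le_max_right _ _) (abs_nonneg _)
  have hlim : ∀ w w' : ℝ → ℝ, Continuous w → Continuous w' →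
      (∀ r, 0 ≤ r → r < r₀ → w r = w' r) → w r₀ = w' r₀ := fun w w' cw cw' hw =>
    tendsto_nhds_unique_of_eventuallyEq (cw.continuousAt.mono_left nhdsWithin_le_nhds)
      (cw'.continuousAt.mono_left nhdsWithin_le_nhds) (hmemlt.mono fun r hr => hw r hr.1 hr.2)
  have hu' : u' r₀ = 0 :=
    (hlim u u' h.cont_u h'.cont_u fun r a b => (heq r a b).1).symm.trans hur0'
  have hv' := hlim v v' h.cont_v h'.cont_v fun r a b => (heq r a b).2
  rcases hv0.eq_or_lt with hV | hV
  · exact h.not_simultaneous_zero hp0 hq hpq hr0' hupos hvpos hur0' hV.symm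
  · rw [hv'] at hV
    have hev : ∀ᶠ s in 𝓝[>] r₀, 0 < v' s :=
      (h'.cont_v.continuousAt.mono_left nhdsWithin_le_nhds).eventually_const_lt hV
    obtain ⟨s, hs, hrs⟩ := (hev.and self_mem_nhdsWithin).exists
    have hs0 : 0 ≤ s := hr0.trans (le_of_lt hrs)
    refine huv s hs0 ⟨?_, hs⟩
    have h1 := radInt_lt (d := d) cf hr0 hrs fun x hx hxs =>
      Nf.pos _ (hs.trans_le (h'.antitoneOn_v Ng hx hs0 hxs.le))
    have h2 := h'.eq_u r₀
    rw [h'.eq_u s]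
    linarith

end RadialPohozaev

section RadialLift

open Filter Topology

variable {N d : ℕ}

/-- Weighted averages along rays inherit smoothness. -/
theorem contDiff_ray_average {E : Type} [NormedAddCommGroup E] [NormedSpace ℝ E]
    [FiniteDimensional ℝ E] (n : ℕ) {G : Type} [NormedAddCommGroup G] [NormedSpace ℝ G]
    (m : ℕ) {h : E → G} (hh : ContDiff ℝ n h) :
    ContDiff ℝ n fun x => ∫ τ in (0:ℝ)..1, τ ^ m • h (τ • x) := by
  have : ProperSpace E := FiniteDimensional.proper ℝ E
  induction n generalizing G m with
  | zero =>
    have hc := hh.continuous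
    refine contDiff_zero.2 (intervalIntegral.continuous_parametric_intervalIntegral_of_continuous'
      (f := fun x τ => τ ^ m • h (τ • x)) ?_ 0 1)
    fun_prop
  | succ n ih =>
    have hc := hh.continuous
    have hd : ContDiff ℝ n (fderiv ℝ h) := hh.fderiv_right (by norm_cast)
    have hdc := hd.continuous
    refine contDiff_succ_iff_hasFDerivAt.2 ⟨_, ih (m + 1) hd, fun x => ?_⟩
    obtain ⟨C, hC⟩ := (isCompact_closedBall (0:E) (‖x‖ + 1)).exists_bound_of_continuousOn
      hdc.continuousOn
    refine (intervalIntegral.hasFDerivAt_integral_of_dominated_of_fderiv_le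
      (F := fun x (τ : ℝ) => τ ^ m • h (τ • x))
      (F' := fun x (τ : ℝ) => τ ^ (m + 1) • fderiv ℝ h (τ • x)) (bound := fun _ => C)
      (ball_mem_nhds x one_pos) (Eventually.of_forall fun y => ?_) ?_ ?_
      (Eventually.of_forall fun τ hτ y hy => ?_) intervalIntegrable_const
      (Eventually.of_forall fun τ hτ y hy => ?_))
    · exact Continuous.aestronglyMeasurable (by fun_prop)
    · exact Continuous.intervalIntegrable (by fun_prop) _ _
    · exact Continuous.aestronglyMeasurable (by fun_prop)
    · rw [uIoc_of_le zero_le_one] at hτ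
      have h1 : ‖τ • y‖ ≤ ‖x‖ + 1 := by
        rw [norm_smul, Real.norm_of_nonneg hτ.1.le]
        have h2 := norm_le_norm_add_norm_sub' y x
        rw [mem_ball, dist_eq_norm] at hy
        exact (mul_le_of_le_one_left (norm_nonneg y) hτ.2).trans (by linarith)
      have h3 := hC (τ • y) (by simpa using h1)
      rw [norm_smul, norm_pow, Real.norm_of_nonneg hτ.1.le]
      exact (mul_le_of_le_one_left (norm_nonneg _) (pow_le_one₀ hτ.1.le hτ.2)).trans h3
    · have h1 : HasFDerivAt h (fderiv ℝ h (τ • y)) (τ • y) :=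
        (hh.differentiable (by norm_cast) _).hasFDerivAt
      have h2 := (h1.comp y ((hasFDerivAt_id y).const_smul τ)).const_smul (τ ^ m)
      refine h2.congr_fderiv ?_
      ext z
      simp [pow_succ, smul_smul]

theorem avg_norm_eq (φ : ℝ → ℝ) (x : Euc N) :
    avg d φ ‖x‖ = ∫ τ in (0:ℝ)..1, τ ^ d • φ ‖τ • x‖ := by
  refine intervalIntegral.integral_congr fun τ hτ => ?_
  rw [uIcc_of_le zero_le_one] at hτ
  simp only [norm_smul, Real.norm_of_nonneg hτ.1, smul_eq_mul]

theorem hasFDerivAt_radInt_norm {φ : ℝ → ℝ} (hφ : Continuous φ) (x : Euc N) :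
    HasFDerivAt (fun y : Euc N => radInt d φ ‖y‖) (avg d φ ‖x‖ • innerSL ℝ x) x := by
  rcases eq_or_ne x 0 with rfl | hx
  · have h1 := hasDerivAt_radInt (d := d) hφ 0
    rw [zero_mul, hasDerivAt_iff_isLittleO] at h1
    have h2 := h1.comp_tendsto (tendsto_norm_zero (E := Euc N))
    rw [hasFDerivAt_iff_isLittleO]
    have h3 : (fun y : Euc N => radInt d φ ‖y‖) =o[𝓝 0] fun y : Euc N => ‖y‖ := by
      simpa [Function.comp_def, radInt_zero] using h2
    simpa [radInt_zero] using h3.of_norm_right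
  · have hn : ‖x‖ ≠ 0 := norm_ne_zero_iff.2 hx
    have h1 := ((hasStrictFDerivAt_norm_sq x).hasFDerivAt).sqrt (pow_ne_zero 2 hn)
    simp only [Real.sqrt_sq (norm_nonneg _)] at h1
    refine ((hasDerivAt_radInt (d := d) hφ ‖x‖).comp_hasFDerivAt x h1).congr_fderiv ?_
    ext z
    simp
    field_simp

/-- The radial lift of the radial operator inverts the Laplacian. -/
theorem lap_radInt_norm {φ : ℝ → ℝ} (hφ : Continuous φ)
    (hs : ContDiff ℝ 1 fun x : Euc (d + 1) => φ ‖x‖) (x : Euc (d + 1)) :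
    lap (fun y : Euc (d + 1) => radInt d φ ‖y‖) x = φ ‖x‖ := by
  have hH : ContDiff ℝ 1 fun y : Euc (d + 1) => avg d φ ‖y‖ := by
    simp only [avg_norm_eq]
    exact_mod_cast contDiff_ray_average 1 d hs
  have hHd : Differentiable ℝ fun y : Euc (d + 1) => avg d φ ‖y‖ := hH.differentiable one_ne_zero
  have hC2 : ContDiff ℝ 2 fun y : Euc (d + 1) => radInt d φ ‖y‖ := by
    have : ContDiff ℝ ((1:ℕ) + 1) fun y : Euc (d + 1) => radInt d φ ‖y‖ :=
      contDiff_succ_iff_hasFDerivAt.2 ⟨_, hH.smul (innerSL ℝ).contDiff,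
        hasFDerivAt_radInt_norm hφ⟩
    exact_mod_cast this
  have hpd : ∀ i, pd i (fun y : Euc (d + 1) => radInt d φ ‖y‖)
      = fun y => avg d φ ‖y‖ * y i := fun i => by
    funext y
    rw [pd, (hasFDerivAt_radInt_norm hφ y).fderiv]
    simp [EuclideanSpace.inner_single_right]
  have hray : fderiv ℝ (fun y : Euc (d + 1) => avg d φ ‖y‖) x x
      = φ ‖x‖ - (d + 1) * avg d φ ‖x‖ := by
    rcases eq_or_ne x 0 with rfl | hx
    · have : avg d φ ‖(0:Euc (d + 1))‖ = φ 0 / (d + 1) := by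
        rw [norm_zero, ← avg_const (s := 0)]
        simp [avg]
      rw [map_zero, this, norm_zero]
      field_simp
      ring
    · have hn : 0 < ‖x‖ := norm_pos_iff.2 hx
      have h1 : HasDerivAt (fun s : ℝ => avg d φ ‖s • x‖)
          (fderiv ℝ (fun y : Euc (d + 1) => avg d φ ‖y‖) x x) 1 := by
        have e : HasDerivAt (fun s : ℝ => s • x) x 1 := by
          simpa using (hasDerivAt_id (1:ℝ)).smul_const x
        have h0 : HasFDerivAt (fun y : Euc (d + 1) => avg d φ ‖y‖)
            (fderiv ℝ (fun y : Euc (d + 1) => avg d φ ‖y‖) x) ((1:ℝ) • x) := by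
          rw [one_smul]
          exact (hHd x).hasFDerivAt
        exact h0.comp_hasDerivAt (1:ℝ) e
      have h2 : HasDerivAt (fun s : ℝ => avg d φ ‖s • x‖)
          (φ ‖x‖ - (d + 1) * avg d φ ‖x‖) 1 := by
        have e : HasDerivAt (fun s : ℝ => s * ‖x‖) ‖x‖ 1 := by
          simpa using (hasDerivAt_id (1:ℝ)).mul_const ‖x‖
        have h0 : HasDerivAt (avg d φ) ((φ ‖x‖ - (d + 1) * avg d φ ‖x‖) / ‖x‖) (1 * ‖x‖) := by
          rw [one_mul]
          exact hasDerivAt_avg hφ hn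
        refine ((h0.comp (1:ℝ) e).congr_of_eventuallyEq ?_).congr_deriv
          (div_mul_cancel₀ _ hn.ne')
        filter_upwards [lt_mem_nhds (zero_lt_one' ℝ)] with s hs
        simp [norm_smul, abs_of_pos hs]
      exact h1.unique h2
  rw [lap_eq hC2.contDiffAt]
  simp only [hpd]
  have hsum : ∀ i, pd i (fun y : Euc (d + 1) => avg d φ ‖y‖ * y i) x
      = x i * pd i (fun y : Euc (d + 1) => avg d φ ‖y‖) x + avg d φ ‖x‖ := fun i => by
    rw [pd_mul (hHd x) (differentiableAt_coord i), pd_coord]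
    simp
    ring
  rw [Finset.sum_congr rfl fun i _ => hsum i, Finset.sum_add_distrib, ← fderiv_apply_eq_sum, hray]
  simp

end RadialLift

section LaneEmden

open Filter Topology

variable {d : ℕ} {p q t : ℝ} {u v : ℝ → ℝ}

theorem ContDiff.posPow_comp {n : ℕ} {w : Euc (d + 1) → ℝ} (hw : ContDiff ℝ n w)
    (hpos : ∀ x, 0 < w x) (p : ℝ) : ContDiff ℝ n fun x => posPow p (w x) := by
  have : (fun x => posPow p (w x)) = fun x => w x ^ p := funext fun x => posPow_of_pos (hpos x)
  rw [this]
  exact hw.rpow_const_of_ne fun x => (hpos x).ne'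

theorem contDiff_succ_const_sub_radInt {n : ℕ} {φ w : ℝ → ℝ} (c : ℝ) (hφ : Continuous φ)
    (hs : ContDiff ℝ n fun x : Euc (d + 1) => φ ‖x‖) (hw : ∀ r, w r = c - radInt d φ r) :
    ContDiff ℝ (n + 1) fun x : Euc (d + 1) => w ‖x‖ := by
  simp only [hw]
  have hH : ContDiff ℝ n fun y : Euc (d + 1) => avg d φ ‖y‖ := by
    simp only [avg_norm_eq]
    exact contDiff_ray_average n d hs
  exact contDiff_const.sub (contDiff_succ_iff_hasFDerivAt.2
    ⟨_, hH.smul (innerSL ℝ).contDiff, hasFDerivAt_radInt_norm hφ⟩)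

theorem IsShoot.contDiff (h : IsShoot d (posPow p) (posPow q) t u v) (hp : 0 < p) (hq : 0 < q)
    (hpos : ∀ r, 0 ≤ r → 0 < u r ∧ 0 < v r) (n : ℕ) :
    ContDiff ℝ n (fun x : Euc (d + 1) => u ‖x‖) ∧
      ContDiff ℝ n (fun x : Euc (d + 1) => v ‖x‖) := by
  induction n with
  | zero =>
    exact ⟨contDiff_zero.2 (h.cont_u.comp continuous_norm),
      contDiff_zero.2 (h.cont_v.comp continuous_norm)⟩
  | succ n ih =>
    exact ⟨contDiff_succ_const_sub_radInt 1 ((isNonlin_posPow hp).cont.comp h.cont_v)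
        (ih.2.posPow_comp (fun x => (hpos _ (norm_nonneg x)).2) p) h.eq_u,
      contDiff_succ_const_sub_radInt t ((isNonlin_posPow hq).cont.comp h.cont_u)
        (ih.1.posPow_comp (fun x => (hpos _ (norm_nonneg x)).1) q) h.eq_v⟩

theorem lap_const_sub_radInt {φ w : ℝ → ℝ} (c : ℝ) (hφ : Continuous φ)
    (hs : ContDiff ℝ 1 fun x : Euc (d + 1) => φ ‖x‖) (hw : ∀ r, w r = c - radInt d φ r)
    (hC : ContDiff ℝ 2 fun x : Euc (d + 1) => w ‖x‖) (x : Euc (d + 1)) :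
    -lap (fun y : Euc (d + 1) => w ‖y‖) x = φ ‖x‖ := by
  have e : (fun y : Euc (d + 1) => radInt d φ ‖y‖) = fun y => c - w ‖y‖ := by
    funext y
    rw [hw]
    ring
  have h1 := lap_radInt_norm hφ hs x
  rw [e, lap_sub contDiffAt_const hC.contDiffAt, lap_const, zero_sub] at h1
  exact h1

/-- The Lane–Emden system has bounded positive smooth solutions on and above the critical
hyperbola. -/
theorem exists_isLESol {N : ℕ} (hN : 1 ≤ N) (hp : 1 ≤ p) (hq : 0 < q)
    (hpq : (N:ℝ) / (p + 1) + (N:ℝ) / (q + 1) ≤ N - 2) :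
    ∃ u v : Euc N → ℝ, ContDiff ℝ (⊤ : ℕ∞) u ∧ ContDiff ℝ (⊤ : ℕ∞) v ∧
      (∀ x, 0 < u x) ∧ (∀ x, 0 < v x) ∧
      (∃ M : ℝ, ∀ x, u x ≤ M ∧ v x ≤ M) ∧ IsLESol p q u v := by
  obtain ⟨d, rfl⟩ : ∃ d, N = d + 1 := ⟨N - 1, by omega⟩
  have hp0 : 0 < p := by linarith
  push_cast at hpq
  obtain ⟨t, u, v, h, hpos⟩ := exists_pos_shoot (d := d) hp hq (by linarith)
  have Nf := isNonlin_posPow hp0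
  have Ng := isNonlin_posPow hq
  have hC := h.contDiff hp0 hq hpos
  have hu : ∀ x : Euc (d + 1), 0 < u ‖x‖ := fun x => (hpos _ (norm_nonneg x)).1
  have hv : ∀ x : Euc (d + 1), 0 < v ‖x‖ := fun x => (hpos _ (norm_nonneg x)).2
  have hC1 := hC 1
  have hC2 := hC 2
  refine ⟨fun x => u ‖x‖, fun x => v ‖x‖, contDiff_infty.2 fun n => (hC n).1,
    contDiff_infty.2 fun n => (hC n).2, hu, hv,
    ⟨max 1 t, fun x => ⟨(h.u_le Nf _).trans (le_max_left _ _),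
      (h.v_le Ng _).trans (le_max_right _ _)⟩⟩, fun x => ?_, fun x => ?_⟩
  · rw [lap_const_sub_radInt 1 (Nf.cont.comp h.cont_v)
      (by exact_mod_cast hC1.2.posPow_comp hv p) h.eq_u (by exact_mod_cast hC2.1)]
    simp only [Function.comp_apply, posPow_of_pos (hv x), abs_rpow_sub_one_mul (hv x)]
  · rw [lap_const_sub_radInt t (Ng.cont.comp h.cont_u)
      (by exact_mod_cast hC1.1.posPow_comp hu q) h.eq_v (by exact_mod_cast hC2.2)]
    simp only [Function.comp_apply, posPow_of_pos (hu x), abs_rpow_sub_one_mul (hu x)]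

end LaneEmden

/-- Theorem 1.10 (ii): in the supercritical case with `0 ≤ a - b ≤ (N-2)(p-q)`, if the
Lane–Emden system has no bounded positive smooth solution, then the Hénon–Lane–Emden
system has no positive solution with `u ∈ L^{N/α̃}`. -/
theorem stmt_9 (N : ℕ) (hN : 3 ≤ N) (p q a b : ℝ)
    (hq : 0 < q) (hqp : q ≤ p) (hpq : 1 < p * q)
    (ha : -2 < a) (hb : -2 < b)
    (hsup : ((N : ℝ) + a) / (p + 1) + ((N : ℝ) + b) / (q + 1) < (N : ℝ) - 2)
    (hab : 0 ≤ a - b ∧ a - b ≤ ((N : ℝ) - 2) * (p - q))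
    (hLE : ¬ ∃ u v : Euc N → ℝ, ContDiff ℝ (⊤ : ℕ∞) u ∧ ContDiff ℝ (⊤ : ℕ∞) v ∧
        (∀ x, 0 < u x) ∧ (∀ x, 0 < v x) ∧
        (∃ M : ℝ, ∀ x, u x ≤ M ∧ v x ≤ M) ∧ IsLESol p q u v) :
    ¬ ∃ u v : Euc N → ℝ,
        IsHLESol p q a b u v ∧ (∀ x, 0 < u x) ∧ (∀ x, 0 < v x) ∧
        (∫⁻ x : Euc N, ENNReal.ofReal
            (u x ^ ((N : ℝ) / ((2 * (p + 1) + a + p * b) / (p * q - 1))))) < ⊤ := by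
  rintro ⟨u, v, hsol, hu, hv, hintg⟩
  rcases lt_or_ge ((N:ℝ) / (p + 1) + N / (q + 1)) ((N:ℝ) - 2) with h | h
  · have hp : 1 ≤ p := by nlinarith
    exact hLE (exists_isLESol (by omega) hp hq h.le)
  · exact (hsol.isPosSol hu hv).false_of_integrable hN hq hqp hpq ha hb hsup hab.1 hab.2 h hintg
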